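/- Let p be a polynomial with complex coefficients having at least 3 distinct roots, let ξ be a root of p with immediate basin U_ξ, and let W be a connected component of ℂ \ U_ξ. Then the number of fixed points of the Newton map in W equals the number of poles of the Newton map in W counted with multiplicities; precisely, the number of distinct roots of p lying in W equals the sum, over all z ∈ W with p(z) ≠ 0, of the multiplicity of z as a root of p′ (equivalently, the number of roots of p′ in W, counted with multiplicity, that are not roots of p). -/

import Mathlib

/-- The Newton map of a polynomial `p`: `N_p(z) = z - p(z)/p'(z)`
(with the convention that division by zero yields 0, so `N_p(z) = z` when `p'(z) = 0`). -/
noncomputable def NewtonMap (p : Polynomial ℂ) (z : ℂ) : ℂ :=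
  z - Polynomial.eval z p / Polynomial.eval z (Polynomial.derivative p)

/-- The basin of attraction of `ξ` under the Newton map of `p`:
all points whose orbit under iteration of `N_p` converges to `ξ`. -/
noncomputable def NewtonBasin (p : Polynomial ℂ) (ξ : ℂ) : Set ℂ :=
  {z : ℂ | Filter.Tendsto (fun n => (NewtonMap p)^[n] z) Filter.atTop (nhds ξ)}

/-- The immediate basin of a root `ξ`: the connected component of the basin `B_ξ`
containing `ξ`. -/
noncomputable def NewtonImmediateBasin (p : Polynomial ℂ) (ξ : ℂ) : Set ℂ :=
  connectedComponentIn (NewtonBasin p ξ) ξ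

section
open Complex Set Filter Topology Metric

namespace NW

/-- uniform approximability by polynomials on a set -/
def PA (X : Set ℂ) (f : ℂ → ℂ) : Prop :=
  ∀ ε > 0, ∃ P : Polynomial ℂ, ∀ z ∈ X, ‖f z - P.eval z‖ < ε

/-- approximability on all compact subsets -/
def PAon (Ω : Set ℂ) (f : ℂ → ℂ) : Prop := ∀ X, X ⊆ Ω → IsCompact X → PA X f

/-- every point of the complement lies in an unbounded connected subset of the complement -/
def NoHole (Ω : Set ℂ) : Prop :=
  ∀ a, a ∉ Ω → ∃ C, IsPreconnected C ∧ ¬ Bornology.IsBounded C ∧ C ⊆ Ωᶜ ∧ a ∈ C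

lemma PA.poly (X : Set ℂ) (P : Polynomial ℂ) : PA X (fun z => P.eval z) :=
  fun ε hε => ⟨P, fun z _ => by simpa using hε⟩

lemma PA.congr {X : Set ℂ} {f g : ℂ → ℂ} (hf : PA X f) (h : ∀ z ∈ X, f z = g z) : PA X g := by
  intro ε hε
  obtain ⟨P, hP⟩ := hf ε hε
  exact ⟨P, fun z hz => by rw [← h z hz]; exact hP z hz⟩

lemma PA.mono {X Y : Set ℂ} {f : ℂ → ℂ} (hf : PA X f) (h : Y ⊆ X) : PA Y f := by
  intro ε hε
  obtain ⟨P, hP⟩ := hf ε hε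
  exact ⟨P, fun z hz => hP z (h hz)⟩

lemma PA.of_approx {X : Set ℂ} {f : ℂ → ℂ}
    (h : ∀ ε > 0, ∃ g, PA X g ∧ ∀ z ∈ X, ‖f z - g z‖ < ε) : PA X f := by
  intro ε hε
  obtain ⟨g, hg, h1⟩ := h (ε/2) (by positivity)
  obtain ⟨P, hP⟩ := hg (ε/2) (by positivity)
  refine ⟨P, fun z hz => ?_⟩
  calc ‖f z - P.eval z‖ = ‖(f z - g z) + (g z - P.eval z)‖ := by ring_nf
    _ ≤ ‖f z - g z‖ + ‖g z - P.eval z‖ := norm_add_le _ _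
    _ < ε := by linarith [h1 z hz, hP z hz]

lemma PA.continuousOn {X : Set ℂ} {f : ℂ → ℂ} (hf : PA X f) : ContinuousOn f X := by
  choose P hP using fun n : ℕ => hf (1/((n:ℝ)+1)) (by positivity)
  have : TendstoUniformlyOn (fun n z => (P n).eval z) f atTop X := by
    rw [Metric.tendstoUniformlyOn_iff]
    intro ε hε
    obtain ⟨N, hN⟩ := exists_nat_one_div_lt hε
    filter_upwards [eventually_ge_atTop N] with n hn z hz
    rw [dist_eq_norm]
    refine (hP n z hz).trans_le (le_trans ?_ hN.le)
    apply one_div_le_one_div_of_le (by positivity)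
    have : (N:ℝ) ≤ n := by exact_mod_cast hn
    linarith
  exact this.continuousOn (Frequently.of_forall fun n => (P n).continuous.continuousOn)

lemma PA.bdd {X : Set ℂ} {f : ℂ → ℂ} (hX : IsCompact X) (hf : PA X f) :
    ∃ M > 0, ∀ z ∈ X, ‖f z‖ ≤ M := by
  obtain ⟨M, hM⟩ := hX.exists_bound_of_continuousOn hf.continuousOn
  exact ⟨max M 1, by positivity, fun z hz => (hM z hz).trans (le_max_left _ _)⟩

lemma PA.add {X : Set ℂ} {f g : ℂ → ℂ} (hf : PA X f) (hg : PA X g) :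
    PA X (fun z => f z + g z) := by
  intro ε hε
  obtain ⟨P, hP⟩ := hf (ε/2) (by positivity)
  obtain ⟨Q, hQ⟩ := hg (ε/2) (by positivity)
  refine ⟨P + Q, fun z hz => ?_⟩
  rw [Polynomial.eval_add]
  calc _ = ‖(f z - P.eval z) + (g z - Q.eval z)‖ := by ring_nf
    _ ≤ _ := norm_add_le _ _
    _ < ε := by linarith [hP z hz, hQ z hz]

lemma PA.mul {X : Set ℂ} (hX : IsCompact X) {f g : ℂ → ℂ} (hf : PA X f) (hg : PA X g) :
    PA X (fun z => f z * g z) := by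
  obtain ⟨M, hM0, hM⟩ := hf.bdd hX
  obtain ⟨M', hM0', hM'⟩ := hg.bdd hX
  apply PA.of_approx
  intro ε hε
  obtain ⟨P, hP⟩ := hf (min 1 (ε/(2*M'))) (by positivity)
  obtain ⟨Q, hQ⟩ := hg (ε/(2*(M+1))) (by positivity)
  refine ⟨fun z => (P*Q).eval z, PA.poly _ _, fun z hz => ?_⟩
  simp only [Polynomial.eval_mul]
  have h1 := hP z hz
  have h2 := hQ z hz
  have hPz : ‖P.eval z‖ ≤ M + 1 := by
    have := norm_sub_norm_le (P.eval z) (f z)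
    rw [norm_sub_rev] at this
    linarith [hM z hz, lt_of_lt_of_le h1 (min_le_left _ _)]
  calc _ = ‖(f z - P.eval z) * g z + P.eval z * (g z - Q.eval z)‖ := by ring_nf
    _ ≤ ‖f z - P.eval z‖ * ‖g z‖ + ‖P.eval z‖ * ‖g z - Q.eval z‖ := by
      refine (norm_add_le _ _).trans ?_
      rw [norm_mul, norm_mul]
    _ ≤ ‖f z - P.eval z‖ * M' + (M+1) * ‖g z - Q.eval z‖ := by
      gcongr
      exact hM' z hz
    _ < (ε/(2*M')) * M' + (M+1) * (ε/(2*(M+1))) := by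
      have : ‖f z - P.eval z‖ < ε/(2*M') := lt_of_lt_of_le h1 (min_le_right _ _)
      gcongr
    _ = ε := by field_simp; ring

lemma PA.inv_lin {X : Set ℂ} (hX : IsCompact X) {a : ℂ}
    (ha : ¬ Bornology.IsBounded (connectedComponentIn Xᶜ a)) :
    PA X (fun z => (z - a)⁻¹) := by
  have haX : a ∉ X := by
    intro h
    apply ha
    rw [connectedComponentIn_eq_empty (by simpa using h)]
    exact Bornology.isBounded_empty
  have : CompactSpace X := isCompact_iff_compactSpace.mp hX
  let S : Subalgebra ℂ C(X, ℂ) := (polynomialFunctions X).topologicalClosure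
  have hSc : IsClosed (S : Set C(X, ℂ)) := Subalgebra.isClosed_topologicalClosure _
  let id0 : C(X, ℂ) := ⟨fun z => z, continuous_subtype_val⟩
  have hid : id0 ∈ S := by
    apply Subalgebra.le_topologicalClosure
    refine ⟨Polynomial.X, trivial, ?_⟩
    ext z; simp [id0]
  have : IsClosed (S : Set C(X, ℂ)) := hSc
  have : CompleteSpace S := hSc.completeSpace_coe
  let x : S := ⟨id0, hid⟩
  have hspec : spectrum ℂ (x : C(X, ℂ)) = X := by
    rw [ContinuousMap.spectrum_eq_range]
    ext z; simp [x, id0]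
  have hns : a ∉ spectrum ℂ x := by
    intro h
    have := Subalgebra.spectrum_isBounded_connectedComponentIn S x h
    rw [hspec] at this
    exact ha this
  rw [spectrum.notMem_iff] at hns
  obtain ⟨u, hu⟩ := hns
  -- inverse element
  let y : S := ↑u⁻¹
  have hy : ∀ z : X, (a - z) * (y : C(X,ℂ)) z = 1 := by
    intro z
    have h1 : (algebraMap ℂ S a - x) * y = 1 := by rw [← hu]; simp [y]
    have h2 := congrArg (fun t : S => (t : C(X,ℂ)) z) h1
    simpa [x, id0] using h2
  intro ε hε
  have hyS : (y : C(X,ℂ)) ∈ closure ((polynomialFunctions X : Subalgebra ℂ C(X,ℂ)) : Set C(X,ℂ)) := by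
    have := y.2
    exact this
  obtain ⟨b, hb, hb2⟩ := Metric.mem_closure_iff.mp hyS ε hε
  obtain ⟨P, -, rfl⟩ := hb
  refine ⟨-P, fun z hz => ?_⟩
  have h3 := ContinuousMap.dist_lt_iff (hε) |>.mp hb2 ⟨z, hz⟩
  have h4 := hy ⟨z, hz⟩
  have hza : a - z ≠ 0 := sub_ne_zero.mpr (fun h => haX (h ▸ hz))
  have h5 : (y : C(X,ℂ)) ⟨z, hz⟩ = (a - z)⁻¹ := by
    field_simp; linear_combination h4
  rw [h5, dist_eq_norm] at h3
  have : (z - a)⁻¹ - (-P).eval z = -((a - z)⁻¹ - P.eval z) := by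
    rw [show z - a = -(a - z) by ring, inv_neg, Polynomial.eval_neg]; ring
  rw [this, norm_neg]
  simpa using h3

lemma PA.const (X : Set ℂ) (c : ℂ) : PA X (fun _ => c) := by
  simpa using PA.poly X (Polynomial.C c)

lemma PA.inv {X : Set ℂ} (hX : IsCompact X)
    (hfull : ∀ a, a ∉ X → ¬ Bornology.IsBounded (connectedComponentIn Xᶜ a))
    {g : ℂ → ℂ} (hg : PA X g) (h0 : ∀ z ∈ X, g z ≠ 0) : PA X (fun z => (g z)⁻¹) := by
  rcases X.eq_empty_or_nonempty with rfl | hne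
  · exact fun ε hε => ⟨0, by simp⟩
  obtain ⟨z0, hz0, hmin⟩ := hX.exists_isMinOn hne hg.continuousOn.norm
  set δ := ‖g z0‖ with hδ
  have hδ0 : 0 < δ := norm_pos_iff.mpr (h0 z0 hz0)
  have hmin' : ∀ z ∈ X, δ ≤ ‖g z‖ := fun z hz => hmin hz
  apply PA.of_approx
  intro ε hε
  obtain ⟨R, hR⟩ := hg (min (δ/2) (ε * δ^2/4)) (by positivity)
  have hRb : ∀ z ∈ X, δ/2 ≤ ‖R.eval z‖ := by
    intro z hz
    have h1 := norm_sub_norm_le (g z) (R.eval z)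
    linarith [hmin' z hz, lt_of_lt_of_le (hR z hz) (min_le_left _ _)]
  have hR0 : ∀ z ∈ X, R.eval z ≠ 0 := fun z hz h => by
    have := hRb z hz; rw [h, norm_zero] at this; linarith
  have hRne : R ≠ 0 := by
    rintro rfl
    exact hR0 z0 hz0 (by simp)
  refine ⟨fun z => (R.eval z)⁻¹, ?_, ?_⟩
  · have hsp := (IsAlgClosed.splits R).eq_prod_roots
    have key : ∀ s : Multiset ℂ, (∀ a ∈ s, a ∉ X) → PA X (fun z => ((s.map (fun a => z - a)).prod)⁻¹) := by
      intro s
      induction s using Multiset.induction_on with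
      | empty => intro _; simpa using PA.const X 1
      | cons a s ih =>
        intro hs
        have h1 := ih (fun b hb => hs b (Multiset.mem_cons_of_mem hb))
        have h2 := PA.inv_lin hX (hfull a (hs a (Multiset.mem_cons_self _ _)))
        refine (PA.mul hX h2 h1).congr fun z _ => ?_
        simp [mul_comm]
    have := (PA.const X (R.leadingCoeff)⁻¹).mul hX (key R.roots (fun a ha haX => hR0 a haX (by
      exact (Polynomial.mem_roots hRne).mp ha)))
    refine this.congr fun z _ => ?_
    conv_rhs => rw [hsp]
    rw [Polynomial.eval_mul, Polynomial.eval_C, Polynomial.eval_multiset_prod, mul_inv]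
    simp [Multiset.map_map]
  · intro z hz
    have hgz := h0 z hz
    have hRz := hR0 z hz
    have : (g z)⁻¹ - (R.eval z)⁻¹ = - (g z - R.eval z) / (g z * R.eval z) := by
      field_simp; ring
    rw [this, norm_div, norm_neg, norm_mul, div_lt_iff₀ (by positivity)]
    calc _ < ε * δ^2/4 := lt_of_lt_of_le (hR z hz) (min_le_right _ _)
      _ < ε * (δ * (δ/2)) := by nlinarith [mul_pos hε (pow_pos hδ0 2)]
      _ ≤ _ := by
        gcongr
        · exact hmin' z hz
        · exact hRb z hz

end NW
end

section
open Complex Set Filter Topology Metric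

namespace NW

/-- filled hull -/
def hull (X : Set ℂ) : Set ℂ := {z | Bornology.IsBounded (connectedComponentIn Xᶜ z)}

lemma subset_hull (X : Set ℂ) : X ⊆ hull X := by
  intro z hz
  simp only [hull, mem_ofPred_eq]
  rw [connectedComponentIn_eq_empty (by simpa using hz)]
  exact Bornology.isBounded_empty

lemma compl_hull_component {X : Set ℂ} {a : ℂ} (ha : a ∉ hull X) :
    connectedComponentIn Xᶜ a ⊆ (hull X)ᶜ := by
  intro b hb hb'
  simp only [hull, mem_ofPred_eq] at hb' ha
  rw [← connectedComponentIn_eq hb] at hb'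
  exact ha hb'

lemma mem_compl_of_notMem_hull {X : Set ℂ} {a : ℂ} (ha : a ∉ hull X) : a ∈ Xᶜ :=
  fun h => ha (subset_hull X h)

lemma isClosed_hull {X : Set ℂ} (hX : IsClosed X) : IsClosed (hull X) := by
  rw [← isOpen_compl_iff, isOpen_iff_mem_nhds]
  intro a ha
  have h1 : a ∈ connectedComponentIn Xᶜ a := mem_connectedComponentIn (mem_compl_of_notMem_hull ha)
  exact mem_of_superset ((hX.isOpen_compl.connectedComponentIn).mem_nhds h1) (compl_hull_component ha)

lemma isPreconnected_outside {R : ℝ} (hR : 0 ≤ R) : IsPreconnected {z : ℂ | R < ‖z‖} := by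
  have hT : OrdConnected {t : ℝ | R < Real.exp t} := by
    constructor
    intro x hx y hy z hz
    simp only [mem_ofPred_eq] at hx ⊢
    exact lt_of_lt_of_le hx (Real.exp_le_exp.mpr hz.1)
  have hc : Convex ℝ (Complex.reLm ⁻¹' {t : ℝ | R < Real.exp t}) :=
    hT.convex.linear_preimage _
  have := hc.isPreconnected.image Complex.exp Complex.continuous_exp.continuousOn
  convert this using 1
  ext z
  simp only [mem_ofPred_eq, mem_image, mem_preimage, Complex.reLm_coe]
  constructor
  · intro h
    have hz : z ≠ 0 := by rintro rfl; simp at h; linarith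
    refine ⟨Complex.log z, ?_, Complex.exp_log hz⟩
    rw [Complex.log_re, Real.exp_log (norm_pos_iff.mpr hz)]; exact h
  · rintro ⟨w, hw, rfl⟩
    rwa [Complex.norm_exp]

lemma not_bounded_compl_closedBall_component {R : ℝ} {a : ℂ} {Y : Set ℂ} (hR : 0 ≤ R) (ha : R < ‖a‖)
    (hY : (closedBall (0:ℂ) R)ᶜ ⊆ Y) : ¬ Bornology.IsBounded (connectedComponentIn Y a) := by
  have hc : IsPreconnected ((closedBall (0:ℂ) R)ᶜ) :=
    by
      convert isPreconnected_outside hR using 1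
      ext z; simp
  have hsub : (closedBall (0:ℂ) R)ᶜ ⊆ connectedComponentIn Y a :=
    hc.subset_connectedComponentIn (by simpa using ha) hY
  intro hb
  obtain ⟨C, hC⟩ := (hb.subset hsub).exists_norm_le
  have := hC ((max R C + 1 : ℝ) : ℂ) (by
    simp only [mem_compl_iff, mem_closedBall, dist_zero_right, norm_real, Real.norm_eq_abs, not_le]
    rw [abs_of_nonneg (by positivity)]
    linarith [le_max_left R C])
  rw [norm_real, Real.norm_eq_abs] at this
  linarith [le_abs_self (max R C + 1), le_max_right R C]

lemma isCompact_hull {X : Set ℂ} (hX : IsCompact X) : IsCompact (hull X) := by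
  obtain ⟨R, hR⟩ := hX.isBounded.subset_closedBall 0
  refine Metric.isCompact_of_isClosed_isBounded (isClosed_hull hX.isClosed) ?_
  refine (Metric.isBounded_closedBall (x := (0:ℂ)) (r := max R 0)).subset ?_
  intro a ha
  by_contra h
  refine not_bounded_compl_closedBall_component (R := max R 0) (by positivity) (by simpa using h) ?_ ha
  exact compl_subset_compl.mpr (hR.trans (closedBall_subset_closedBall (le_max_left _ _)))

lemma hull_full {X : Set ℂ} {a : ℂ} (ha : a ∉ hull X) :
    ¬ Bornology.IsBounded (connectedComponentIn (hull X)ᶜ a) := by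
  intro h
  apply ha
  refine h.subset ?_
  exact isPreconnected_connectedComponentIn.subset_connectedComponentIn
    (mem_connectedComponentIn (mem_compl_of_notMem_hull ha)) (compl_hull_component ha)

lemma NoHole.hull_subset {Ω X : Set ℂ} (h : NoHole Ω) (hX : X ⊆ Ω) : hull X ⊆ Ω := by
  intro a ha
  by_contra haΩ
  obtain ⟨C, hC, hCb, hCΩ, haC⟩ := h a haΩ
  apply hCb
  exact Bornology.IsBounded.subset ha
    (hC.subset_connectedComponentIn haC (hCΩ.trans (compl_subset_compl.mpr hX)))

lemma PAon.inv {Ω : Set ℂ} (h : NoHole Ω) {g : ℂ → ℂ} (hg : PAon Ω g) (h0 : ∀ z ∈ Ω, g z ≠ 0) :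
    PAon Ω (fun z => (g z)⁻¹) := by
  intro X hX hXc
  have hs := h.hull_subset hX
  exact (PA.inv (isCompact_hull hXc) (fun a ha => hull_full ha)
    (hg _ hs (isCompact_hull hXc)) (fun z hz => h0 z (hs hz))).mono (subset_hull X)

lemma PAon.mul {Ω : Set ℂ} {f g : ℂ → ℂ} (hf : PAon Ω f) (hg : PAon Ω g) :
    PAon Ω (fun z => f z * g z) := fun X hX hXc => (hf X hX hXc).mul hXc (hg X hX hXc)

lemma PAon.add {Ω : Set ℂ} {f g : ℂ → ℂ} (hf : PAon Ω f) (hg : PAon Ω g) :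
    PAon Ω (fun z => f z + g z) := fun X hX hXc => (hf X hX hXc).add (hg X hX hXc)

lemma PAon.const {Ω : Set ℂ} (c : ℂ) : PAon Ω (fun _ => c) := fun X _ _ => PA.const X c

lemma PAon.poly {Ω : Set ℂ} (P : Polynomial ℂ) : PAon Ω (fun z => P.eval z) :=
  fun X _ _ => PA.poly X P

lemma PAon.congr {Ω : Set ℂ} {f g : ℂ → ℂ} (hf : PAon Ω f) (h : ∀ z ∈ Ω, f z = g z) : PAon Ω g :=
  fun X hX hXc => (hf X hX hXc).congr fun z hz => h z (hX hz)

lemma PAon.exists_seq {Ω : Set ℂ} (hΩ : IsOpen Ω) {f : ℂ → ℂ} (hf : PAon Ω f) :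
    ∃ P : ℕ → Polynomial ℂ, TendstoLocallyUniformlyOn (fun n z => (P n).eval z) f atTop Ω := by
  let X : ℕ → Set ℂ := fun n => closedBall 0 n ∩ {z | 1/((n:ℝ)+1) ≤ infDist z Ωᶜ}
  by_cases hne : (Ωᶜ).Nonempty
  · have hXc : ∀ n, IsCompact (X n) := fun n =>
      (isCompact_closedBall _ _).inter_right (isClosed_le continuous_const (continuous_infDist_pt _))
    have hXs : ∀ n, X n ⊆ Ω := by
      rintro n z ⟨-, hz⟩
      by_contra h
      have h2 : infDist z Ωᶜ = 0 := infDist_zero_of_mem h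
      simp only [mem_ofPred_eq, h2] at hz
      have : (0:ℝ) < 1/((n:ℝ)+1) := by positivity
      linarith
    choose P hP using fun n : ℕ => hf (X n) (hXs n) (hXc n) (1/((n:ℝ)+1)) (by positivity)
    refine ⟨P, ?_⟩
    rw [tendstoLocallyUniformlyOn_iff_forall_isCompact hΩ]
    intro K hK hKc
    rw [Metric.tendstoUniformlyOn_iff]
    intro ε hε
    obtain ⟨R, hR⟩ := hKc.isBounded.exists_norm_le
    obtain ⟨δ, hδ, hδK⟩ : ∃ δ > 0, ∀ z ∈ K, δ ≤ infDist z Ωᶜ := by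
      rcases K.eq_empty_or_nonempty with rfl | hKne
      · exact ⟨1, one_pos, by simp⟩
      obtain ⟨z0, hz0, hm⟩ := hKc.exists_isMinOn hKne (continuous_infDist_pt Ωᶜ).continuousOn
      refine ⟨infDist z0 Ωᶜ, ?_, fun z hz => hm hz⟩
      exact (hΩ.isClosed_compl.notMem_iff_infDist_pos hne).mp (by simpa using hK hz0)
    obtain ⟨N1, hN1⟩ := exists_nat_one_div_lt hε
    obtain ⟨N2, hN2⟩ := exists_nat_one_div_lt hδ
    obtain ⟨N3, hN3⟩ := exists_nat_ge R
    filter_upwards [eventually_ge_atTop N1, eventually_ge_atTop N2, eventually_ge_atTop N3]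
      with n h1 h2 h3 z hz
    have h1' : (N1:ℝ) ≤ n := by exact_mod_cast h1
    have h2' : (N2:ℝ) ≤ n := by exact_mod_cast h2
    have h3' : (N3:ℝ) ≤ n := by exact_mod_cast h3
    rw [dist_eq_norm]
    refine (hP n z ⟨?_, ?_⟩).trans_le ?_
    · simpa using (hR z hz).trans (hN3.trans h3')
    · refine le_trans ?_ (hN2.le.trans (hδK z hz))
      exact one_div_le_one_div_of_le (by positivity) (by linarith)
    · refine le_trans ?_ hN1.le
      exact one_div_le_one_div_of_le (by positivity) (by linarith)
  · rw [Set.not_nonempty_iff_eq_empty, compl_empty_iff] at hne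
    subst hne
    choose P hP using fun n : ℕ => hf (closedBall 0 n) (subset_univ _) (isCompact_closedBall _ _)
      (1/((n:ℝ)+1)) (by positivity)
    refine ⟨P, ?_⟩
    rw [tendstoLocallyUniformlyOn_iff_forall_isCompact hΩ]
    intro K hK hKc
    rw [Metric.tendstoUniformlyOn_iff]
    intro ε hε
    obtain ⟨R, hR⟩ := hKc.isBounded.exists_norm_le
    obtain ⟨N1, hN1⟩ := exists_nat_one_div_lt hε
    obtain ⟨N3, hN3⟩ := exists_nat_ge R
    filter_upwards [eventually_ge_atTop N1, eventually_ge_atTop N3] with n h1 h3 z hz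
    have h1' : (N1:ℝ) ≤ n := by exact_mod_cast h1
    have h3' : (N3:ℝ) ≤ n := by exact_mod_cast h3
    rw [dist_eq_norm]
    refine (hP n z ?_).trans_le ?_
    · simpa using (hR z hz).trans (hN3.trans h3')
    · refine le_trans ?_ hN1.le
      exact one_div_le_one_div_of_le (by positivity) (by linarith)

lemma PAon.of_seq {Ω : Set ℂ} (hΩ : IsOpen Ω) {f : ℂ → ℂ} {P : ℕ → Polynomial ℂ}
    (h : TendstoLocallyUniformlyOn (fun n z => (P n).eval z) f atTop Ω) : PAon Ω f := by
  intro X hX hXc ε hε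
  have := (tendstoLocallyUniformlyOn_iff_forall_isCompact hΩ).mp h X hX hXc
  rw [Metric.tendstoUniformlyOn_iff] at this
  obtain ⟨n, hn⟩ := (this ε hε).exists
  exact ⟨P n, fun z hz => by rw [← dist_eq_norm]; exact hn z hz⟩

lemma PAon.differentiableOn {Ω : Set ℂ} (hΩ : IsOpen Ω) {f : ℂ → ℂ} (hf : PAon Ω f) :
    DifferentiableOn ℂ f Ω := by
  obtain ⟨P, hP⟩ := hf.exists_seq hΩ
  exact hP.differentiableOn (Eventually.of_forall fun n => (P n).differentiable.differentiableOn) hΩ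

lemma PAon.deriv {Ω : Set ℂ} (hΩ : IsOpen Ω) {f : ℂ → ℂ} (hf : PAon Ω f) :
    PAon Ω (deriv f) := by
  obtain ⟨P, hP⟩ := hf.exists_seq hΩ
  have := hP.deriv (Eventually.of_forall fun n => (P n).differentiable.differentiableOn) hΩ
  refine PAon.of_seq hΩ (P := fun n => Polynomial.derivative (P n)) ?_
  convert this using 2 with n
  ext z
  simp [Function.comp]

end NW
end

section
open Complex Set Filter Topology Metric

namespace NW

lemma exists_antideriv (P : Polynomial ℂ) : ∃ Q : Polynomial ℂ, Polynomial.derivative Q = P := by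
  induction P using Polynomial.induction_on' with
  | add p q hp hq =>
    obtain ⟨a, rfl⟩ := hp
    obtain ⟨b, rfl⟩ := hq
    exact ⟨a + b, by simp⟩
  | monomial n c =>
    refine ⟨Polynomial.monomial (n+1) (c / (n+1)), ?_⟩
    rw [Polynomial.derivative_monomial]
    have : ((n:ℂ) + 1) ≠ 0 := by exact_mod_cast Nat.succ_ne_zero n
    simp only [Nat.add_sub_cancel]
    congr 1
    push_cast
    field_simp

lemma PAon.primitive {Ω : Set ℂ} (hΩ : IsOpen Ω) (hc : IsPreconnected Ω) {z0 : ℂ} (hz0 : z0 ∈ Ω)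
    {f : ℂ → ℂ} (hf : PAon Ω f) :
    ∃ F, PAon Ω F ∧ F z0 = 0 ∧ ∀ z ∈ Ω, HasDerivAt F (f z) z := by
  obtain ⟨P, hP⟩ := hf.exists_seq hΩ
  have hQ : ∀ n, ∃ Q : Polynomial ℂ, Polynomial.derivative Q = P n ∧ Q.eval z0 = 0 := by
    intro n
    obtain ⟨Q, hQ⟩ := exists_antideriv (P n)
    exact ⟨Q - Polynomial.C (Q.eval z0), by simp [hQ], by simp⟩
  choose Q hQd hQ0 using hQ
  have hder : ∀ n z, HasDerivAt (fun z => (Q n).eval z) ((P n).eval z) z := by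
    intro n z
    rw [← hQd n]
    exact (Q n).hasDerivAt z
  have hball : ∀ z ∈ Ω, ∃ r > 0, ball z r ⊆ Ω ∧
      UniformCauchySeqOn (fun n z => (P n).eval z) atTop (ball z r) := by
    intro z hz
    obtain ⟨r, hr, hrs⟩ := Metric.nhds_basis_closedBall.mem_iff.mp (hΩ.mem_nhds hz)
    have := (tendstoLocallyUniformlyOn_iff_forall_isCompact hΩ).mp hP _ hrs (isCompact_closedBall z r)
    exact ⟨r, hr, ball_subset_closedBall.trans hrs,
      (this.mono ball_subset_closedBall).uniformCauchySeqOn⟩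
  have hprop : ∀ z r, UniformCauchySeqOn (fun n z => (P n).eval z) atTop (ball z r) →
      CauchySeq (fun n => (Q n).eval z) →
      UniformCauchySeqOn (fun n z => (Q n).eval z) atTop (ball z r) := by
    intro z r h1 h2
    exact uniformCauchySeqOn_ball_of_deriv h1 (fun n y _ => hder n y) h2
  let S : Set ℂ := {z | z ∈ Ω ∧ CauchySeq (fun n => (Q n).eval z)}
  have hSo : IsOpen S := by
    rw [Metric.isOpen_iff]
    rintro z ⟨hz, hcz⟩
    obtain ⟨r, hr, hrs, hu⟩ := hball z hz
    refine ⟨r, hr, fun y hy => ⟨hrs hy, ?_⟩⟩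
    exact (hprop z r hu hcz).cauchySeq hy
  have hsub : Ω ⊆ S := by
    apply hc.subset_of_closure_inter_subset hSo
    · exact ⟨z0, hz0, hz0, by simp only [hQ0]; exact cauchySeq_const _⟩
    · rintro z ⟨hzc, hz⟩
      obtain ⟨r, hr, hrs, hu⟩ := hball z hz
      obtain ⟨y, hy, hyd⟩ := Metric.mem_closure_iff.mp hzc (r/2) (by positivity)
      refine ⟨hz, ?_⟩
      have hsb : ball y (r/2) ⊆ ball z r := by
        intro w hw
        rw [mem_ball] at *
        have := dist_triangle w y z
        rw [dist_comm y z] at this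
        linarith
      exact (hprop y (r/2) (hu.mono hsb) hy.2).cauchySeq (by rw [mem_ball]; exact hyd)
  have hlim : ∀ z, ∃ l, z ∈ Ω → Tendsto (fun n => (Q n).eval z) atTop (𝓝 l) := by
    intro z
    by_cases hz : z ∈ Ω
    · obtain ⟨l, hl⟩ := cauchySeq_tendsto_of_complete (hsub hz).2
      exact ⟨l, fun _ => hl⟩
    · exact ⟨0, fun h => absurd h hz⟩
  choose F hF using hlim
  have hloc : TendstoLocallyUniformlyOn (fun n z => (Q n).eval z) F atTop Ω := by
    rw [tendstoLocallyUniformlyOn_iff_forall_tendsto] 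
    intro z hz
    obtain ⟨r, hr, hrs, hu⟩ := hball z hz
    have h1 := hprop z r hu (hsub hz).2
    have h2 : TendstoUniformlyOn (fun n z => (Q n).eval z) F atTop (ball z r) :=
      h1.tendstoUniformlyOn_of_tendsto (fun y hy => hF y (hrs hy))
    rw [tendstoUniformlyOn_iff_tendsto] at h2
    refine h2.mono_left ?_
    refine Filter.prod_mono le_rfl ?_
    rw [Filter.le_principal_iff]
    exact mem_nhdsWithin_of_mem_nhds (ball_mem_nhds z hr)
  refine ⟨F, PAon.of_seq hΩ hloc, ?_, ?_⟩
  · have := hF z0 hz0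
    simp only [hQ0] at this
    exact (tendsto_nhds_unique this tendsto_const_nhds)
  · intro z hz
    exact hasDerivAt_of_tendstoLocallyUniformlyOn hΩ hP (Eventually.of_forall fun n x _ => hder n x)
      (fun x hx => hF x hx) hz

lemma PA.cexp {X : Set ℂ} (hX : IsCompact X) {f : ℂ → ℂ} (hf : PA X f) :
    PA X (fun z => Complex.exp (f z)) := by
  obtain ⟨M, hM0, hM⟩ := hf.bdd hX
  apply PA.of_approx
  intro ε hε
  have huc : UniformContinuousOn Complex.exp (closedBall 0 (M+1)) :=
    (isCompact_closedBall _ _).uniformContinuousOn_of_continuous Complex.continuous_exp.continuousOn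
  rw [Metric.uniformContinuousOn_iff] at huc
  obtain ⟨δ, hδ, huc⟩ := huc ε hε
  obtain ⟨P, hP⟩ := hf (min 1 δ) (by positivity)
  refine ⟨fun z => Complex.exp (P.eval z), ?_, ?_⟩
  · intro η hη
    obtain ⟨M', hM0', hM'⟩ := (PA.poly X P).bdd hX
    have hexp : TendstoUniformlyOn (fun (n:ℕ) z => ∑ i ∈ Finset.range n, z^i / (Nat.factorial i : ℂ))
        Complex.exp atTop (closedBall 0 M') := by
      apply tendstoUniformlyOn_tsum_nat (f := fun (i:ℕ) (z:ℂ) => z^i / (Nat.factorial i : ℂ))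
        (u := fun i => M'^i / (Nat.factorial i : ℝ)) (Real.summable_pow_div_factorial M') ?_ |>.congr_right ?_
      · intro n x hx
        rw [mem_closedBall_zero_iff] at hx
        rw [norm_div, norm_pow, RCLike.norm_natCast]
        gcongr
      · intro x _
        exact (congrFun Complex.exp_eq_exp_ℂ x ▸ congrFun (NormedSpace.exp_eq_tsum_div (𝔸 := ℂ)) x).symm
    rw [Metric.tendstoUniformlyOn_iff] at hexp
    obtain ⟨n, hn⟩ := (hexp η hη).exists
    refine ⟨∑ i ∈ Finset.range n, Polynomial.C ((Nat.factorial i : ℂ)⁻¹) * P^i, fun z hz => ?_⟩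
    have := hn (P.eval z) (by simpa using hM' z hz)
    rw [dist_eq_norm] at this
    have h2 : (∑ i ∈ Finset.range n, Polynomial.C ((Nat.factorial i : ℂ)⁻¹) * P^i).eval z =
        ∑ i ∈ Finset.range n, (P.eval z)^i / (Nat.factorial i : ℂ) := by
      rw [Polynomial.eval_finsetSum]
      simp [div_eq_mul_inv, mul_comm]
    rw [h2]
    exact this
  · intro z hz
    rw [← dist_eq_norm]
    have h1 := hP z hz
    apply huc
    · simpa using (hM z hz).trans (by linarith)
    · rw [mem_closedBall_zero_iff]
      have := norm_sub_norm_le (P.eval z) (f z)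
      rw [norm_sub_rev] at this
      linarith [hM z hz, lt_of_lt_of_le h1 (min_le_left _ _)]
    · rw [dist_eq_norm]; exact lt_of_lt_of_le h1 (min_le_right _ _)

lemma PAon.cexp {Ω : Set ℂ} {f : ℂ → ℂ} (hf : PAon Ω f) : PAon Ω (fun z => Complex.exp (f z)) :=
  fun X hX hXc => (hf X hX hXc).cexp hXc

lemma PAon.log {Ω : Set ℂ} (hΩ : IsOpen Ω) (hc : IsPreconnected Ω) (hh : NoHole Ω)
    {g : ℂ → ℂ} (hg : PAon Ω g) (h0 : ∀ z ∈ Ω, g z ≠ 0) :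
    ∃ F, PAon Ω F ∧ ∀ z ∈ Ω, Complex.exp (F z) = g z := by
  rcases Ω.eq_empty_or_nonempty with rfl | ⟨z0, hz0⟩
  · exact ⟨fun _ => 0, PAon.const 0, by simp⟩
  obtain ⟨F, hF, hF0, hFd⟩ := ((hg.deriv hΩ).mul (hg.inv hh h0)).primitive hΩ hc hz0
  have hgd : ∀ z ∈ Ω, HasDerivAt g (_root_.deriv g z) z := fun z hz =>
    ((hg.differentiableOn hΩ).differentiableAt (hΩ.mem_nhds hz)).hasDerivAt
  have hconst : ∀ z ∈ Ω, Complex.exp (-F z) * g z = Complex.exp (-F z0) * g z0 := by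
    intro z hz
    refine hΩ.is_const_of_deriv_eq_zero (f := fun z => Complex.exp (-F z) * g z) hc ?_ ?_ hz hz0
    · intro w hw
      exact ((((hFd w hw).neg).cexp).mul (hgd w hw)).differentiableAt.differentiableWithinAt
    · intro w hw
      have := ((((hFd w hw).fun_neg).cexp).fun_mul (hgd w hw)).deriv
      rw [this]
      have := h0 w hw
      simp only [Pi.zero_apply]
      field_simp
      ring
  refine ⟨fun z => F z + Complex.log (g z0), hF.add (PAon.const _), fun z hz => ?_⟩
  have := hconst z hz
  rw [hF0] at this
  simp only [neg_zero, Complex.exp_zero, one_mul] at this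
  rw [Complex.exp_add, Complex.exp_log (h0 z0 hz0), ← this, ← mul_assoc, ← Complex.exp_add]
  simp

end NW
end

section
open Complex Set Filter Topology Metric

namespace NW

noncomputable def mob (a z : ℂ) : ℂ := (z - a) * (1 - (starRingEnd ℂ) a * z)⁻¹

lemma mob_den_ne {a z : ℂ} (ha : ‖a‖ < 1) (hz : ‖z‖ < 1) : 1 - (starRingEnd ℂ) a * z ≠ 0 := by
  intro h
  have h1 : (starRingEnd ℂ) a * z = 1 := by linear_combination -h
  have h2 : ‖a‖ * ‖z‖ = 1 := by
    have := congrArg norm h1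
    simpa using this
  nlinarith [norm_nonneg a, norm_nonneg z]

lemma mob_identity (a z : ℂ) :
    ‖1 - (starRingEnd ℂ) a * z‖^2 - ‖z - a‖^2 = (1 - ‖a‖^2) * (1 - ‖z‖^2) := by
  simp only [← Complex.normSq_eq_norm_sq, Complex.normSq_apply]
  simp
  ring

lemma mob_norm_sq {a z : ℂ} (ha : ‖a‖ < 1) (hz : ‖z‖ < 1) :
    1 - ‖mob a z‖^2 = (1 - ‖a‖^2) * (1 - ‖z‖^2) / ‖1 - (starRingEnd ℂ) a * z‖^2 := by
  have h := norm_ne_zero_iff.mpr (mob_den_ne ha hz)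
  rw [← mob_identity, mob, norm_mul, norm_inv]
  generalize ‖1 - (starRingEnd ℂ) a * z‖ = d at *
  field_simp

lemma mob_norm_lt {a z : ℂ} (ha : ‖a‖ < 1) (hz : ‖z‖ < 1) : ‖mob a z‖ < 1 := by
  have h := mob_norm_sq ha hz
  have h0 := norm_pos_iff.mpr (mob_den_ne ha hz)
  have h1 : 0 < 1 - ‖a‖^2 := by nlinarith [norm_nonneg a]
  have h2 : 0 < 1 - ‖z‖^2 := by nlinarith [norm_nonneg z]
  have h3 : 0 < 1 - ‖mob a z‖^2 := by rw [h]; positivity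
  nlinarith [norm_nonneg (mob a z)]

lemma mob_norm_bound {a z : ℂ} {ρ t : ℝ} (ha : ‖a‖ ≤ ρ) (hz : ‖z‖ ≤ t) (hρ : ρ < 1) (ht : t < 1) :
    ‖mob a z‖^2 ≤ 1 - (1 - ρ^2) * (1 - t^2) / 4 := by
  have ha' := ha.trans_lt hρ
  have hz' := hz.trans_lt ht
  have h := mob_norm_sq ha' hz'
  have h0 := norm_pos_iff.mpr (mob_den_ne ha' hz')
  have hle : ‖1 - (starRingEnd ℂ) a * z‖ ≤ 2 := by
    refine (norm_sub_le _ _).trans ?_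
    simp only [norm_one, norm_mul, RCLike.norm_conj]
    nlinarith [norm_nonneg a, norm_nonneg z]
  have h1 : 1 - ρ^2 ≤ 1 - ‖a‖^2 := by nlinarith [norm_nonneg a]
  have h2 : 1 - t^2 ≤ 1 - ‖z‖^2 := by nlinarith [norm_nonneg z]
  have h1' : 0 ≤ 1 - ρ^2 := by nlinarith [norm_nonneg a]
  have h2' : 0 ≤ 1 - t^2 := by nlinarith [norm_nonneg z]
  have : (1 - ρ^2) * (1 - t^2) / 4 ≤ 1 - ‖mob a z‖^2 := by
    rw [h]
    apply div_le_div₀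
    · exact mul_nonneg (h1'.trans h1) (h2'.trans h2)
    · exact mul_le_mul h1 h2 h2' (h1'.trans h1)
    · positivity
    · nlinarith
  linarith

lemma mob_inv {a z : ℂ} (ha : ‖a‖ < 1) (hz : ‖z‖ < 1) : mob (-a) (mob a z) = z := by
  have h := mob_den_ne ha hz
  have h1 := mob_den_ne ha ha
  have h2 := mob_den_ne (a := -a) (z := mob a z) (by simpa using ha) (mob_norm_lt ha hz)
  rw [mob, mul_inv_eq_iff_eq_mul₀ h2]
  rw [mob]
  simp only [map_neg]
  generalize hd : (1 - (starRingEnd ℂ) a * z) = d at *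
  generalize (starRingEnd ℂ) a = c at *
  subst hd
  generalize hd : (1 - c * z)⁻¹ = e
  have he : (1 - c * z) * e = 1 := by rw [← hd]; exact mul_inv_cancel₀ h
  linear_combination (z - a) * he

lemma mob_hasDerivAt {a z : ℂ} (ha : ‖a‖ < 1) (hz : ‖z‖ < 1) :
    HasDerivAt (mob a) ((1 - (starRingEnd ℂ) a * a) * ((1 - (starRingEnd ℂ) a * z)⁻¹)^2) z := by
  have h := mob_den_ne ha hz
  have h1 : HasDerivAt (fun z => 1 - (starRingEnd ℂ) a * z) (-(starRingEnd ℂ) a) z := by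
    simpa using ((hasDerivAt_id z).const_mul ((starRingEnd ℂ) a)).const_sub 1
  have h2 := ((hasDerivAt_id z).sub_const a).fun_mul (h1.fun_inv h)
  refine h2.congr_deriv ?_
  simp only [id]
  generalize (starRingEnd ℂ) a = c at *
  rw [div_eq_mul_inv, ← inv_pow]
  generalize hd : (1 - c * z)⁻¹ = e at *
  have he : (1 - c * z) * e = 1 := by rw [← hd]; exact mul_inv_cancel₀ h
  linear_combination (-e) * he

lemma PAon.mob {V : Set ℂ} (hh : NoHole V) {g : ℂ → ℂ} (hg : PAon V g) {a : ℂ} (ha : ‖a‖ < 1)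
    (hm : ∀ z ∈ V, ‖g z‖ < 1) : PAon V (fun z => mob a (g z)) := by
  have h1 : PAon V (fun z => 1 - (starRingEnd ℂ) a * g z) :=
    ((PAon.const 1).add ((PAon.const (-(starRingEnd ℂ) a)).mul hg)).congr (fun z _ => by ring)
  have h2 : PAon V (fun z => g z - a) := (hg.add (PAon.const (-a))).congr (fun z _ => by ring)
  exact h2.mul (h1.inv hh (fun z hz => mob_den_ne ha (hm z hz)))

/-- uniform bound -/
lemma schwarz_bound {V : Set ℂ} (hVo : IsOpen V) (hVc : IsPreconnected V) (h0 : (0:ℂ) ∈ V)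
    {E : Set ℂ} (hE : IsCompact E) (hEV : E ⊆ V) :
    ∃ ρ, 0 < ρ ∧ ρ < 1 ∧ ∀ Φ : ℂ → ℂ, DifferentiableOn ℂ Φ V → (∀ z ∈ V, ‖Φ z‖ < 1) → Φ 0 = 0 →
      ∀ z ∈ E, ‖Φ z‖ ≤ ρ := by
  let S : Set ℂ := {z | z ∈ V ∧ ∃ ρ < 1, ∃ ε > 0, ∀ Φ : ℂ → ℂ, DifferentiableOn ℂ Φ V →
    (∀ z ∈ V, ‖Φ z‖ < 1) → Φ 0 = 0 → ∀ w ∈ ball z ε, ‖Φ w‖ ≤ ρ}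
  have key : ∀ y ρ ε, ρ < 1 → 0 < ε → ball y (3*ε) ⊆ V → 
      (∀ Φ : ℂ → ℂ, DifferentiableOn ℂ Φ V →
        (∀ z ∈ V, ‖Φ z‖ < 1) → Φ 0 = 0 → ‖Φ y‖ ≤ ρ) → ∃ ρ' < 1, ∀ Φ : ℂ → ℂ, DifferentiableOn ℂ Φ V →
        (∀ z ∈ V, ‖Φ z‖ < 1) → Φ 0 = 0 → ∀ w ∈ ball y (2*ε), ‖Φ w‖ ≤ ρ' := by
    intro y ρ ε hρ hε hb hy
    by_cases hex : 0 ≤ ρ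
    swap
    · refine ⟨0, by norm_num, fun Φ hd hm h0 => ?_⟩
      have := hy Φ hd hm h0
      exact absurd ((norm_nonneg _).trans this) hex
    refine ⟨Real.sqrt (1 - (1 - ρ^2) * (1 - (2/3)^2) / 4), ?_, ?_⟩
    · rw [Real.sqrt_lt' one_pos]
      nlinarith
    · intro Φ hd hm hΦ0 w hw
      have hyV : y ∈ V := hb (mem_ball_self (by positivity))
      have hwV : w ∈ V := hb (ball_subset_ball (by linarith) hw)
      have ha := hm y hyV
      have hd' : DifferentiableOn ℂ (fun z => mob (Φ y) (Φ z)) (ball y (3*ε)) := by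
        intro z hz
        have := hm z (hb hz)
        exact (mob_hasDerivAt ha this).differentiableAt.comp_differentiableWithinAt z
          ((hd z (hb hz)).mono hb)
      have h1 := Complex.dist_le_div_mul_dist_of_mapsTo_ball (R₂ := 1) (z := w) hd' ?_ ?_
      · have hself : mob (Φ y) (Φ y) = 0 := by simp [mob]
        rw [hself, dist_zero_right] at h1
        have h2 : ‖mob (Φ y) (Φ w)‖ ≤ 2/3 := by
          refine h1.trans ?_
          rw [mem_ball] at hw
          rw [div_mul_eq_mul_div, div_le_iff₀ (by positivity)]
          linarith
        have h3 := mob_norm_bound (a := -(Φ y)) (z := mob (Φ y) (Φ w)) (ρ := ρ) (t := 2/3)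
          (by simpa using hy Φ hd hm hΦ0) h2 hρ (by norm_num)
        rw [mob_inv ha (hm w hwV)] at h3
        exact Real.le_sqrt_of_sq_le h3
      · intro z hz
        have hself : mob (Φ y) (Φ y) = 0 := by simp [mob]
        simp only [hself]
        rw [mem_closedBall_zero_iff]
        exact (mob_norm_lt ha (hm z (hb hz))).le
      · exact ball_subset_ball (by linarith) hw
  have hSo : IsOpen S := by
    rw [Metric.isOpen_iff]
    rintro z ⟨hz, ρ, hρ, ε, hε, h⟩
    obtain ⟨δ, hδ, hδs⟩ := Metric.isOpen_iff.mp hVo z hz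
    refine ⟨min δ (ε/2), by positivity, fun y hy => ⟨hδs (ball_subset_ball (min_le_left _ _) hy), ρ, hρ,
      ε/2, by positivity, fun Φ h1 h2 h3 w hw => h Φ h1 h2 h3 w ?_⟩⟩
    rw [mem_ball] at *
    have := dist_triangle w y z
    have := min_le_right δ (ε/2)
    linarith
  have hsub : V ⊆ S := by
    apply hVc.subset_of_closure_inter_subset hSo
    · obtain ⟨δ, hδ, hδs⟩ := Metric.isOpen_iff.mp hVo 0 h0
      obtain ⟨ρ', h1, h2⟩ := key 0 0 (δ/3) (by norm_num) (by positivity) (by convert hδs using 2; ring)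
        (fun Φ _ _ h => by simp [h])
      exact ⟨0, h0, h0, ρ', h1, 2*(δ/3), by positivity, h2⟩
    · rintro z ⟨hzc, hz⟩
      obtain ⟨δ, hδ, hδs⟩ := Metric.isOpen_iff.mp hVo z hz
      obtain ⟨y, hy, hyd⟩ := Metric.mem_closure_iff.mp hzc (δ/4) (by positivity)
      obtain ⟨hyV, ρ, hρ, ε, hε, h⟩ := hy
      obtain ⟨ρ', h1, h2⟩ := key y ρ (δ/4) hρ (by positivity)
        (fun w hw => hδs (by
          rw [mem_ball] at *
          have := dist_triangle w y z
          rw [dist_comm y z] at this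
          linarith))
        (fun Φ a b c => h Φ a b c y (mem_ball_self hε))
      refine ⟨hz, ρ', h1, δ/4, by positivity, fun Φ a b c w hw => h2 Φ a b c w ?_⟩
      rw [mem_ball] at *
      have := dist_triangle w z y
      linarith
  -- compactness
  have hcomp : ∃ ρ, ρ < 1 ∧ ∀ Φ : ℂ → ℂ, DifferentiableOn ℂ Φ V → (∀ z ∈ V, ‖Φ z‖ < 1) → Φ 0 = 0 →
      ∀ z ∈ E, ‖Φ z‖ ≤ ρ := by
    apply hE.induction_on (p := fun E => ∃ ρ, ρ < 1 ∧ ∀ Φ : ℂ → ℂ, DifferentiableOn ℂ Φ V →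
      (∀ z ∈ V, ‖Φ z‖ < 1) → Φ 0 = 0 → ∀ z ∈ E, ‖Φ z‖ ≤ ρ)
    · exact ⟨0, by norm_num, by simp⟩
    · rintro s t hst ⟨ρ, h1, h2⟩
      exact ⟨ρ, h1, fun Φ a b c z hz => h2 Φ a b c z (hst hz)⟩
    · rintro s t ⟨ρ, h1, h2⟩ ⟨ρ', h1', h2'⟩
      refine ⟨max ρ ρ', max_lt h1 h1', fun Φ a b c z hz => ?_⟩
      rcases hz with hz | hz
      · exact (h2 Φ a b c z hz).trans (le_max_left _ _)
      · exact (h2' Φ a b c z hz).trans (le_max_right _ _)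
    · intro z hz
      obtain ⟨_, ρ, hρ, ε, hε, h⟩ := hsub (hEV hz)
      exact ⟨ball z ε, mem_nhdsWithin_of_mem_nhds (ball_mem_nhds z hε), ρ, hρ, h⟩
  obtain ⟨ρ, h1, h2⟩ := hcomp
  exact ⟨max ρ (1/2), by positivity, max_lt h1 (by norm_num),
    fun Φ a b c z hz => (h2 Φ a b c z hz).trans (le_max_left _ _)⟩

def KF (V : Set ℂ) (Φ : ℂ → ℂ) : Prop :=
  PAon V Φ ∧ InjOn Φ V ∧ (∀ z ∈ V, ‖Φ z‖ < 1) ∧ Φ 0 = 0 ∧ ∀ z ∈ V, deriv Φ z ≠ 0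

lemma mob_injOn {a : ℂ} (ha : ‖a‖ < 1) {z w : ℂ} (hz : ‖z‖ < 1) (hw : ‖w‖ < 1)
    (h : mob a z = mob a w) : z = w := by
  rw [← mob_inv ha hz, h, mob_inv ha hw]

lemma koebe_step {V : Set ℂ} (hVo : IsOpen V) (hVc : IsPreconnected V) (hh : NoHole V)
    (h0 : (0:ℂ) ∈ V) {Φ : ℂ → ℂ} (hΦ : KF V Φ) {a : ℂ} (ha : ‖a‖ < 1) (haV : a ∉ Φ '' V) :
    ∃ Ψ, KF V Ψ ∧ ‖deriv Ψ 0‖ * (2 * Real.sqrt ‖a‖) = ‖deriv Φ 0‖ * (1 + ‖a‖) := by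
  obtain ⟨hP, hi, hm, hz, hdn⟩ := hΦ
  have hg1 := PAon.mob hh hP ha hm
  have hg1n : ∀ z ∈ V, mob a (Φ z) ≠ 0 := by
    intro z hzV h
    rw [mob, mul_eq_zero] at h
    rcases h with h | h
    · exact haV ⟨z, hzV, by linear_combination h⟩
    · exact mob_den_ne ha (hm z hzV) (inv_eq_zero.mp h)
  obtain ⟨F, hF, hFe⟩ := hg1.log hVo hVc hh hg1n
  let g2 : ℂ → ℂ := fun z => Complex.exp (1/2 * F z)
  have hg2 : PAon V g2 := ((PAon.const (1/2)).mul hF).cexp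
  have hsq : ∀ z ∈ V, g2 z * g2 z = mob a (Φ z) := by
    intro z hzV
    simp only [g2]
    rw [← Complex.exp_add, ← hFe z hzV]
    congr 1
    ring
  have hg2m : ∀ z ∈ V, ‖g2 z‖ < 1 := by
    intro z hzV
    have h1 := mob_norm_lt ha (hm z hzV)
    rw [← hsq z hzV, norm_mul] at h1
    nlinarith [norm_nonneg (g2 z)]
  have hg2i : InjOn g2 V := by
    intro z hzV w hw h
    apply hi hzV hw
    apply mob_injOn ha (hm z hzV) (hm w hw)
    rw [← hsq z hzV, ← hsq w hw, h]
  set b := g2 0 with hb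
  have hb1 : ‖b‖ < 1 := hg2m 0 h0
  have hbb : b * b = -a := by
    rw [hb, hsq 0 h0, hz]; simp [mob]
  have hbn : ‖b‖ = Real.sqrt ‖a‖ := by
    have : ‖b‖ * ‖b‖ = ‖a‖ := by rw [← norm_mul, hbb, norm_neg]
    rw [← this, Real.sqrt_mul_self (norm_nonneg _)]
  refine ⟨fun z => mob b (g2 z), ⟨PAon.mob hh hg2 hb1 hg2m, ?_, ?_, ?_, ?_⟩, ?_⟩
  · intro z hzV w hw h
    exact hg2i hzV hw (mob_injOn hb1 (hg2m z hzV) (hg2m w hw) h)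
  · intro z hzV
    exact mob_norm_lt hb1 (hg2m z hzV)
  · simp [mob, ← hb]
  · intro z hzV
    have hΦd : HasDerivAt Φ (deriv Φ z) z :=
      ((hP.differentiableOn hVo).differentiableAt (hVo.mem_nhds hzV)).hasDerivAt
    have hg2d : HasDerivAt g2 (deriv g2 z) z :=
      ((hg2.differentiableOn hVo).differentiableAt (hVo.mem_nhds hzV)).hasDerivAt
    have e1 : HasDerivAt (fun z => mob a (Φ z)) _ z :=
      HasDerivAt.comp z (mob_hasDerivAt ha (hm z hzV)) hΦd
    have e2 := hg2d.fun_mul hg2d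
    have e3 := (e2.congr_of_eventuallyEq (f₁ := fun z => mob a (Φ z))
      (by filter_upwards [hVo.mem_nhds hzV] with z hzV using (hsq z hzV).symm)).unique e1
    have e4 : HasDerivAt (fun z => mob b (g2 z)) _ z :=
      HasDerivAt.comp z (mob_hasDerivAt hb1 (hg2m z hzV)) hg2d
    have hne : ∀ {a z : ℂ}, ‖a‖ < 1 → ‖z‖ < 1 →
        (1 - (starRingEnd ℂ) a * a) * ((1 - (starRingEnd ℂ) a * z)⁻¹)^2 ≠ 0 := fun h h' =>
      mul_ne_zero (mob_den_ne h h) (pow_ne_zero _ (inv_ne_zero (mob_den_ne h h')))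
    rw [e4.deriv]
    refine mul_ne_zero (hne hb1 (hg2m z hzV)) ?_
    intro h
    rw [h] at e3
    refine mul_ne_zero (hne ha (hm z hzV)) (hdn z hzV) ?_
    rw [← e3]; ring
  · have hΦd : HasDerivAt Φ (deriv Φ 0) 0 :=
      ((hP.differentiableOn hVo).differentiableAt (hVo.mem_nhds h0)).hasDerivAt
    have hg2d : HasDerivAt g2 (deriv g2 0) 0 :=
      ((hg2.differentiableOn hVo).differentiableAt (hVo.mem_nhds h0)).hasDerivAt
    have e1 : HasDerivAt (fun z => mob a (Φ z)) _ 0 :=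
      HasDerivAt.comp (0:ℂ) (mob_hasDerivAt ha (hm 0 h0)) hΦd
    have e2 := hg2d.fun_mul hg2d
    have e3 := (e2.congr_of_eventuallyEq (f₁ := fun z => mob a (Φ z))
      (by filter_upwards [hVo.mem_nhds h0] with z hzV using (hsq z hzV).symm)).unique e1
    have e4 : HasDerivAt (fun z => mob b (g2 z)) _ 0 :=
      HasDerivAt.comp (0:ℂ) (mob_hasDerivAt hb1 hb1) hg2d
    rw [e4.deriv]
    rw [hz, ← hb] at e3
    have hbc := mob_den_ne hb1 hb1
    have hcb : (1 - (starRingEnd ℂ) a * a) = (1 - (starRingEnd ℂ) b * b) * (1 + (starRingEnd ℂ) b * b) := by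
      have : a = -(b*b) := by rw [hbb]; ring
      rw [this]
      simp only [map_neg, map_mul]
      ring
    have e5 : (1 - (starRingEnd ℂ) b * b) * ((1 - (starRingEnd ℂ) b * b)⁻¹)^2 * deriv g2 0 * (2 * b)
        = deriv Φ 0 * (1 + (starRingEnd ℂ) b * b) := by
      have : deriv g2 0 * (2*b) = (1 - (starRingEnd ℂ) b * b) * (1 + (starRingEnd ℂ) b * b) * deriv Φ 0 := by
        rw [← hcb]
        simp only [mul_zero, sub_zero, inv_one, one_pow, mul_one] at e3
        linear_combination e3
      rw [mul_assoc, this]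
      field_simp
    have e6 := congrArg norm e5
    rw [norm_mul, norm_mul (deriv Φ 0)] at e6
    have e7 : ‖1 + (starRingEnd ℂ) b * b‖ = 1 + ‖a‖ := by
      have : (1 + (starRingEnd ℂ) b * b) = ((1 + ‖a‖ : ℝ) : ℂ) := by
        rw [← Complex.normSq_eq_conj_mul_self, Complex.normSq_eq_norm_sq, hbn, Real.sq_sqrt (norm_nonneg _)]
        push_cast; rfl
      rw [this, Complex.norm_real, Real.norm_of_nonneg (by positivity)]
    rw [e7] at e6
    rw [← hbn, ← e6, ← hb]
    congr 1
    simp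

theorem koebe {V : Set ℂ} (hVo : IsOpen V) (hVc : IsPreconnected V) (hVb : Bornology.IsBounded V)
    (hh : NoHole V) (h0 : (0:ℂ) ∈ V) {E : Set ℂ} (hE : IsCompact E) (hEV : E ⊆ V) :
    ∃ (Φ : ℂ → ℂ) (ρ r : ℝ), 0 < ρ ∧ ρ < r ∧ r < 1 ∧ DifferentiableOn ℂ Φ V ∧ InjOn Φ V ∧ Φ 0 = 0 ∧
      (∀ z ∈ V, deriv Φ z ≠ 0) ∧
      (∀ z ∈ V, ‖Φ z‖ < 1) ∧ ball 0 r ⊆ Φ '' V ∧ ∀ z ∈ E, ‖Φ z‖ ≤ ρ := by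
  obtain ⟨ρ, hρ0, hρ1, hρ⟩ := schwarz_bound hVo hVc h0 hE hEV
  let r := (ρ + 1)/2
  have hr0 : 0 < r := by positivity
  have hr1 : r < 1 := by simp only [r]; linarith
  have hrρ : ρ < r := by simp only [r]; linarith
  let D : Set ℝ := {x | ∃ Φ, KF V Φ ∧ x = ‖deriv Φ 0‖}
  have hDb : BddAbove D := by
    obtain ⟨δ, hδ, hδs⟩ := Metric.isOpen_iff.mp hVo 0 h0
    refine ⟨1/δ, ?_⟩
    rintro x ⟨Φ, ⟨hP, hi, hm, hz, hdn⟩, rfl⟩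
    apply Complex.norm_deriv_le_div_of_mapsTo_ball ((hP.differentiableOn hVo).mono hδs) _ hδ
    intro z hz'
    rw [hz, mem_closedBall_zero_iff]
    exact (hm z (hδs hz')).le
  obtain ⟨B, hB0, hB⟩ := hVb.exists_pos_norm_lt
  have hne : (1/B) ∈ D := by
    refine ⟨fun z => ((1/B : ℝ) : ℂ) * z, ⟨?_, ?_, ?_, by simp, ?_⟩, ?_⟩
    · exact (PAon.poly (Polynomial.C ((1/B : ℝ) : ℂ) * Polynomial.X)).congr (fun z _ => by simp)
    · intro z _ w _ h
      have : ((1/B : ℝ) : ℂ) ≠ 0 := by exact_mod_cast (by positivity : (1/B) ≠ 0)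
      exact mul_left_cancel₀ this h
    · intro z hz
      rw [norm_mul, Complex.norm_real, Real.norm_of_nonneg (by positivity)]
      rw [div_mul_eq_mul_div, one_mul, div_lt_one hB0]
      exact hB z hz
    · intro z _
      have : HasDerivAt (fun z : ℂ => ((1/B : ℝ) : ℂ) * z) ((1/B : ℝ) : ℂ) z := by
        simpa using (hasDerivAt_id z).const_mul ((1/B : ℝ) : ℂ)
      rw [this.deriv]
      exact_mod_cast (by positivity : (1/B) ≠ 0)
    · have : HasDerivAt (fun z : ℂ => ((1/B : ℝ) : ℂ) * z) ((1/B : ℝ) : ℂ) 0 := by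
        simpa using (hasDerivAt_id (0:ℂ)).const_mul ((1/B : ℝ) : ℂ)
      rw [this.deriv, Complex.norm_real, Real.norm_of_nonneg (by positivity)]
  set M := sSup D with hM
  have hM0 : 0 < M := lt_of_lt_of_le (by positivity) (le_csSup hDb hne)
  let s := Real.sqrt r
  have hs0 : 0 < s := Real.sqrt_pos.mpr hr0
  have hs1 : s < 1 := by rw [Real.sqrt_lt' one_pos]; linarith
  let c := (1 + s^2)/(2*s)
  have hc : 1 < c := by
    rw [lt_div_iff₀ (by positivity)]
    nlinarith [sq_nonneg (1 - s), mul_pos (sub_pos.mpr hs1) (sub_pos.mpr hs1)]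
  obtain ⟨x, ⟨Φ, hΦ, rfl⟩, hx⟩ := exists_lt_of_lt_csSup (b := M/c) ⟨_, hne⟩ (by
    rw [← hM, div_lt_iff₀ (by linarith)]; nlinarith)
  obtain ⟨hP, hi, hm, hz, hdn⟩ := id hΦ
  refine ⟨Φ, ρ, r, hρ0, hrρ, hr1, hP.differentiableOn hVo, hi, hz, hdn, hm, ?_,
    hρ Φ (hP.differentiableOn hVo) hm hz⟩
  intro a ha
  rw [mem_ball_zero_iff] at ha
  by_contra haV
  obtain ⟨Ψ, hΨ, hder⟩ := koebe_step hVo hVc hh h0 hΦ (ha.trans hr1) haV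
  have ha0 : a ≠ 0 := fun h => haV ⟨0, h0, by rw [hz, h]⟩
  have hle : ‖deriv Ψ 0‖ ≤ M := le_csSup hDb ⟨Ψ, hΨ, rfl⟩
  set t := Real.sqrt ‖a‖ with ht
  have ht0 : 0 < t := Real.sqrt_pos.mpr (norm_pos_iff.mpr ha0)
  have hts : t ≤ s := Real.sqrt_le_sqrt ha.le
  have ht2 : ‖a‖ = t^2 := (Real.sq_sqrt (norm_nonneg _)).symm
  rw [ht2] at hder
  have hct : c ≤ (1 + t^2)/(2*t) := by
    rw [div_le_div_iff₀ (by positivity) (by positivity)]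
    nlinarith [mul_nonneg (sub_nonneg.mpr hts) (by nlinarith : (0:ℝ) ≤ 1 - s*t)]
  have h5 : ‖deriv Ψ 0‖ = ‖deriv Φ 0‖ * ((1 + t^2)/(2*t)) := by
    field_simp
    linarith
  rw [div_lt_iff₀ (by linarith)] at hx
  have : M < ‖deriv Ψ 0‖ := by
    rw [h5]
    exact hx.trans_le (mul_le_mul_of_nonneg_left hct (norm_nonneg _))
  linarith

end NW
end

section
open Complex Set Filter Topology Metric

namespace NW

structure PM (O : Set ℂ) (g : ℂ → ℂ) (R : ℝ) : Prop where
  op : IsOpen O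
  diff : DifferentiableOn ℂ g O
  lt : ∀ w ∈ O, ‖g w‖ < R
  proper : ∀ r < R, IsCompact {w | w ∈ O ∧ ‖g w‖ ≤ r}
  crit : {w | w ∈ O ∧ deriv g w = 0}.Finite

def fibS (O : Set ℂ) (g : ℂ → ℂ) (Y : ℂ) : Set ℂ := {w | w ∈ O ∧ g w = Y}

variable {O : Set ℂ} {g : ℂ → ℂ} {R : ℝ}

lemma PM.analyticAt (h : PM O g R) {w : ℂ} (hw : w ∈ O) : AnalyticAt ℂ g w :=
  (h.diff.analyticOnNhd h.op) w hw

lemma PM.not_const (h : PM O g R) {w : ℂ} (hw : w ∈ O) : ¬ ∀ᶠ x in 𝓝 w, g x = g w := by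
  intro hc
  have h1 : ∀ᶠ x in 𝓝 w, deriv g x = 0 := by
    filter_upwards [hc.eventually_nhds] with x hx
    have : g =ᶠ[𝓝 x] fun _ => g w := hx
    rw [this.deriv_eq]; simp
  exact infinite_of_mem_nhds w (h1.and (h.op.mem_nhds hw)) (h.crit.subset fun x hx => ⟨hx.2, hx.1⟩)

lemma PM.isolated (h : PM O g R) {w : ℂ} (hw : w ∈ O) (c : ℂ) : ∀ᶠ x in 𝓝[≠] w, g x ≠ c := by
  rcases (h.analyticAt hw).eventually_eq_or_eventually_ne analyticAt_const (g := fun _ => c) with h1 | h1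
  · exfalso
    apply h.not_const hw
    have := h1.self_of_nhds
    have h2 : g w = c := this
    rw [h2]
    exact h1
  · exact h1

lemma PM.fib_finite (h : PM O g R) (Y : ℂ) : (fibS O g Y).Finite := by
  by_cases hY : ‖Y‖ < R
  swap
  · convert Set.finite_empty
    rw [Set.eq_empty_iff_forall_notMem]
    rintro w ⟨hw, rfl⟩
    exact hY (h.lt w hw)
  have hK := h.proper _ hY
  have hc : IsCompact (fibS O g Y) := by
    have : IsClosed ({w | w ∈ O ∧ ‖g w‖ ≤ ‖Y‖} ∩ g ⁻¹' {Y}) :=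
      (h.diff.continuousOn.mono fun w hw => hw.1).preimage_isClosed_of_isClosed hK.isClosed isClosed_singleton
    convert hK.inter_right this using 1
    ext w
    simp only [fibS, mem_ofPred_eq, mem_inter_iff, mem_preimage, mem_singleton_iff]
    constructor
    · rintro ⟨a, rfl⟩
      simp [a]
    · rintro ⟨⟨a, -⟩, -, b⟩
      exact ⟨a, b⟩
  by_contra hinf
  have hinf : (fibS O g Y).Infinite := hinf
  obtain ⟨x, hx, hacc⟩ := hinf.exists_accPt_of_subset_isCompact hc subset_rfl
  have := h.isolated hx.1 Y
  rw [accPt_iff_frequently_nhdsNE] at hacc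
  exact hacc (this.mono fun y hy hy' => hy hy'.2)

noncomputable def PM.fib (h : PM O g R) (Y : ℂ) : Finset ℂ := (h.fib_finite Y).toFinset

lemma PM.mem_fib (h : PM O g R) {Y w : ℂ} : w ∈ h.fib Y ↔ w ∈ O ∧ g w = Y := by
  simp [PM.fib, fibS]

lemma PM.near (h : PM O g R) {Y : ℂ} (hY : ‖Y‖ < R) {N : Set ℂ} (hN : IsOpen N)
    (hs : ∀ w ∈ h.fib Y, w ∈ N) : ∀ᶠ Y' in 𝓝 Y, ∀ w ∈ h.fib Y', w ∈ N := by
  obtain ⟨r, hr1, hr2⟩ := exists_between hY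
  have hK := (h.proper r hr2).diff hN
  have himg := (hK.image_of_continuousOn (h.diff.continuousOn.mono fun w hw => hw.1.1)).isClosed
  have hnot : Y ∉ g '' ({w | w ∈ O ∧ ‖g w‖ ≤ r} \ N) := by
    rintro ⟨w, ⟨⟨hw, -⟩, hwN⟩, rfl⟩
    exact hwN (hs w (h.mem_fib.mpr ⟨hw, rfl⟩))
  filter_upwards [himg.isOpen_compl.mem_nhds hnot,
    (continuous_norm.tendsto Y).eventually (gt_mem_nhds hr1)] with Y' h1 h2 w hw
  rw [h.mem_fib] at hw
  by_contra hwN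
  exact h1 ⟨w, ⟨⟨hw.1, by rw [hw.2]; exact h2.le⟩, hwN⟩, hw.2⟩

lemma PM.fib_nonempty (h : PM O g R) (hne : O.Nonempty) {Y : ℂ} (hY : ‖Y‖ < R) :
    (h.fib Y).Nonempty := by
  have hsub : ball (0:ℂ) R ⊆ g '' O := by
    apply (convex_ball (0:ℂ) R).isPreconnected.subset_of_closure_inter_subset
    · rw [isOpen_iff_mem_nhds]
      rintro _ ⟨w, hw, rfl⟩
      rcases (h.analyticAt hw).eventually_constant_or_nhds_le_map_nhds with h1 | h1
      · exact absurd h1 (h.not_const hw)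
      · exact h1 (image_mem_map (h.op.mem_nhds hw))
    · obtain ⟨w, hw⟩ := hne
      exact ⟨g w, by simpa using h.lt w hw, w, hw, rfl⟩
    · rintro Y ⟨hYc, hY⟩
      by_contra hYn
      have h1 := h.near (Y := Y) (by simpa using hY) isOpen_empty (by
        intro w hw
        rw [h.mem_fib] at hw
        exact absurd ⟨w, hw.1, hw.2⟩ hYn)
      obtain ⟨Y', ⟨w, hw, rfl⟩, hn⟩ := ((mem_closure_iff_frequently.mp hYc).and_eventually h1).exists
      exact hn w (h.mem_fib.mpr ⟨hw, rfl⟩)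
  obtain ⟨w, hw, hwY⟩ := hsub (by simpa using hY)
  exact ⟨w, h.mem_fib.mpr ⟨hw, hwY⟩⟩

/-- a local branch of the inverse -/
lemma PM.branch (h : PM O g R) {w : ℂ} (hw : w ∈ O) (hd : deriv g w ≠ 0) {N : Set ℂ} (hN : N ∈ 𝓝 w) :
    ∃ b : ℂ → ℂ, ∃ N' ⊆ N, IsOpen N' ∧ w ∈ N' ∧ DifferentiableAt ℂ b (g w) ∧ b (g w) = w ∧
      ∀ᶠ Y in 𝓝 (g w), b Y ∈ N' ∧ g (b Y) = Y ∧ ∀ x ∈ N', g x = Y → x = b Y := by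
  have hs : HasStrictDerivAt g (deriv g w) w := (h.analyticAt hw).hasStrictDerivAt
  let b := hs.localInverse g (deriv g w) w hd
  have h1 : ∀ᶠ x in 𝓝 w, b (g x) = x := hs.eventually_left_inverse hd
  have h2 : ∀ᶠ Y in 𝓝 (g w), g (b Y) = Y := hs.eventually_right_inverse hd
  have h3 : b (g w) = w := h1.self_of_nhds
  have h4 : DifferentiableAt ℂ b (g w) := (hs.to_localInverse hd).hasDerivAt.differentiableAt
  obtain ⟨N', hN', hNo, hwN⟩ := _root_.mem_nhds_iff.mp (inter_mem hN h1)
  refine ⟨b, N', fun x hx => (hN' hx).1, hNo, hwN, h4, h3, ?_⟩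
  have h5 : Tendsto b (𝓝 (g w)) (𝓝 w) := by
    have := h4.continuousAt
    rw [ContinuousAt, h3] at this
    exact this
  filter_upwards [h2, h5.eventually (hNo.mem_nhds hwN)] with Y ha hb
  refine ⟨hb, ha, fun x hx hxY => ?_⟩
  rw [← hxY]
  exact (hN' hx).2.symm

/-- splitting of the fibres near a given value -/
lemma PM.split (h : PM O g R) {Y1 : ℂ} (hY : ‖Y1‖ < R) : ∃ N : ℂ → Set ℂ, ∃ b : ℂ → ℂ → ℂ,
    (∀ w ∈ h.fib Y1, IsOpen (N w) ∧ w ∈ N w ∧ N w ⊆ O) ∧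
    ((h.fib Y1 : Set ℂ).PairwiseDisjoint N) ∧
    (∀ w ∈ h.fib Y1, deriv g w ≠ 0 → DifferentiableAt ℂ (b w) Y1 ∧ b w Y1 = w ∧
      ∀ᶠ Y in 𝓝 Y1, b w Y ∈ N w ∧ g (b w Y) = Y ∧ ∀ x ∈ N w, g x = Y → x = b w Y) := by
  obtain ⟨U, hU, hdis⟩ := (h.fib_finite Y1).t2_separation
  have key : ∀ w, ∃ N : Set ℂ, ∃ b : ℂ → ℂ, w ∈ h.fib Y1 → (IsOpen N ∧ w ∈ N ∧ N ⊆ O) ∧ N ⊆ U w ∧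
      (deriv g w ≠ 0 → DifferentiableAt ℂ b Y1 ∧ b Y1 = w ∧
      ∀ᶠ Y in 𝓝 Y1, b Y ∈ N ∧ g (b Y) = Y ∧ ∀ x ∈ N, g x = Y → x = b Y) := by
    intro w
    by_cases hw : w ∈ h.fib Y1
    swap
    · exact ⟨∅, id, fun h => absurd h hw⟩
    have hw' := h.mem_fib.mp hw
    have hO : O ∩ U w ∈ 𝓝 w := inter_mem (h.op.mem_nhds hw'.1) ((hU w).2.mem_nhds (hU w).1)
    by_cases hd : deriv g w = 0
    · exact ⟨O ∩ U w, id, fun _ => ⟨⟨h.op.inter (hU w).2, ⟨hw'.1, (hU w).1⟩, inter_subset_left⟩,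
        inter_subset_right, fun h => absurd hd h⟩⟩
    · obtain ⟨b, N', hN, ho, hm, h1, h2, h3⟩ := h.branch hw'.1 hd hO
      rw [hw'.2] at h1 h2 h3
      exact ⟨N', b, fun _ => ⟨⟨ho, hm, fun x hx => (hN hx).1⟩, fun x hx => (hN hx).2, fun _ => ⟨h1, h2, h3⟩⟩⟩
  choose N b hNb using key
  refine ⟨N, b, fun w hw => (hNb w hw).1, ?_, fun w hw => (hNb w hw).2.2⟩
  intro x hx y hy hxy
  have hx' : x ∈ h.fib Y1 := by simpa using hx
  have hy' : y ∈ h.fib Y1 := by simpa using hy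
  have := hdis (x := x) (by simpa [PM.fib] using hx) (y := y) (by simpa [PM.fib] using hy) hxy
  exact this.mono (hNb x hx').2.1 (hNb y hy').2.1

open Classical in
lemma PM.sum_split (h : PM O g R) {Y1 : ℂ} (hY : ‖Y1‖ < R) {N : ℂ → Set ℂ}
    (hN : ∀ w ∈ h.fib Y1, IsOpen (N w) ∧ w ∈ N w)
    (hd : (h.fib Y1 : Set ℂ).PairwiseDisjoint N) :
    ∀ᶠ Y in 𝓝 Y1, ∀ τ : ℂ → ℂ, ∑ x ∈ h.fib Y, τ x =
      ∑ w ∈ h.fib Y1, ∑ x ∈ (h.fib Y).filter (fun x => x ∈ N w), τ x := by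
  have := h.near hY (N := ⋃ w ∈ h.fib Y1, N w) (isOpen_biUnion fun w hw => (hN w hw).1)
    (fun w hw => mem_biUnion hw (hN w hw).2)
  filter_upwards [this] with Y hYn τ
  rw [← Finset.sum_biUnion]
  · apply Finset.sum_congr _ (fun _ _ => rfl)
    ext x
    simp only [Finset.mem_biUnion, Finset.mem_filter]
    constructor
    · intro hx
      have := hYn x hx
      simp only [mem_iUnion] at this
      obtain ⟨w, hw, hxw⟩ := this
      exact ⟨w, hw, hx, hxw⟩
    · rintro ⟨w, -, hx, -⟩
      exact hx
  · intro x hx y hy hxy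
    rw [Function.onFun, Finset.disjoint_left]
    intro a ha hb
    rw [Finset.mem_filter] at ha hb
    exact (disjoint_left.mp (hd hx hy hxy)) ha.2 hb.2

open Classical in
lemma PM.filter_eq (h : PM O g R) {N : Set ℂ} (hN : N ⊆ O) {y Y : ℂ}
    (hb : y ∈ N ∧ g y = Y ∧ ∀ x ∈ N, g x = Y → x = y) :
    (h.fib Y).filter (fun x => x ∈ N) = {y} := by
  ext x
  rw [Finset.mem_filter, h.mem_fib, Finset.mem_singleton]
  constructor
  · rintro ⟨⟨h1, h2⟩, h3⟩
    exact hb.2.2 x h3 h2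
  · rintro rfl
    exact ⟨⟨hN hb.1, hb.2.1⟩, hb.1⟩

/-- near a non critical value, traces are sums over branches -/
lemma PM.trace_good (h : PM O g R) {Y1 : ℂ} (hY : ‖Y1‖ < R) (hc : ∀ w ∈ h.fib Y1, deriv g w ≠ 0) :
    ∃ b : ℂ → ℂ → ℂ, (∀ w ∈ h.fib Y1, DifferentiableAt ℂ (b w) Y1 ∧ b w Y1 = w) ∧
     ∀ᶠ Y in 𝓝 Y1, ∀ τ : ℂ → ℂ, ∑ x ∈ h.fib Y, τ x = ∑ w ∈ h.fib Y1, τ (b w Y) := by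
  classical
  obtain ⟨N, b, h1, h2, h3⟩ := h.split hY
  refine ⟨b, fun w hw => ⟨(h3 w hw (hc w hw)).1, (h3 w hw (hc w hw)).2.1⟩, ?_⟩
  have h4 : ∀ᶠ Y in 𝓝 Y1, ∀ w ∈ h.fib Y1, b w Y ∈ N w ∧ g (b w Y) = Y ∧ ∀ x ∈ N w, g x = Y → x = b w Y :=
    (Filter.eventually_all_finset _).mpr fun w hw => (h3 w hw (hc w hw)).2.2
  filter_upwards [h4, h.sum_split hY (fun w hw => ⟨(h1 w hw).1, (h1 w hw).2.1⟩) h2] with Y ha hb τ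
  rw [hb τ]
  apply Finset.sum_congr rfl
  intro w hw
  rw [h.filter_eq (h1 w hw).2.2 (ha w hw), Finset.sum_singleton]

lemma PM.trace_diff (h : PM O g R) {Y1 : ℂ} (hY : ‖Y1‖ < R) (hc : ∀ w ∈ h.fib Y1, deriv g w ≠ 0)
    {τ : ℂ → ℂ} (hτ : ∀ w ∈ h.fib Y1, DifferentiableAt ℂ τ w) :
    DifferentiableAt ℂ (fun Y => ∑ x ∈ h.fib Y, τ x) Y1 := by
  obtain ⟨b, h1, h2⟩ := h.trace_good hY hc
  have : DifferentiableAt ℂ (fun Y => ∑ w ∈ h.fib Y1, τ (b w Y)) Y1 := by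
    apply DifferentiableAt.fun_sum
    intro w hw
    apply DifferentiableAt.comp (g := τ) Y1 _ (h1 w hw).1
    rw [(h1 w hw).2]
    exact hτ w hw
  exact this.congr_of_eventuallyEq (h2.mono fun Y hY => hY τ)

lemma isPreconnected_punctured (c : ℂ) {δ : ℝ} (hδ : 0 < δ) : IsPreconnected (ball c δ \ {c}) := by
  have hc : Convex ℝ {t : ℂ | t.re < Real.log δ} := convex_halfSpace_re_lt _
  have := hc.isPreconnected.image (fun t => c + Complex.exp t) (by fun_prop)
  convert this using 1
  ext z
  simp only [Set.mem_sdiff, mem_ball, mem_singleton_iff, mem_image, mem_ofPred_eq]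
  constructor
  · rintro ⟨h1, h2⟩
    have h3 : z - c ≠ 0 := sub_ne_zero.mpr h2
    refine ⟨Complex.log (z - c), ?_, by rw [Complex.exp_log h3]; ring⟩
    rw [Complex.log_re]
    rw [dist_eq_norm] at h1
    exact Real.log_lt_log (norm_pos_iff.mpr h3) h1
  · rintro ⟨t, ht, rfl⟩
    refine ⟨?_, by simp⟩
    rw [dist_eq_norm, add_sub_cancel_left, Complex.norm_exp]
    rwa [← Real.lt_log_iff_exp_lt hδ]

lemma PM.crit_values (h : PM O g R) (Y1 : ℂ) : ∀ᶠ Y in 𝓝[≠] Y1, ∀ w ∈ h.fib Y, deriv g w ≠ 0 := by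
  have hf : (g '' {w | w ∈ O ∧ deriv g w = 0} \ {Y1}).Finite := (h.crit.image g).sdiff
  have := hf.isClosed.isOpen_compl.mem_nhds (x := Y1) (by simp)
  filter_upwards [mem_nhdsWithin_of_mem_nhds this, self_mem_nhdsWithin] with Y h1 h2 w hw hd
  rw [h.mem_fib] at hw
  exact h1 ⟨⟨w, ⟨hw.1, hd⟩, hw.2⟩, h2⟩

lemma PM.card_bound (h : PM O g R) {Y1 : ℂ} (hY : ‖Y1‖ < R) :
    ∃ d : ℕ, ∀ᶠ Y in 𝓝[≠] Y1, (h.fib Y).card ≤ d := by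
  have h1 : ∀ᶠ Y in 𝓝[≠] Y1, (∀ w ∈ h.fib Y, deriv g w ≠ 0) ∧ ‖Y‖ < R :=
    (h.crit_values Y1).and (mem_nhdsWithin_of_mem_nhds
      ((continuous_norm.tendsto Y1).eventually (gt_mem_nhds hY)))
  rw [eventually_nhdsWithin_iff, Metric.eventually_nhds_iff_ball] at h1
  obtain ⟨δ, hδ, hb⟩ := h1
  have hlc : ∀ Y ∈ ball Y1 δ \ {Y1}, ∀ᶠ Y' in 𝓝 Y, (h.fib Y').card = (h.fib Y).card := by
    rintro Y ⟨hYb, hYn⟩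
    obtain ⟨hc, hYR⟩ := hb Y hYb hYn
    obtain ⟨b, -, h3⟩ := h.trace_good hYR hc
    filter_upwards [h3] with Y' hY'
    have := hY' (fun _ => 1)
    simp only [Finset.sum_const, nsmul_eq_mul, mul_one] at this
    exact_mod_cast this
  have hconn := isPreconnected_punctured Y1 hδ
  have hcont : ContinuousOn (fun Y => (h.fib Y).card) (ball Y1 δ \ {Y1}) := by
    intro Y hY
    apply ContinuousAt.continuousWithinAt
    exact continuousAt_const.congr ((hlc Y hY).mono fun _ h => h.symm)
  have hne : Y1 + (δ/2 : ℝ) ∈ ball Y1 δ \ {Y1} := by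
    constructor
    · rw [mem_ball, dist_eq_norm, add_sub_cancel_left, Complex.norm_real, Real.norm_of_nonneg (by positivity)]
      linarith
    · simp [hδ.ne']
  refine ⟨(h.fib (Y1 + (δ/2 : ℝ))).card, ?_⟩
  rw [eventually_nhdsWithin_iff, Metric.eventually_nhds_iff_ball]
  refine ⟨δ, hδ, fun Y hY hYn => ?_⟩
  have := (hconn.constant hcont ⟨hY, hYn⟩ hne)
  exact this.le

lemma PM.trace_limit (h : PM O g R) {Y1 : ℂ} (hY : ‖Y1‖ < R) {τ : ℂ → ℂ} {c : ℂ → ℂ}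
    (hc : ∀ w ∈ h.fib Y1, Tendsto (fun x => (g x - Y1) * τ x) (𝓝[≠] w) (𝓝 (c w)))
    (hc0 : ∀ w ∈ h.fib Y1, deriv g w = 0 → c w = 0) :
    Tendsto (fun Y => (Y - Y1) * ∑ x ∈ h.fib Y, τ x) (𝓝[≠] Y1) (𝓝 (∑ w ∈ h.fib Y1, c w)) := by
  classical
  obtain ⟨N, b, h1, h2, h3⟩ := h.split hY
  obtain ⟨d, hd⟩ := h.card_bound hY
  have hs := mem_nhdsWithin_of_mem_nhds (t := {Y1}ᶜ)
    (h.sum_split hY (fun w hw => ⟨(h1 w hw).1, (h1 w hw).2.1⟩) h2)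
  have key : Tendsto (fun Y => ∑ w ∈ h.fib Y1, ∑ x ∈ (h.fib Y).filter (fun x => x ∈ N w), (g x - Y1) * τ x)
      (𝓝[≠] Y1) (𝓝 (∑ w ∈ h.fib Y1, c w)) := by
    apply tendsto_finsetSum
    intro w hw
    by_cases hcr : deriv g w = 0
    · rw [hc0 w hw hcr, Metric.tendsto_nhds]
      intro ε hε
      have hcw := hc w hw
      rw [hc0 w hw hcr, Metric.tendsto_nhds] at hcw
      have h4 := hcw (ε/(d+1)) (by positivity)
      rw [eventually_nhdsWithin_iff] at h4
      obtain ⟨Q, hQ, hQo, hwQ⟩ := _root_.mem_nhds_iff.mp h4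
      -- the fibres near w are in Q
      have h5 := h.near hY (N := ⋃ v ∈ h.fib Y1, (if v = w then N w ∩ Q else N v))
        (isOpen_biUnion fun v hv => by
          split_ifs
          · exact (h1 w hw).1.inter hQo
          · exact (h1 v hv).1)
        (fun v hv => by
          refine mem_biUnion hv ?_
          split_ifs with hvw
          · rw [hvw]; exact ⟨(h1 w hw).2.1, hwQ⟩
          · exact (h1 v hv).2.1)
      filter_upwards [mem_nhdsWithin_of_mem_nhds h5, hd, self_mem_nhdsWithin] with Y h5 hd hYne
      rw [dist_zero_right]
      have hterm : ∀ x ∈ (h.fib Y).filter (fun x => x ∈ N w), ‖(g x - Y1) * τ x‖ ≤ ε/(d+1) := by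
        intro x hx
        rw [Finset.mem_filter] at hx
        have h6 := h5 x hx.1
        simp only [mem_iUnion] at h6
        obtain ⟨v, hv, hxv⟩ := h6
        have hvw : v = w := by
          by_contra hne
          rw [if_neg hne] at hxv
          exact (disjoint_left.mp (h2 hv hw hne)) hxv hx.2
        rw [if_pos hvw] at hxv
        have hxw : x ≠ w := by
          rintro rfl
          rw [h.mem_fib] at hw hx
          exact hYne (hx.1.2.symm.trans hw.2)
        have := hQ hxv.2 hxw
        rw [dist_zero_right] at this
        exact this.le
      calc _ ≤ _ := norm_sum_le_of_le _ hterm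
        _ = ((h.fib Y).filter (fun x => x ∈ N w)).card * (ε/(d+1)) := by
          rw [Finset.sum_const, nsmul_eq_mul]
        _ ≤ d * (ε/(d+1)) := by
          gcongr
          exact_mod_cast (Finset.card_filter_le _ _).trans hd
        _ < ε := by
          rw [mul_div_assoc', div_lt_iff₀ (by positivity)]
          nlinarith
    · obtain ⟨hb1, hb2, hb3⟩ := h3 w hw hcr
      have hbt : Tendsto (b w) (𝓝[≠] Y1) (𝓝[≠] w) := by
        rw [tendsto_nhdsWithin_iff]
        constructor
        · have := hb1.continuousAt
          rw [ContinuousAt, hb2] at this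
          exact this.mono_left nhdsWithin_le_nhds
        · filter_upwards [mem_nhdsWithin_of_mem_nhds hb3, self_mem_nhdsWithin] with Y hY hYne heq
          simp only [mem_singleton_iff] at heq
          rw [heq] at hY
          rw [h.mem_fib] at hw
          exact hYne (hY.2.1.symm.trans hw.2)
      refine ((hc w hw).comp hbt).congr' ?_
      filter_upwards [mem_nhdsWithin_of_mem_nhds hb3] with Y hY
      rw [h.filter_eq (h1 w hw).2.2 hY, Finset.sum_singleton, Function.comp]
  refine key.congr' ?_
  filter_upwards [hs] with Y hs
  rw [← hs (fun x => (g x - Y1) * τ x), Finset.mul_sum]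
  apply Finset.sum_congr rfl
  intro x hx
  rw [h.mem_fib] at hx
  rw [hx.2]

end NW
end

section
open Complex Set Filter Topology Metric

namespace NW

lemma removable_finite {U B : Set ℂ} (hU : IsOpen U) (hB : B.Finite) {S : ℂ → ℂ}
    (hd : ∀ Y ∈ U, Y ∉ B → DifferentiableAt ℂ S Y)
    (hl : ∀ Y ∈ U, Y ∈ B → Tendsto (fun y => (y - Y) * S y) (𝓝[≠] Y) (𝓝 0)) :
    ∃ S' : ℂ → ℂ, DifferentiableOn ℂ S' U ∧ ∀ Y ∈ U, Y ∉ B → S' Y = S Y := by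
  have heq : ∀ Y ∈ U, Y ∉ B → limUnder (𝓝[≠] Y) S = S Y := by
    intro Y hY hYB
    exact ((hd Y hY hYB).continuousAt.tendsto.mono_left nhdsWithin_le_nhds).limUnder_eq
  refine ⟨fun Y => limUnder (𝓝[≠] Y) S, ?_, heq⟩
  intro Y hY
  apply DifferentiableAt.differentiableWithinAt
  have hnb : U ∩ (B \ {Y})ᶜ ∈ 𝓝 Y := inter_mem (hU.mem_nhds hY)
    ((hB.sdiff).isClosed.isOpen_compl.mem_nhds (by simp))
  have hB' : ∀ y ∈ U ∩ (B \ {Y})ᶜ, y ≠ Y → y ∈ U ∧ y ∉ B := by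
    rintro y ⟨h1, h2⟩ hy
    exact ⟨h1, fun h => h2 ⟨h, hy⟩⟩
  have hlim : Tendsto (fun y => (y - Y) * S y) (𝓝[≠] Y) (𝓝 0) := by
    by_cases hYB : Y ∈ B
    · exact hl Y hY hYB
    · have : Tendsto (fun y => (y - Y) * S y) (𝓝 Y) (𝓝 ((Y - Y) * S Y)) :=
        (tendsto_id.sub_const Y).mul (hd Y hY hYB).continuousAt.tendsto
      rw [sub_self, zero_mul] at this
      exact this.mono_left nhdsWithin_le_nhds
  have ho : (fun z => S z - S Y) =o[𝓝[≠] Y] fun z => (z - Y)⁻¹ := by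
    have hne : ∀ᶠ z in 𝓝[≠] Y, (z - Y)⁻¹ = 0 → S z - S Y = 0 := by
      filter_upwards [self_mem_nhdsWithin] with z hz h
      exact absurd (inv_eq_zero.mp h) (sub_ne_zero.mpr hz)
    rw [Asymptotics.isLittleO_iff_tendsto' hne]
    have h2 : Tendsto (fun y => (y - Y) * S y - (y - Y) * S Y) (𝓝[≠] Y) (𝓝 (0 - (Y - Y) * S Y)) :=
      hlim.sub (((tendsto_id.sub_const Y).mul_const (S Y)).mono_left nhdsWithin_le_nhds)
    simp only [sub_self, zero_mul] at h2
    refine h2.congr fun y => ?_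
    rw [div_inv_eq_mul]; ring
  have h1 := Complex.differentiableOn_update_limUnder_of_isLittleO hnb (f := S) (fun y hy =>
    ((hd y (hB' y hy.1 hy.2).1 (hB' y hy.1 hy.2).2)).differentiableWithinAt) ho
  have h2 := h1.differentiableAt hnb
  refine h2.congr_of_eventuallyEq ?_
  filter_upwards [hnb] with y hy
  by_cases hyY : y = Y
  · rw [hyY, Function.update_self]
  · rw [Function.update_of_ne hyY]
    exact heq y (hB' y hy hyY).1 (hB' y hy hyY).2

noncomputable def hZ (r : ℝ) (Z Y : ℂ) : ℂ :=
  (Y + Z) / (Y - Z) - ((r:ℂ)^2 + (starRingEnd ℂ) Z * Y) / ((r:ℂ)^2 - (starRingEnd ℂ) Z * Y)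

lemma hZ_den {r R1 : ℝ} {Z Y : ℂ} (hr : 0 < r) (hZ : ‖Z‖ * R1 < r^2) (hY : ‖Y‖ < R1) :
    (r:ℂ)^2 - (starRingEnd ℂ) Z * Y ≠ 0 := by
  intro h
  have h1 : (r:ℂ)^2 = (starRingEnd ℂ) Z * Y := by linear_combination h
  have h2 := congrArg norm h1
  rw [norm_mul, norm_pow, Complex.norm_real, Real.norm_of_nonneg hr.le, RCLike.norm_conj] at h2
  nlinarith [norm_nonneg Z]

lemma hZ_re {r : ℝ} {Z Y : ℂ} (hr : 0 < r) (hY : ‖Y‖ = r) (hZr : ‖Z‖ < r) : (hZ r Z Y).re = 0 := by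
  have hY0 : Y ≠ 0 := by rw [← norm_pos_iff, hY]; exact hr
  have h1 : (r:ℂ)^2 = Y * (starRingEnd ℂ) Y := by
    rw [Complex.mul_conj, Complex.normSq_eq_norm_sq, hY]; push_cast; rfl
  have h2 : ((r:ℂ)^2 + (starRingEnd ℂ) Z * Y) / ((r:ℂ)^2 - (starRingEnd ℂ) Z * Y) =
      (starRingEnd ℂ) ((Y + Z) / (Y - Z)) := by
    rw [h1, map_div₀, map_add, map_sub]
    rw [show Y * (starRingEnd ℂ) Y + (starRingEnd ℂ) Z * Y = Y * ((starRingEnd ℂ) Y + (starRingEnd ℂ) Z) by ring,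
      show Y * (starRingEnd ℂ) Y - (starRingEnd ℂ) Z * Y = Y * ((starRingEnd ℂ) Y - (starRingEnd ℂ) Z) by ring,
      mul_div_mul_left _ _ hY0]
  rw [NW.hZ, h2, Complex.sub_re, Complex.conj_re, sub_self]

lemma re_half {Y h : ℂ} (hlt : ‖h‖ < ‖Y‖) : 1/2 ≤ (Y / (Y - h)).re := by
  have hne : Y - h ≠ 0 := by
    intro h0
    rw [sub_eq_zero.mp h0] at hlt
    exact lt_irrefl _ hlt
  have hn : 0 < Complex.normSq (Y - h) := Complex.normSq_pos.mpr hne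
  have hsq : Complex.normSq h < Complex.normSq Y := by
    rw [Complex.normSq_eq_norm_sq, Complex.normSq_eq_norm_sq]
    exact pow_lt_pow_left₀ hlt (norm_nonneg _) (by norm_num)
  rw [Complex.div_re, ← add_div, div_le_div_iff₀ (by norm_num) hn]
  simp only [Complex.normSq_apply, Complex.sub_re, Complex.sub_im] at *
  nlinarith

variable {O : Set ℂ} {g h : ℂ → ℂ} {R ρ : ℝ}

theorem index_lemma (hg : PM O g R) (hne : O.Nonempty) (hh : DifferentiableOn ℂ h O)
    (hρ0 : 0 < ρ) (hρR : ρ < R) (hρ : ∀ w ∈ O, ‖h w‖ ≤ ρ) (h0 : ∀ w ∈ O, h w ≠ 0)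
    (hfin : {w | w ∈ O ∧ g w = h w}.Finite)
    (hfix : ∀ w ∈ O, g w = h w → ∃ μ : ℝ, 0 ≤ μ ∧ μ < 1 ∧ deriv g w = μ * deriv h w ∧ deriv h w ≠ 0) :
    False := by
  classical
  have hR0 : 0 < R := hρ0.trans hρR
  let Fix : Set ℂ := {w | w ∈ O ∧ g w = h w}
  let B : Set ℂ := g '' {w | w ∈ O ∧ deriv g w = 0} ∪ g '' Fix
  have hB : B.Finite := (hg.crit.image g).union (hfin.image g)
  have hderg : ∀ w ∈ O, HasDerivAt g (deriv g w) w := fun w hw => (hg.analyticAt hw).differentiableAt.hasDerivAt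
  have hderh : ∀ w ∈ O, HasDerivAt h (deriv h w) w := fun w hw =>
    (hh.differentiableAt (hg.op.mem_nhds hw)).hasDerivAt
  let τ : ℂ → ℂ := fun x => (g x - h x)⁻¹
  let cc : ℂ → ℝ := fun w => if g w = h w then
    (if hw : w ∈ O ∧ g w = h w then (hfix w hw.1 hw.2).choose / ((hfix w hw.1 hw.2).choose - 1) else 0) else 0
  have hcc : ∀ w ∈ O, g w = h w → ∃ μ : ℝ, 0 ≤ μ ∧ μ < 1 ∧ deriv g w = μ * deriv h w ∧ deriv h w ≠ 0 ∧
      cc w = μ / (μ - 1) := by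
    intro w hw hgh
    have := (hfix w hw hgh).choose_spec
    refine ⟨_, this.1, this.2.1, this.2.2.1, this.2.2.2, ?_⟩
    simp only [cc]
    rw [if_pos hgh, dif_pos ⟨hw, hgh⟩]
  have hcc0 : ∀ w, g w ≠ h w → cc w = 0 := by
    intro w hw
    simp only [cc]
    rw [if_neg hw]
  have hccle : ∀ w ∈ O, cc w ≤ 0 := by
    intro w hw
    by_cases hgh : g w = h w
    · obtain ⟨μ, h1, h2, -, -, h5⟩ := hcc w hw hgh
      rw [h5]
      exact div_nonpos_of_nonneg_of_nonpos h1 (by linarith)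
    · rw [hcc0 w hgh]
  have hcrit0 : ∀ w ∈ O, deriv g w = 0 → cc w = 0 := by
    intro w hw hd
    by_cases hgh : g w = h w
    · obtain ⟨μ, h1, h2, h3, h4, h5⟩ := hcc w hw hgh
      rw [hd] at h3
      have : μ = 0 := by
        rcases mul_eq_zero.mp h3.symm with h | h
        · exact_mod_cast h
        · exact absurd h h4
      rw [h5, this]; simp
    · rw [hcc0 w hgh]
  have hlimw : ∀ w ∈ O, Tendsto (fun x => (g x - g w) * τ x) (𝓝[≠] w) (𝓝 (cc w : ℂ)) := by
    intro w hw
    by_cases hgh : g w = h w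
    · obtain ⟨μ, h1, h2, h3, h4, h5⟩ := hcc w hw hgh
      have e1 := (hderg w hw).tendsto_slope
      have e2 := ((hderg w hw).fun_sub (hderh w hw)).tendsto_slope
      have hdn : deriv g w - deriv h w ≠ 0 := by
        rw [h3]
        have : ((μ:ℂ) - 1) ≠ 0 := by
          have : (μ - 1 : ℝ) ≠ 0 := by linarith
          exact_mod_cast this
        rw [show (μ:ℂ) * deriv h w - deriv h w = (μ - 1) * deriv h w by ring]
        exact mul_ne_zero this h4
      have e3 := e1.div e2 hdn
      have e4 : deriv g w / (deriv g w - deriv h w) = (cc w : ℂ) := by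
        rw [h5, h3]
        push_cast
        rw [show (μ:ℂ) * deriv h w - deriv h w = (μ - 1) * deriv h w by ring]
        exact mul_div_mul_right _ _ h4
      rw [e4] at e3
      refine e3.congr' ?_
      filter_upwards [self_mem_nhdsWithin] with x hx
      have hxw : x - w ≠ 0 := sub_ne_zero.mpr hx
      simp only [slope_def_field, τ, hgh, sub_self, sub_zero, Pi.div_apply]
      rw [div_div_div_cancel_right₀ hxw, div_eq_mul_inv]
    · rw [hcc0 w hgh]
      have e1 : ContinuousAt (fun x => (g x - g w) * τ x) w := by
        apply ContinuousAt.mul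
        · exact (hderg w hw).continuousAt.sub continuousAt_const
        · exact ((hderg w hw).continuousAt.sub (hderh w hw).continuousAt).inv₀ (sub_ne_zero.mpr hgh)
      have := e1.tendsto.mono_left (nhdsWithin_le_nhds (s := {w}ᶜ))
      simpa using this
  let T : ℂ → ℂ := fun Y => Y * ∑ x ∈ hg.fib Y, τ x
  let C : ℂ → ℝ := fun Y => ∑ w ∈ hg.fib Y, cc w
  have hCle : ∀ Y, C Y ≤ 0 := fun Y => Finset.sum_nonpos fun w hw => hccle w (hg.mem_fib.mp hw).1
  have hlimT' : ∀ Y1, ‖Y1‖ < R → Tendsto (fun Y => (Y - Y1) * ∑ x ∈ hg.fib Y, τ x) (𝓝[≠] Y1) (𝓝 (C Y1 : ℂ)) := by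
    intro Y1 hY1
    have := hg.trace_limit hY1 (τ := τ) (c := fun w => (cc w : ℂ)) (fun w hw => by
      rw [hg.mem_fib] at hw
      have := hlimw w hw.1
      rwa [hw.2] at this) (fun w hw hd => by
        rw [hg.mem_fib] at hw
        rw [hcrit0 w hw.1 hd]; simp)
    simp only [C]
    push_cast
    exact this
  -- points with C nonzero
  have hCz : ∀ Y, C Y ≠ 0 → ‖Y‖ ≤ ρ ∧ Y ≠ 0 ∧ Y ∈ B := by
    intro Y hC
    obtain ⟨w, hw, hcw⟩ := Finset.exists_ne_zero_of_sum_ne_zero hC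
    rw [hg.mem_fib] at hw
    have hgh : g w = h w := by
      by_contra hgh
      exact hcw (hcc0 w hgh)
    rw [← hw.2]
    exact ⟨hgh ▸ hρ w hw.1, hgh ▸ h0 w hw.1, Or.inr ⟨w, ⟨hw.1, hgh⟩, rfl⟩⟩
  -- choose r
  obtain ⟨r, ⟨hr1, hr2⟩, hrB⟩ : ∃ r ∈ Ioo ρ R, r ∉ norm '' B :=
    ((Ioo_infinite hρR).sdiff (hB.image norm)).nonempty
  have hr0 : 0 < r := hρ0.trans hr1
  obtain ⟨R1, hR1r, hR1R, hR1⟩ : ∃ R1, r < R1 ∧ R1 < R ∧ ρ * R1 < r^2 := by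
    have h1 : r < min R (r^2/ρ) := by
      rw [lt_min_iff]
      refine ⟨hr2, ?_⟩
      rw [lt_div_iff₀ hρ0]; nlinarith
    obtain ⟨R1, h2, h3⟩ := exists_between h1
    refine ⟨R1, h2, h3.trans_le (min_le_left _ _), ?_⟩
    have := h3.trans_le (min_le_right _ _)
    rw [lt_div_iff₀ hρ0] at this
    linarith
  let S : ℂ → ℂ := fun Y => T Y - ∑ Z ∈ hB.toFinset, ((C Z / 2 : ℝ) : ℂ) * hZ r Z Y
  -- differentiability of the correction
  have hZd : ∀ Z ∈ hB.toFinset, ∀ Y, ‖Y‖ < R1 → Y ≠ Z → DifferentiableAt ℂ (fun Y => ((C Z / 2 : ℝ) : ℂ) * hZ r Z Y) Y := by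
    intro Z hZB Y hY hYZ
    by_cases hC : C Z = 0
    · simp [hC]
    · have hZρ := (hCz Z hC).1
      have hden : (r:ℂ)^2 - (starRingEnd ℂ) Z * Y ≠ 0 :=
        hZ_den hr0 (R1 := R1) (by nlinarith [norm_nonneg Z]) hY
      have : Y - Z ≠ 0 := sub_ne_zero.mpr hYZ
      unfold hZ
      fun_prop (disch := assumption)
  have hSd : ∀ Y ∈ ball (0:ℂ) R1, Y ∉ B → DifferentiableAt ℂ S Y := by
    intro Y hY hYB
    rw [mem_ball_zero_iff] at hY
    apply DifferentiableAt.sub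
    · apply DifferentiableAt.mul differentiableAt_id
      apply hg.trace_diff (hY.trans hR1R)
      · intro w hw hd
        rw [hg.mem_fib] at hw
        exact hYB (Or.inl ⟨w, ⟨hw.1, hd⟩, hw.2⟩)
      · intro w hw
        rw [hg.mem_fib] at hw
        apply DifferentiableAt.fun_inv
        · exact (hderg w hw.1).differentiableAt.sub (hderh w hw.1).differentiableAt
        · intro he
          exact hYB (Or.inr ⟨w, ⟨hw.1, sub_eq_zero.mp he⟩, hw.2⟩)
    · apply DifferentiableAt.fun_sum
      intro Z hZB
      apply hZd Z hZB Y hY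
      rintro rfl
      exact hYB (by simpa using hZB)
  have hSl : ∀ Y ∈ ball (0:ℂ) R1, Y ∈ B → Tendsto (fun y => (y - Y) * S y) (𝓝[≠] Y) (𝓝 0) := by
    intro Y hY hYB
    rw [mem_ball_zero_iff] at hY
    have e1 : Tendsto (fun y => (y - Y) * T y) (𝓝[≠] Y) (𝓝 (Y * (C Y : ℂ))) := by
      have := ((tendsto_id (x := 𝓝 Y)).mono_left nhdsWithin_le_nhds).mul (hlimT' Y (hY.trans hR1R))
      refine this.congr fun y => ?_
      simp only [T, id]; ring
    have e2 : Tendsto (fun y => ∑ Z ∈ hB.toFinset, (y - Y) * (((C Z / 2 : ℝ) : ℂ) * hZ r Z y)) (𝓝[≠] Y)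
        (𝓝 (∑ Z ∈ hB.toFinset, if Z = Y then Y * (C Y : ℂ) else 0)) := by
      apply tendsto_finsetSum
      intro Z hZB
      split_ifs with hZY
      · subst hZY
        by_cases hC : C Z = 0
        · simp [hC]
        · have hden : (r:ℂ)^2 - (starRingEnd ℂ) Z * Z ≠ 0 :=
            hZ_den hr0 (R1 := R1) (by nlinarith [norm_nonneg Z, (hCz Z hC).1]) hY
          have hcont : ContinuousAt (fun y => ((C Z / 2 : ℝ) : ℂ) * ((y + Z) - (y - Z) *
            (((r:ℂ)^2 + (starRingEnd ℂ) Z * y) / ((r:ℂ)^2 - (starRingEnd ℂ) Z * y)))) Z := by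
            fun_prop (disch := assumption)
          have e3 := hcont.tendsto.mono_left (nhdsWithin_le_nhds (s := {Z}ᶜ))
          have e4 : ((C Z / 2 : ℝ) : ℂ) * ((Z + Z) - (Z - Z) *
            (((r:ℂ)^2 + (starRingEnd ℂ) Z * Z) / ((r:ℂ)^2 - (starRingEnd ℂ) Z * Z))) = Z * (C Z : ℂ) := by
            push_cast; ring
          rw [e4] at e3
          refine e3.congr' ?_
          filter_upwards [self_mem_nhdsWithin] with y hy
          have : y - Z ≠ 0 := sub_ne_zero.mpr hy
          unfold hZ
          rw [mul_left_comm]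
          congr 1
          rw [mul_sub, mul_div_cancel₀ _ this]
      · have e3 := (hZd Z hZB Y hY (Ne.symm hZY)).continuousAt
        have e4 : ContinuousAt (fun y => (y - Y) * (((C Z / 2 : ℝ) : ℂ) * hZ r Z y)) Y :=
          (continuousAt_id.sub continuousAt_const).mul e3
        have := e4.tendsto.mono_left (nhdsWithin_le_nhds (s := {Y}ᶜ))
        simpa using this
    have e3 := e1.sub e2
    rw [Finset.sum_ite_eq', if_pos (by simpa using hYB), sub_self] at e3
    refine e3.congr fun y => ?_
    simp only [S]
    rw [mul_sub, Finset.mul_sum]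
  obtain ⟨S', hS'd, hS'e⟩ := removable_finite isOpen_ball hB hSd hSl
  -- value at zero
  have hC0 : C 0 = 0 := by
    by_contra h
    exact (hCz 0 h).2.1 rfl
  have hT0 : Tendsto T (𝓝[≠] 0) (𝓝 0) := by
    have := hlimT' 0 (by simpa using hR0)
    rw [hC0] at this
    simpa using this
  have hz0 : (0:ℂ) ∈ ball (0:ℂ) R1 := by simp; linarith
  have hS0 : S' 0 = ((∑ Z ∈ hB.toFinset, C Z : ℝ) : ℂ) := by
    have hcor : Tendsto (fun Y => ∑ Z ∈ hB.toFinset, ((C Z / 2 : ℝ) : ℂ) * hZ r Z Y) (𝓝[≠] 0)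
        (𝓝 (∑ Z ∈ hB.toFinset, -(C Z : ℂ))) := by
      apply tendsto_finsetSum
      intro Z hZB
      by_cases hC : C Z = 0
      · simp [hC]
      · have hZ0 := (hCz Z hC).2.1
        have e1 := (hZd Z hZB 0 (by simpa using hz0) hZ0.symm).continuousAt.tendsto.mono_left
          (nhdsWithin_le_nhds (s := {(0:ℂ)}ᶜ))
        convert e1 using 2
        have hrc : (r:ℂ) ≠ 0 := by exact_mod_cast hr0.ne'
        unfold hZ
        simp only [zero_add, zero_sub, mul_zero, add_zero, sub_zero]
        rw [div_self (pow_ne_zero _ hrc), div_neg, div_self hZ0]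
        push_cast; ring
    have hSt := hT0.sub hcor
    have hS't : Tendsto S' (𝓝[≠] 0) (𝓝 (S' 0)) :=
      ((hS'd.differentiableAt (isOpen_ball.mem_nhds hz0)).continuousAt.tendsto).mono_left nhdsWithin_le_nhds
    have hee : ∀ᶠ Y in 𝓝[≠] (0:ℂ), S Y = S' Y := by
      have h1 : (B \ {0})ᶜ ∈ 𝓝 (0:ℂ) := (hB.sdiff).isClosed.isOpen_compl.mem_nhds (by simp)
      filter_upwards [mem_nhdsWithin_of_mem_nhds h1, mem_nhdsWithin_of_mem_nhds (isOpen_ball.mem_nhds hz0),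
        self_mem_nhdsWithin] with Y a b c
      exact (hS'e Y b (fun h => a ⟨h, c⟩)).symm
    have := tendsto_nhds_unique (hSt.congr' (f₂ := S') hee) hS't
    rw [← this]
    simp
  have hmax : ∀ z ∈ frontier (ball (0:ℂ) r), ‖Complex.exp (-S' z)‖ ≤ Real.exp (-(1/2)) := by
    intro z hz
    rw [frontier_ball _ hr0.ne', mem_sphere_zero_iff_norm] at hz
    have hzB : z ∉ B := fun h => hrB ⟨z, h, hz⟩
    rw [Complex.norm_exp, Complex.neg_re, hS'e z (by rw [mem_ball_zero_iff, hz]; exact hR1r) hzB]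
    apply Real.exp_le_exp.mpr
    rw [neg_le_neg_iff]
    simp only [S]
    rw [Complex.sub_re, Complex.re_sum]
    have e1 : ∀ Z ∈ hB.toFinset, (((C Z / 2 : ℝ) : ℂ) * hZ r Z z).re = 0 := by
      intro Z hZB
      rw [Complex.re_ofReal_mul]
      by_cases hC : C Z = 0
      · simp [hC]
      · rw [hZ_re hr0 hz ((hCz Z hC).1.trans_lt hr1), mul_zero]
    rw [Finset.sum_eq_zero e1, sub_zero]
    simp only [T]
    rw [Finset.mul_sum, Complex.re_sum]
    have e2 : ∀ x ∈ hg.fib z, 1/2 ≤ (z * τ x).re := by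
      intro x hx
      rw [hg.mem_fib] at hx
      have := re_half (Y := z) (h := h x) (by rw [hz]; exact (hρ x hx.1).trans_lt hr1)
      simp only [τ]
      rw [hx.2, ← div_eq_mul_inv]
      exact this
    obtain ⟨x0, hx0⟩ := hg.fib_nonempty hne (Y := z) (by rw [hz]; exact hr2)
    calc (1/2 : ℝ) ≤ (z * τ x0).re := e2 x0 hx0
      _ ≤ _ := Finset.single_le_sum (f := fun x => (z * τ x).re)
        (fun x hx => by have := e2 x hx; linarith) hx0
  have hcl : closure (ball (0:ℂ) r) ⊆ ball 0 R1 := by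
    rw [closure_ball _ hr0.ne']
    exact closedBall_subset_ball hR1r
  have hdc : DiffContOnCl ℂ (fun z => Complex.exp (-S' z)) (ball (0:ℂ) r) := by
    apply DifferentiableOn.diffContOnCl
    exact (hS'd.mono hcl).neg.cexp
  have := Complex.norm_le_of_forall_mem_frontier_norm_le isBounded_ball hdc hmax (z := 0)
    (subset_closure (by simpa using hr0))
  rw [hS0, Complex.norm_exp, Complex.neg_re, Complex.ofReal_re, Real.exp_le_exp] at this
  have h3 : ∑ Z ∈ hB.toFinset, C Z ≤ 0 := Finset.sum_nonpos fun Z _ => hCle Z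
  linarith

end NW
end

section
open Complex Set Filter Topology Metric

namespace NW

structure NS (s t : Polynomial ℂ) (m : ℕ) : Prop where
  monic : s.Monic
  deg : s.natDegree = t.natDegree + 1
  lead : t.leadingCoeff = m
  two : 2 ≤ m
  root : ∀ ζ, s.eval ζ = 0 → ∃ k : ℕ, 1 ≤ k ∧ t.eval ζ = k * s.derivative.eval ζ ∧ s.derivative.eval ζ ≠ 0

noncomputable def NN (s t : Polynomial ℂ) (z : ℂ) : ℂ := z - s.eval z / t.eval z

lemma isClosed_connectedComponentIn' {F : Set ℂ} (hF : IsClosed F) (x : ℂ) :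
    IsClosed (connectedComponentIn F x) := by
  by_cases hx : x ∈ F
  · apply isClosed_of_closure_subset
    apply isPreconnected_connectedComponentIn.closure.subset_connectedComponentIn
    · exact subset_closure (mem_connectedComponentIn hx)
    · exact closure_minimal (connectedComponentIn_subset F x) hF
  · rw [connectedComponentIn_eq_empty hx]; exact isClosed_empty

lemma ne_cobounded (a : ℂ) : ∀ᶠ z in Bornology.cobounded ℂ, z ≠ a :=
  Bornology.IsBounded.compl (Bornology.isBounded_singleton (x := a))

lemma poly_div_pow_tendsto (a : Polynomial ℂ) :
    Tendsto (fun z : ℂ => a.eval z / z ^ a.natDegree) (Bornology.cobounded ℂ) (𝓝 a.leadingCoeff) := by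
  have h1 : Tendsto (fun z : ℂ => a.reverse.eval (z⁻¹)) (Bornology.cobounded ℂ) (𝓝 a.leadingCoeff) := by
    have h2 : a.leadingCoeff = a.reverse.eval 0 := by
      rw [← Polynomial.coeff_zero_eq_eval_zero, Polynomial.coeff_zero_reverse]
    rw [h2]
    exact (a.reverse.continuous.tendsto 0).comp tendsto_inv₀_cobounded
  refine h1.congr' ?_
  filter_upwards [ne_cobounded (0:ℂ)] with z hz
  haveI := invertibleOfNonzero hz
  have := Polynomial.eval₂_reverse_mul_pow (RingHom.id ℂ) z a
  rw [invOf_eq_inv] at this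
  rw [eq_div_iff (pow_ne_zero _ hz)]
  exact this

lemma poly_ne_cobounded {a : Polynomial ℂ} (ha : a ≠ 0) : ∀ᶠ z in Bornology.cobounded ℂ, a.eval z ≠ 0 := by
  have := (poly_div_pow_tendsto a).eventually_ne (Polynomial.leadingCoeff_ne_zero.mpr ha)
  filter_upwards [this] with z hz h
  rw [h, zero_div] at hz
  exact hz rfl

variable {s t : Polynomial ℂ} {m : ℕ}

lemma NS.m0 (h : NS s t m) : (m:ℂ) ≠ 0 := by
  have := h.two
  exact_mod_cast (by omega : m ≠ 0)

lemma NS.t0 (h : NS s t m) : t ≠ 0 := by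
  rw [← Polynomial.leadingCoeff_ne_zero, h.lead]; exact h.m0

lemma NS.cop (h : NS s t m) {z : ℂ} (hs : s.eval z = 0) : t.eval z ≠ 0 := by
  obtain ⟨k, hk, h1, h2⟩ := h.root z hs
  rw [h1]
  exact mul_ne_zero (by exact_mod_cast (by omega : k ≠ 0)) h2

lemma NS.ratio (h : NS s t m) (ξ : ℂ) : Tendsto (fun z : ℂ => m * (s.eval z / ((z - ξ) * t.eval z)))
    (Bornology.cobounded ℂ) (𝓝 1) := by
  have h1 := poly_div_pow_tendsto s
  have h2 := poly_div_pow_tendsto t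
  have h3 : Tendsto (fun z : ℂ => (Polynomial.X - Polynomial.C ξ).eval z / z ^ (Polynomial.X - Polynomial.C ξ : Polynomial ℂ).natDegree)
    (Bornology.cobounded ℂ) (𝓝 1) := by
    convert poly_div_pow_tendsto (Polynomial.X - Polynomial.C ξ) using 2
    exact (Polynomial.leadingCoeff_X_sub_C ξ).symm
  have h4 := (h1.div (h3.mul h2) (by rw [h.lead]; simpa using h.m0)).const_mul (m:ℂ)
  rw [h.monic.leadingCoeff, h.lead] at h4
  have h5 : (m:ℂ) * (1 / (1 * m)) = 1 := by field_simp [h.m0]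
  rw [h5] at h4
  refine h4.congr' ?_
  filter_upwards [ne_cobounded (0:ℂ)] with z hz
  simp only [Pi.mul_apply, Pi.div_apply, Polynomial.eval_sub, Polynomial.eval_X, Polynomial.eval_C, Polynomial.natDegree_X_sub_C, h.deg]
  rw [pow_one, pow_succ]
  have := pow_ne_zero t.natDegree hz
  field_simp

lemma NS.tendsto (h : NS s t m) : Tendsto (NN s t) (Bornology.cobounded ℂ) (Bornology.cobounded ℂ) := by
  have h1 : Tendsto (fun z : ℂ => ‖1 - (m:ℂ)⁻¹ * (m * (s.eval z / ((z - 0) * t.eval z)))‖) (Bornology.cobounded ℂ)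
      (𝓝 ‖1 - (m:ℂ)⁻¹ * 1‖) := ((h.ratio 0).const_mul _).const_sub _ |>.norm
  have h2 : 0 < ‖1 - (m:ℂ)⁻¹ * 1‖ := by
    rw [norm_pos_iff, mul_one, sub_ne_zero]
    intro h3
    have := h.two
    rw [eq_comm, inv_eq_one] at h3
    have : m = 1 := by exact_mod_cast h3
    omega
  rw [← tendsto_norm_atTop_iff_cobounded]
  have h3 := (tendsto_norm_cobounded_atTop (E := ℂ)).atTop_mul_pos h2 h1
  refine h3.congr' ?_
  filter_upwards [ne_cobounded (0:ℂ)] with z hz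
  rw [← norm_mul, NN, sub_zero]
  congr 1
  have := h.m0
  by_cases ht : t.eval z = 0
  · rw [ht]; simp
  · field_simp

lemma NN_diff {z : ℂ} (ht : t.eval z ≠ 0) : DifferentiableAt ℂ (NN s t) z :=
  differentiableAt_id.sub (s.differentiableAt.div t.differentiableAt ht)

lemma NN_root {z : ℂ} (hs : s.eval z = 0) : NN s t z = z := by simp [NN, hs]

lemma NS.contr (h : NS s t m) {ξ : ℂ} (hξ : s.eval ξ = 0) :
    ∃ c : ℝ, 0 ≤ c ∧ c < 1 ∧ ∀ᶠ z in 𝓝 ξ, ‖NN s t z - ξ‖ ≤ c * ‖z - ξ‖ := by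
  obtain ⟨k, hk, h1, h2⟩ := h.root ξ hξ
  have ht := h.cop hξ
  have hk0 : (k:ℂ) ≠ 0 := by exact_mod_cast (by omega : k ≠ 0)
  have hd : HasDerivAt (NN s t) (1 - 1 / (k:ℂ)) ξ := by
    have := (hasDerivAt_id ξ).sub ((s.hasDerivAt ξ).div (t.hasDerivAt ξ) ht)
    refine this.congr_deriv ?_
    rw [hξ, h1]
    field_simp
    ring
  have hμ : ‖(1 - 1/(k:ℂ))‖ < 1 := by
    have hk' : (1:ℝ) ≤ k := by exact_mod_cast hk
    have : (1 - 1/(k:ℂ)) = ((1 - 1/(k:ℝ) : ℝ) : ℂ) := by push_cast; rfl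
    rw [this, norm_real, Real.norm_eq_abs, abs_of_nonneg]
    · have : 0 < 1/(k:ℝ) := by positivity
      linarith
    · rw [sub_nonneg, div_le_one (by linarith)]; exact hk'
  set μ := ‖(1 - 1/(k:ℂ))‖
  have hμ0 : 0 ≤ μ := norm_nonneg _
  refine ⟨(1 + μ)/2, by linarith, by linarith, ?_⟩
  have h3 := (hasDerivAt_iff_isLittleO.mp hd).def (show 0 < (1 - μ)/2 by linarith)
  filter_upwards [h3] with z hz
  rw [NN_root hξ, smul_eq_mul] at hz
  calc ‖NN s t z - ξ‖ = ‖(NN s t z - ξ - (z - ξ) * (1 - 1/(k:ℂ))) + (z - ξ) * (1 - 1/(k:ℂ))‖ := by congr 1; ring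
    _ ≤ _ := norm_add_le _ _
    _ ≤ (1-μ)/2 * ‖z - ξ‖ + ‖z-ξ‖ * μ := by rw [norm_mul]; gcongr
    _ = _ := by ring

lemma NS.preimage_compact (h : NS s t m) {C : Set ℂ} (hC : IsCompact C) (hp : ∀ z ∈ C, t.eval z ≠ 0) :
    IsCompact {z | NN s t z ∈ C} ∧ ∀ z, NN s t z ∈ C → t.eval z ≠ 0 := by
  have h2 : ∀ z, NN s t z ∈ C → t.eval z ≠ 0 := by
    intro z hz ht
    have : NN s t z = z := by simp [NN, ht]
    rw [this] at hz
    exact hp z hz ht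
  refine ⟨?_, h2⟩
  have hb : Bornology.IsBounded {z | NN s t z ∈ C} := by
    have h3 : ∀ᶠ z in Bornology.cobounded ℂ, NN s t z ∈ Cᶜ :=
      h.tendsto.eventually (Bornology.IsBounded.compl hC.isBounded)
    exact Bornology.isBounded_def.mpr h3
  obtain ⟨R, hR⟩ := hb.subset_closedBall 0
  have : {z | NN s t z ∈ C} = Prod.fst '' ({x : ℂ × ℂ | (x.1 - x.2) * t.eval x.1 = s.eval x.1} ∩ (closedBall 0 R ×ˢ C)) := by
    ext z
    simp only [mem_ofPred_eq, mem_image, mem_inter_iff, mem_prod, Prod.exists, exists_and_right, exists_eq_right]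
    constructor
    · intro hz
      refine ⟨_, ?_, hR hz, hz⟩
      have := h2 z hz
      rw [NN]; field_simp; ring
    · rintro ⟨c, h3, -, hc⟩
      have ht : t.eval z ≠ 0 := by
        intro ht
        rw [ht, mul_zero] at h3
        exact h.cop h3.symm ht
      have : NN s t z = c := by rw [NN, ← h3]; field_simp; ring
      rwa [this]
  rw [this]
  refine IsCompact.image ?_ continuous_fst
  refine ((isCompact_closedBall 0 R).prod hC).inter_left (isClosed_eq ?_ ?_)
  · exact (continuous_fst.sub continuous_snd).mul (t.continuous.comp continuous_fst)
  · exact s.continuous.comp continuous_fst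

end NW
end

section
open Complex Set Filter Topology Metric

namespace NW
variable {s t : Polynomial ℂ} {m : ℕ} {ξ : ℂ} {ε c : ℝ}

structure Good (s t : Polynomial ℂ) (m : ℕ) (ξ : ℂ) (ε c : ℝ) : Prop where
  ns : NS s t m
  hξ : s.eval ξ = 0
  ε0 : 0 < ε
  c0 : 0 ≤ c
  c1 : c < 1
  nt : ∀ z ∈ closedBall ξ ε, t.eval z ≠ 0
  con : ∀ z ∈ closedBall ξ ε, ‖NN s t z - ξ‖ ≤ c * ‖z - ξ‖

lemma NS.good (h : NS s t m) (hξ : s.eval ξ = 0) : ∃ ε c, Good s t m ξ ε c := by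
  obtain ⟨c, h0, h1, h2⟩ := h.contr hξ
  have h3 : ∀ᶠ z in 𝓝 ξ, t.eval z ≠ 0 := t.continuous.continuousAt.eventually_ne (h.cop hξ)
  obtain ⟨ε, hε, h4⟩ := Metric.nhds_basis_closedBall.mem_iff.mp (h2.and h3)
  exact ⟨ε, c, h, hξ, hε, h0, h1, fun z hz => (h4 hz).2, fun z hz => (h4 hz).1⟩

def GG (s t : Polynomial ℂ) (ξ : ℂ) (ε : ℝ) (n : ℕ) : Set ℂ := {z | (NN s t)^[n] z ∈ closedBall ξ ε}
def KK (s t : Polynomial ℂ) (ξ : ℂ) (ε : ℝ) (n : ℕ) : Set ℂ := connectedComponentIn (GG s t ξ ε n) ξ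

lemma Good.ball (h : Good s t m ξ ε c) {z : ℂ} (hz : z ∈ closedBall ξ ε) : NN s t z ∈ Metric.ball ξ ε := by
  have h1 := h.con z hz
  rw [mem_closedBall, dist_eq_norm] at hz
  rw [mem_ball, dist_eq_norm]
  have := h.c1; have := h.c0; have := h.ε0
  have h5 : c * ‖z - ξ‖ ≤ c * ε := by gcongr
  nlinarith

lemma GG_succ (n : ℕ) : GG s t ξ ε (n+1) = {z | NN s t z ∈ GG s t ξ ε n} := by
  ext z; simp [GG, Function.iterate_succ_apply]

lemma Good.G (h : Good s t m ξ ε c) (n : ℕ) : IsCompact (GG s t ξ ε n) ∧ ∀ z ∈ GG s t ξ ε n, t.eval z ≠ 0 := by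
  induction n with
  | zero => exact ⟨isCompact_closedBall _ _, h.nt⟩
  | succ n ih =>
    rw [GG_succ]
    exact h.ns.preimage_compact ih.1 ih.2

lemma NN_iter_root (hξ : s.eval ξ = 0) (n : ℕ) : (NN s t)^[n] ξ = ξ :=
  Function.iterate_fixed (NN_root hξ) n

lemma Good.ξG (h : Good s t m ξ ε c) (n : ℕ) : ξ ∈ GG s t ξ ε n := by
  simp only [GG, mem_ofPred_eq, NN_iter_root h.hξ]
  exact mem_closedBall_self h.ε0.le

lemma Good.ξK (h : Good s t m ξ ε c) (n : ℕ) : ξ ∈ KK s t ξ ε n := mem_connectedComponentIn (h.ξG n)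

lemma Good.Kcompact (h : Good s t m ξ ε c) (n : ℕ) : IsCompact (KK s t ξ ε n) :=
  (h.G n).1.of_isClosed_subset (isClosed_connectedComponentIn' (h.G n).1.isClosed _)
    (connectedComponentIn_subset _ _)

lemma KK_pre (n : ℕ) : IsPreconnected (KK s t ξ ε n) := isPreconnected_connectedComponentIn
lemma KK_sub (n : ℕ) : KK s t ξ ε n ⊆ GG s t ξ ε n := connectedComponentIn_subset _ _

lemma Good.K0 (h : Good s t m ξ ε c) : KK s t ξ ε 0 = closedBall ξ ε := by
  apply subset_antisymm
  · exact KK_sub 0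
  · exact (convex_closedBall ξ ε).isPreconnected.subset_connectedComponentIn (mem_closedBall_self h.ε0.le) subset_rfl

lemma Good.Knt (h : Good s t m ξ ε c) {n : ℕ} {z : ℂ} (hz : z ∈ KK s t ξ ε n) : t.eval z ≠ 0 :=
  (h.G n).2 z (KK_sub n hz)

lemma Good.map (h : Good s t m ξ ε c) {n : ℕ} {z : ℂ} (hz : z ∈ KK s t ξ ε (n+1)) : NN s t z ∈ KK s t ξ ε n := by
  have h1 : IsPreconnected (NN s t '' KK s t ξ ε (n+1)) := (KK_pre (n+1)).image _
    (fun x hx => (NN_diff (h.Knt hx)).continuousAt.continuousWithinAt)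
  refine h1.subset_connectedComponentIn ⟨ξ, h.ξK _, NN_root h.hξ⟩ ?_ ⟨z, hz, rfl⟩
  rintro _ ⟨x, hx, rfl⟩
  have := KK_sub _ hx
  rwa [GG_succ] at this

lemma Good.iter_cont (h : Good s t m ξ ε c) (n : ℕ) : ∀ z ∈ GG s t ξ ε n, ContinuousAt ((NN s t)^[n]) z := by
  induction n with
  | zero => intro z _; exact continuousAt_id
  | succ n ih =>
    intro z hz
    have h1 := (h.G _).2 z hz
    rw [GG_succ] at hz
    rw [Function.iterate_succ]
    exact ContinuousAt.comp (ih _ hz) (NN_diff h1).continuousAt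

lemma Good.G_int (h : Good s t m ξ ε c) (n : ℕ) : GG s t ξ ε n ⊆ interior (GG s t ξ ε (n+1)) := by
  intro z hz
  rw [mem_interior_iff_mem_nhds]
  have h1 := h.iter_cont n z hz
  have h2 : ContinuousAt (NN s t) ((NN s t)^[n] z) := (NN_diff (h.nt _ hz)).continuousAt
  have h3 : ContinuousAt (fun z => NN s t ((NN s t)^[n] z)) z := ContinuousAt.comp h2 h1
  have h4 := h3.eventually (isOpen_ball.mem_nhds (h.ball hz))
  filter_upwards [h4] with x hx
  simp only [GG, mem_ofPred_eq, Function.iterate_succ_apply']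
  exact ball_subset_closedBall hx

lemma Good.G_mono (h : Good s t m ξ ε c) : Monotone (GG s t ξ ε) :=
  monotone_nat_of_le_succ fun n => (h.G_int n).trans interior_subset

lemma Good.K_mono (h : Good s t m ξ ε c) : Monotone (KK s t ξ ε) := fun _ _ hab =>
  connectedComponentIn_mono ξ (h.G_mono hab)

lemma K_absorb {n : ℕ} {A : Set ℂ} (hA : IsPreconnected A) (hG : A ⊆ GG s t ξ ε n)
    (hne : (A ∩ KK s t ξ ε n).Nonempty) : A ⊆ KK s t ξ ε n := by
  obtain ⟨x, hx, hx'⟩ := hne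
  rw [KK, connectedComponentIn_eq hx']
  exact hA.subset_connectedComponentIn hx hG

lemma Good.near (h : Good s t m ξ ε c) {n : ℕ} {z : ℂ} (hz : z ∈ GG s t ξ ε n) :
    ∃ δ > 0, Metric.ball z δ ⊆ GG s t ξ ε (n+1) := by
  have := h.G_int n hz
  exact Metric.isOpen_iff.mp isOpen_interior z this |>.imp fun δ hδ => ⟨hδ.1, hδ.2.trans interior_subset⟩

lemma Good.K_int (h : Good s t m ξ ε c) (n : ℕ) : KK s t ξ ε n ⊆ interior (KK s t ξ ε (n+1)) := by
  intro z hz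
  obtain ⟨δ, hδ, hb⟩ := h.near (KK_sub n hz)
  rw [mem_interior_iff_mem_nhds]
  exact mem_of_superset (ball_mem_nhds z hδ) (K_absorb (convex_ball z δ).isPreconnected hb
    ⟨z, mem_ball_self hδ, h.K_mono n.le_succ hz⟩)

def basinU (s t : Polynomial ℂ) (ξ : ℂ) : Set ℂ :=
  connectedComponentIn {z | Tendsto (fun n => (NN s t)^[n] z) atTop (𝓝 ξ)} ξ

lemma Good.basin (h : Good s t m ξ ε c) : {z | Tendsto (fun n => (NN s t)^[n] z) atTop (𝓝 ξ)} = ⋃ n, GG s t ξ ε n := by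
  ext z
  simp only [mem_ofPred_eq, mem_iUnion]
  constructor
  · intro hz
    obtain ⟨n, hn⟩ := (hz.eventually (closedBall_mem_nhds ξ h.ε0)).exists
    exact ⟨n, hn⟩
  · rintro ⟨n, hn⟩
    rw [← tendsto_add_atTop_iff_nat n]
    have h1 : ∀ k, (NN s t)^[k + n] z ∈ closedBall ξ ε ∧ ‖(NN s t)^[k + n] z - ξ‖ ≤ c^k * ε := by
      intro k
      induction k with
      | zero =>
        rw [zero_add]
        refine ⟨hn, ?_⟩
        rw [pow_zero, one_mul, ← dist_eq_norm]; exact hn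
      | succ k ih =>
        rw [show k + 1 + n = (k + n) + 1 by ring, Function.iterate_succ_apply']
        refine ⟨ball_subset_closedBall (h.ball ih.1), (h.con _ ih.1).trans ?_⟩
        rw [pow_succ', mul_assoc]
        exact mul_le_mul_of_nonneg_left ih.2 h.c0
    rw [tendsto_iff_norm_sub_tendsto_zero]
    refine squeeze_zero (fun _ => norm_nonneg _) (fun k => (h1 k).2) ?_
    simpa using (tendsto_pow_atTop_nhds_zero_of_lt_one h.c0 h.c1).mul_const ε

lemma Good.U_eq (h : Good s t m ξ ε c) : basinU s t ξ = ⋃ n, KK s t ξ ε n := by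
  have hξB : ξ ∈ {z | Tendsto (fun n => (NN s t)^[n] z) atTop (𝓝 ξ)} := by
    rw [h.basin]; exact mem_iUnion.mpr ⟨0, h.ξG 0⟩
  apply subset_antisymm
  · apply IsPreconnected.subset_of_closure_inter_subset
    · exact isPreconnected_connectedComponentIn
    · rw [isOpen_iff_mem_nhds]
      intro z hz
      obtain ⟨n, hn⟩ := mem_iUnion.mp hz
      exact mem_of_superset (mem_interior_iff_mem_nhds.mp (h.K_int n hn)) (subset_iUnion _ _)
    · exact ⟨ξ, mem_connectedComponentIn hξB, mem_iUnion.mpr ⟨0, h.ξK 0⟩⟩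
    · rintro z ⟨hz, hzU⟩
      have hzB := connectedComponentIn_subset _ _ hzU
      rw [h.basin] at hzB
      obtain ⟨n, hn⟩ := mem_iUnion.mp hzB
      obtain ⟨δ, hδ, hb⟩ := h.near hn
      obtain ⟨y, hy, hyK⟩ := mem_closure_iff_nhds.mp hz _ (ball_mem_nhds z hδ)
      obtain ⟨j, hj⟩ := mem_iUnion.mp hyK
      refine mem_iUnion.mpr ⟨max j (n+1), ?_⟩
      exact K_absorb (convex_ball z δ).isPreconnected (hb.trans (h.G_mono (le_max_right _ _)))
        ⟨y, hy, h.K_mono (le_max_left _ _) hj⟩ (mem_ball_self hδ)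
  · apply IsPreconnected.subset_connectedComponentIn
    · exact isPreconnected_iUnion ⟨ξ, mem_iInter.mpr h.ξK⟩ KK_pre
    · exact mem_iUnion.mpr ⟨0, h.ξK 0⟩
    · rw [h.basin]
      exact iUnion_mono KK_sub

end NW
end

section
open Complex Set Filter Topology Metric

namespace NW
variable {s t : Polynomial ℂ} {m : ℕ} {ξ : ℂ} {ε c : ℝ}

lemma compl_ball_pre (ξ : ℂ) {R : ℝ} (hR : 0 ≤ R) : IsPreconnected (closedBall ξ R)ᶜ := by
  have h1 := (isPreconnected_outside hR).image (fun z => z + ξ) (by fun_prop)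
  convert h1 using 1
  ext z
  simp only [mem_compl_iff, mem_closedBall, dist_eq_norm, not_le, mem_image, mem_ofPred_eq]
  constructor
  · intro h; exact ⟨z - ξ, h, by ring⟩
  · rintro ⟨w, hw, rfl⟩; simpa using hw

lemma full_of_no_bdd {K : Set ℂ} (hK : IsCompact K)
    (h : ∀ a ∉ K, ¬ Bornology.IsBounded (connectedComponentIn Kᶜ a)) : IsPreconnected Kᶜ := by
  obtain ⟨R, hR⟩ := hK.isBounded.subset_closedBall 0
  have hc := compl_ball_pre 0 (le_max_right R 0)
  have hsub : (closedBall (0:ℂ) (max R 0))ᶜ ⊆ Kᶜ :=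
    compl_subset_compl.mpr (hR.trans (closedBall_subset_closedBall (le_max_left _ _)))
  have hmeet : ∀ a ∉ K, ∀ b ∈ (closedBall (0:ℂ) (max R 0))ᶜ, b ∈ connectedComponentIn Kᶜ a := by
    intro a ha b hb
    by_contra hcon
    apply h a ha
    refine (isBounded_closedBall (x := (0:ℂ)) (r := max R 0)).subset ?_
    intro z hz
    by_contra hz'
    apply hcon
    have := connectedComponentIn_eq hz
    rw [this]
    exact hc.subset_connectedComponentIn hz' hsub hb
  apply isPreconnected_of_forall_pair
  intro x hx y hy
  have hb : ((max R 0 + 1 : ℝ) : ℂ) ∈ (closedBall (0:ℂ) (max R 0))ᶜ := by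
    simp only [mem_compl_iff, mem_closedBall, dist_zero_right, norm_real, Real.norm_eq_abs, not_le]
    rw [abs_of_nonneg (by positivity)]
    linarith
  refine ⟨connectedComponentIn Kᶜ x, connectedComponentIn_subset _ _, mem_connectedComponentIn hx, ?_,
    isPreconnected_connectedComponentIn⟩
  rw [connectedComponentIn_eq (hmeet x hx _ hb), ← connectedComponentIn_eq (hmeet y hy _ hb)]
  exact mem_connectedComponentIn hy

lemma punct_pre {K : Set ℂ} (hK : IsPreconnected K) (hε : 0 < ε) (hb : ball ξ ε ⊆ K) :
    IsPreconnected (K \ {ξ}) := by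
  classical
  apply isPreconnected_of_forall_constant
  intro f hf
  have hpp := isPreconnected_punctured ξ hε
  have hsub : ball ξ ε \ {ξ} ⊆ K \ {ξ} := sdiff_subset_sdiff_left hb
  have hp : ξ + (ε/2 : ℝ) ∈ ball ξ ε \ {ξ} := by
    constructor
    · simp only [mem_ball, dist_eq_norm, add_sub_cancel_left, norm_real, Real.norm_eq_abs]
      rw [abs_of_pos (by linarith)]; linarith
    · simp only [mem_singleton_iff, add_eq_left, ofReal_eq_zero]
      linarith
  set p := ξ + (ε/2 : ℝ)
  have hconst : ∀ x ∈ ball ξ ε \ {ξ}, f x = f p := fun x hx =>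
    hpp.constant (hf.mono hsub) hx hp
  let f' : ℂ → Bool := Function.update f ξ (f p)
  have hf' : ContinuousOn f' K := by
    intro x hx
    by_cases hxξ : x = ξ
    · subst hxξ
      have : f' =ᶠ[𝓝 x] fun _ => f p := by
        filter_upwards [ball_mem_nhds x hε] with y hy
        by_cases hyx : y = x
        · subst hyx; simp [f']
        · simp only [f', Function.update_of_ne hyx]
          exact hconst y ⟨hy, hyx⟩
      exact (continuousAt_const.congr this.symm).continuousWithinAt
    · have h1 : ContinuousWithinAt f K x := by
        have := hf x ⟨hx, hxξ⟩
        refine this.mono_of_mem_nhdsWithin ?_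
        refine mem_nhdsWithin.mpr ⟨{ξ}ᶜ, isOpen_compl_singleton, hxξ, ?_⟩
        rintro y ⟨hy1, hy2⟩; exact ⟨hy2, hy1⟩
      refine h1.congr_of_eventuallyEq ?_ (by simp [f', Function.update_of_ne hxξ])
      filter_upwards [mem_nhdsWithin_of_mem_nhds (isOpen_compl_singleton.mem_nhds hxξ)] with y hy
      simp only [f']
      exact Function.update_of_ne hy _ _
  intro x hx y hy
  have := hK.constant hf' hx.1 hy.1
  simpa [f', Function.update_of_ne (show x ≠ ξ from hx.2), Function.update_of_ne (show y ≠ ξ from hy.2)] using this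

lemma closure_comp {F : Set ℂ} (hF : IsOpen F) (a : ℂ) {z : ℂ}
    (hz : z ∈ closure (connectedComponentIn F a)) (hzF : z ∈ F) : z ∈ connectedComponentIn F a := by
  obtain ⟨y, hy, hy'⟩ := mem_closure_iff.mp hz _ (hF.connectedComponentIn (x := z)) (mem_connectedComponentIn hzF)
  rw [connectedComponentIn_eq hy', ← connectedComponentIn_eq hy]
  exact mem_connectedComponentIn hzF

/-- inverted complement -/
def inv_compl (K : Set ℂ) (ξ : ℂ) : Set ℂ := {w | w = 0 ∨ ξ + w⁻¹ ∉ K}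

lemma inv_compl_open {K : Set ℂ} (hK : IsCompact K) : IsOpen (inv_compl K ξ) := by
  rw [isOpen_iff_mem_nhds]
  rintro w hw
  by_cases h0 : w = 0
  · subst h0
    obtain ⟨R, hR0, hR⟩ := hK.isBounded.subset_closedBall_lt 0 ξ
    refine mem_of_superset (ball_mem_nhds 0 (inv_pos.mpr hR0)) ?_
    intro w hw
    by_cases hw0 : w = 0
    · exact Or.inl hw0
    right
    intro hk
    have := hR hk
    rw [mem_closedBall, dist_eq_norm, add_sub_cancel_left, norm_inv] at this
    rw [mem_ball_zero_iff] at hw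
    have h3 := norm_pos_iff.mpr hw0
    rw [inv_le_comm₀ h3 hR0] at this
    linarith
  · have h1 : ContinuousAt (fun w : ℂ => ξ + w⁻¹) w := continuousAt_const.add (continuousAt_inv₀ h0)
    have h2 := h1.eventually (hK.isClosed.isOpen_compl.mem_nhds (hw.resolve_left h0))
    filter_upwards [h2] with x hx
    exact Or.inr hx

lemma mem_inv_compl {K : Set ℂ} {z : ℂ} (hz : z ∉ K) : (z - ξ)⁻¹ ∈ inv_compl K ξ := by
  right; simpa using hz

lemma inv_compl_eq {K : Set ℂ} : inv_compl K ξ = insert 0 ((fun z => (z - ξ)⁻¹) '' Kᶜ) := by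
  ext w
  constructor
  · rintro (h | h)
    · exact Or.inl h
    · exact Or.inr ⟨_, h, by simp⟩
  · rintro (h | ⟨z, hz, rfl⟩)
    · exact Or.inl h
    · exact mem_inv_compl hz

lemma inv_compl_pre {K : Set ℂ} (hK : IsCompact K) (hξ : ξ ∈ K) (hf : IsPreconnected Kᶜ) :
    IsPreconnected (inv_compl K ξ) := by
  rw [inv_compl_eq]
  have hc : ContinuousOn (fun z => (z - ξ)⁻¹) Kᶜ := by
    apply ContinuousOn.inv₀ (by fun_prop)
    intro z hz h
    rw [sub_eq_zero] at h
    exact hz (h ▸ hξ)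
  refine (hf.image _ hc).subset_closure (subset_insert _ _) ?_
  apply insert_subset _ subset_closure
  have h1 : Tendsto (fun z : ℂ => (z - ξ)⁻¹) (Bornology.cobounded ℂ) (𝓝 0) :=
    tendsto_inv₀_cobounded.comp (tendsto_sub_const_cobounded ξ)
  exact mem_closure_of_tendsto h1 (Filter.mem_of_superset hK.isBounded.compl fun z hz => ⟨z, hz, rfl⟩)

lemma inv_compl_bdd {K : Set ℂ} (hε : 0 < ε) (hb : ball ξ ε ⊆ K) : Bornology.IsBounded (inv_compl K ξ) := by
  refine (isBounded_closedBall (x := (0:ℂ)) (r := ε⁻¹)).subset ?_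
  rintro w (rfl | hw)
  · simpa using hε.le
  · by_cases hw0 : w = 0
    · subst hw0; simpa using hε.le
    by_contra hcon
    apply hw
    apply hb
    rw [mem_closedBall_zero_iff, not_le] at hcon
    rw [mem_ball, dist_eq_norm, add_sub_cancel_left, norm_inv]
    rwa [inv_lt_comm₀ (norm_pos_iff.mpr hw0) hε]

lemma inv_compl_noHole {K : Set ℂ} (hK : IsPreconnected K) (hε : 0 < ε) (hb : ball ξ ε ⊆ K) :
    NoHole (inv_compl K ξ) := by
  intro a ha
  have ha0 : a ≠ 0 := fun h => ha (Or.inl h)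
  have ha1 : ξ + a⁻¹ ∈ K := by by_contra h; exact ha (Or.inr h)
  refine ⟨(fun z => (z - ξ)⁻¹) '' (K \ {ξ}), ?_, ?_, ?_, ?_⟩
  · refine (punct_pre hK hε hb).image _ ?_
    apply ContinuousOn.inv₀ (by fun_prop)
    intro z hz h
    exact hz.2 (sub_eq_zero.mp h)
  · intro hbd
    obtain ⟨R, hR0, hR⟩ := hbd.subset_closedBall_lt 0 0
    have hx : ∀ r : ℝ, 0 < r → r < ε → r⁻¹ ≤ R := by
      intro r hr hrε
      have : ((r:ℂ))⁻¹ ∈ closedBall (0:ℂ) R := by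
        apply hR
        refine ⟨ξ + r, ⟨hb ?_, ?_⟩, by simp⟩
        · simpa [abs_of_pos hr] using hrε
        · simpa using hr.ne'
      simpa [abs_of_pos hr] using this
    have h2 := hx (min (ε/2) (R+1)⁻¹) (by positivity) (by
      have := min_le_left (ε/2) (R+1)⁻¹; linarith)
    have h3 : R + 1 ≤ (min (ε/2) (R+1)⁻¹)⁻¹ := by
      rw [le_inv_comm₀ (by positivity) (by positivity)]
      exact min_le_right _ _
    linarith
  · rintro _ ⟨z, hz, rfl⟩ (h | h)
    · exact hz.2 (sub_eq_zero.mp (inv_eq_zero.mp h))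
    · simp at h; exact h hz.1
  · exact ⟨ξ + a⁻¹, ⟨ha1, by simpa using ha0⟩, by simp⟩

lemma compact_preimage {V : Set ℂ} {Φ : ℂ → ℂ} (hV : IsOpen V) (hd : DifferentiableOn ℂ Φ V) (hi : InjOn Φ V)
    (h' : ∀ z ∈ V, deriv Φ z ≠ 0) {r r' : ℝ} (hr : ball 0 r ⊆ Φ '' V) (hr' : r' < r) :
    IsCompact {w | w ∈ V ∧ ‖Φ w‖ ≤ r'} := by
  have hemb : IsOpenEmbedding (V.domRestrict Φ) := by
    apply IsOpenEmbedding.of_continuous_injective_isOpenMap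
    · exact hd.continuousOn.domRestrict
    · exact hi.injective
    · rw [isOpenMap_iff_nhds_le]
      intro x
      have h1 : HasStrictDerivAt Φ (deriv Φ x) x :=
        ((hd.analyticAt (hV.mem_nhds x.2)).contDiffAt (n := 1)).hasStrictDerivAt (by simp)
      have h2 := h1.map_nhds_eq (h' x x.2)
      rw [domRestrict_eq, ← Filter.map_map, map_nhds_subtype_coe_eq_nhds x.2 (hV.mem_nhds x.2), h2]
      exact le_rfl
  have h1 : IsCompact (V.domRestrict Φ ⁻¹' closedBall 0 r') := by
    apply hemb.isInducing.isCompact_preimage' (isCompact_closedBall 0 r')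
    rw [range_domRestrict]
    exact (closedBall_subset_ball hr').trans hr
  convert h1.image continuous_subtype_val using 1
  ext w
  simp [and_comm]

end NW
end

section
open Complex Set Filter Topology Metric

namespace NW
variable {s t : Polynomial ℂ} {m : ℕ} {ξ : ℂ} {ε c : ℝ}

lemma crit_finite {t P : Polynomial ℂ} (hcop : ∀ z, t.eval z = 0 → P.eval z ≠ 0) (ht : t ≠ 0)
    {z0 : ℂ} (hz0 : t.eval z0 = 0) : (t.derivative * P - t * P.derivative) ≠ 0 := by
  intro h
  have hc : IsCoprime t P := by
    rw [Polynomial.isCoprime_iff_aeval_ne_zero_of_isAlgClosed ℂ ℂ]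
    intro a
    by_cases ha : t.eval a = 0
    · right; simpa using hcop a ha
    · left; simpa using ha
  have h1 : t ∣ t.derivative * P := ⟨P.derivative, sub_eq_zero.mp h⟩
  have h2 : t ∣ t.derivative := hc.dvd_of_dvd_mul_right h1
  have h3 : t.derivative = 0 := by
    by_contra h4
    exact (Polynomial.degree_derivative_lt ht).not_ge (Polynomial.degree_le_of_dvd h2 h4)
  have h5 := Polynomial.derivative_eq_zero.mp h3
  rw [Polynomial.eq_C_of_natDegree_eq_zero h5] at hz0 ht
  simp only [Polynomial.eval_C] at hz0
  rw [hz0] at ht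
  simp at ht

lemma pole_step (h : NS s t m) (hξ : s.eval ξ = 0) {E K : Set ℂ} (hEo : IsOpen E) (hEb : Bornology.IsBounded E)
    (hEK : ∀ z ∈ closure E, z ∉ K) (hbd : ∀ z ∈ closure E, z ∉ E → t.eval z ≠ 0 ∧ NN s t z ∈ K)
    (hK : IsCompact K) (hKp : IsPreconnected K) (hε : 0 < ε) (hb : ball ξ ε ⊆ K) (hKf : IsPreconnected Kᶜ)
    {z0 : ℂ} (hz0 : z0 ∈ E) (ht0 : t.eval z0 = 0) : False := by
  have hξK : ξ ∈ K := hb (mem_ball_self hε)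
  have hEc : IsCompact (closure E) := hEb.isCompact_closure
  have hne : ∀ z ∈ closure E, z - ξ ≠ 0 := by
    intro z hz h0
    rw [sub_eq_zero] at h0
    exact hEK z hz (h0 ▸ hξK)
  set V := inv_compl K ξ with hVdef
  have hVo : IsOpen V := inv_compl_open hK
  have hE'c : IsCompact ((fun z => (z - ξ)⁻¹) '' closure E) := by
    apply hEc.image_of_continuousOn
    exact ContinuousOn.inv₀ (by fun_prop) hne
  have hE'V : ((fun z => (z - ξ)⁻¹) '' closure E) ⊆ V := by
    rintro _ ⟨z, hz, rfl⟩
    exact mem_inv_compl (hEK z hz)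
  have h0V : (0:ℂ) ∈ V := Or.inl rfl
  obtain ⟨Φ, ρ, r, hρ0, hρr, hr1, hΦd, hΦi, hΦ0, hΦ', hΦ1, hball, hΦρ⟩ :=
    koebe hVo (inv_compl_pre hK hξK hKf) (inv_compl_bdd hε hb) (inv_compl_noHole hKp hε hb) h0V hE'c hE'V
  let P : Polynomial ℂ := (Polynomial.X - Polynomial.C ξ) * t - s
  have hPe : ∀ z, P.eval z = (z - ξ) * t.eval z - s.eval z := by intro z; simp [P]
  have hcop : ∀ z, t.eval z = 0 → P.eval z ≠ 0 := by
    intro z hz hP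
    rw [hPe, hz, mul_zero, zero_sub, neg_eq_zero] at hP
    exact h.cop hP hz
  let f : ℂ → ℂ := fun z => t.eval z / P.eval z
  have hfd : ∀ z, P.eval z ≠ 0 → HasDerivAt f ((t.derivative.eval z * P.eval z - t.eval z * P.derivative.eval z) / (P.eval z)^2) z :=
    fun z hz => (t.hasDerivAt z).div (P.hasDerivAt z) hz
  let O : Set ℂ := {z | z ∈ E ∧ P.eval z ≠ 0 ∧ f z ∈ V ∧ ‖Φ (f z)‖ < r}
  have hgd : ∀ z ∈ O, HasDerivAt (fun z => Φ (f z)) (deriv Φ (f z) * ((t.derivative.eval z * P.eval z - t.eval z * P.derivative.eval z) / (P.eval z)^2)) z := by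
    rintro z ⟨-, h1, h2, -⟩
    have h3 : HasDerivAt Φ (deriv Φ (f z)) (f z) := (hΦd.differentiableAt (hVo.mem_nhds h2)).hasDerivAt
    exact h3.comp z (hfd z h1)
  have hhd : ∀ z ∈ O, HasDerivAt (fun z => Φ ((z - ξ)⁻¹)) (deriv Φ ((z - ξ)⁻¹) * (-1 / (z - ξ)^2)) z := by
    rintro z ⟨h0, h1, h2, -⟩
    have h0' := subset_closure h0
    have h3 : HasDerivAt Φ (deriv Φ ((z - ξ)⁻¹)) ((z - ξ)⁻¹) :=
      (hΦd.differentiableAt (hVo.mem_nhds (hE'V ⟨z, h0', rfl⟩))).hasDerivAt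
    exact h3.comp z (((hasDerivAt_id z).sub_const ξ).inv (hne z h0'))
  have hOo : IsOpen O := by
    rw [isOpen_iff_mem_nhds]
    rintro z hz
    have hc := (hgd z hz).continuousAt
    obtain ⟨h0, h1, h2, h3⟩ := hz
    filter_upwards [hEo.mem_nhds h0, P.continuous.continuousAt.eventually_ne h1,
      (hfd z h1).continuousAt.eventually (hVo.mem_nhds h2), hc.norm.eventually_lt continuousAt_const h3] with
      y hy1 hy2 hy3 hy4
    exact ⟨hy1, hy2, hy3, hy4⟩
  have hPM : PM O (fun z => Φ (f z)) r := by
    refine ⟨hOo, fun z hz => (hgd z hz).differentiableAt.differentiableWithinAt, fun z hz => hz.2.2.2, ?_, ?_⟩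
    · intro r' hr'
      have hA := compact_preimage hVo hΦd hΦi hΦ' hball hr'
      have : {w | w ∈ O ∧ ‖Φ (f w)‖ ≤ r'} = Prod.fst '' ({x : ℂ × ℂ | t.eval x.1 = x.2 * P.eval x.1} ∩
          (closure E ×ˢ {w | w ∈ V ∧ ‖Φ w‖ ≤ r'})) := by
        ext z
        simp only [mem_ofPred_eq, mem_image, mem_inter_iff, mem_prod, Prod.exists, exists_and_right, exists_eq_right]
        constructor
        · rintro ⟨⟨h0, h1, h2, h3⟩, h4⟩
          exact ⟨f z, (div_mul_cancel₀ _ h1).symm, subset_closure h0, h2, h4⟩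
        · rintro ⟨a, h1, h2, h3, h4⟩
          have hP : P.eval z ≠ 0 := by
            intro hP
            rw [hP, mul_zero] at h1
            exact hcop z h1 hP
          have hfa : f z = a := by rw [div_eq_iff hP]; exact h1
          subst hfa
          refine ⟨⟨?_, hP, h3, h4.trans_lt hr'⟩, h4⟩
          by_contra hzE
          obtain ⟨h5, h6⟩ := hbd z h2 hzE
          have hN : NN s t z - ξ = P.eval z / t.eval z := by
            rw [hPe, NN]; field_simp; ring
          rcases h3 with h3 | h3
          · rcases div_eq_zero_iff.mp h3 with h7 | h7
            · exact h5 h7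
            · exact hP h7
          · apply h3
            have : (f z)⁻¹ = NN s t z - ξ := by rw [hN]; simp [f]
            rw [this]; simpa using h6
      rw [this]
      refine IsCompact.image ?_ continuous_fst
      refine (hEc.prod hA).inter_left (isClosed_eq ?_ ?_)
      · exact t.continuous.comp continuous_fst
      · exact continuous_snd.mul (P.continuous.comp continuous_fst)
    · have hq := crit_finite hcop h.t0 ht0
      refine (Polynomial.finite_setOfPred_isRoot hq).subset ?_
      rintro z ⟨hz, hz'⟩
      rw [(hgd z hz).deriv] at hz'
      have h1 := (mul_eq_zero.mp hz').resolve_left (hΦ' _ hz.2.2.1)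
      have h2 := (div_eq_zero_iff.mp h1).resolve_right (pow_ne_zero _ hz.2.1)
      simpa [Polynomial.IsRoot] using h2
  have hfixs : ∀ z ∈ O, Φ (f z) = Φ ((z - ξ)⁻¹) → s.eval z = 0 := by
    intro z hz he
    have h1 := hΦi hz.2.2.1 (hE'V ⟨z, subset_closure hz.1, rfl⟩) he
    have h2 := hne z (subset_closure hz.1)
    have h3 := hz.2.1
    simp only [f] at h1
    rw [div_eq_iff h3, inv_mul_eq_div, eq_div_iff h2, hPe] at h1
    linear_combination h1
  refine index_lemma (h := fun z => Φ ((z - ξ)⁻¹)) hPM ⟨z0, hz0, hcop z0 ht0, ?_, ?_⟩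
    (fun z hz => (hhd z hz).differentiableAt.differentiableWithinAt) hρ0 hρr ?_ ?_ ?_ ?_
  · simp [f, ht0, h0V]
  · simp [f, ht0, hΦ0]; linarith
  · intro z hz; exact hΦρ _ ⟨z, subset_closure hz.1, rfl⟩
  · intro z hz h0
    have h2 := hne z (subset_closure hz.1)
    rw [← hΦ0] at h0
    have := hΦi (hE'V ⟨z, subset_closure hz.1, rfl⟩) h0V h0
    exact h2 (inv_eq_zero.mp this)
  · refine (Polynomial.finite_setOfPred_isRoot h.monic.ne_zero).subset ?_
    rintro z ⟨hz, he⟩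
    exact hfixs z hz he
  · intro z hz he
    have hs := hfixs z hz he
    have h1 := hΦi hz.2.2.1 (hE'V ⟨z, subset_closure hz.1, rfl⟩) he
    have h2 := hne z (subset_closure hz.1)
    obtain ⟨k, hk, hk1, hk2⟩ := h.root z hs
    have ht := h.cop hs
    have hkr : (1:ℝ) ≤ k := by exact_mod_cast hk
    have hk0 : (k:ℂ) ≠ 0 := by exact_mod_cast (by omega : k ≠ 0)
    refine ⟨1 - 1/k, ?_, ?_, ?_, ?_⟩
    · rw [sub_nonneg, div_le_one (by linarith)]; exact hkr
    · have : 0 < 1/(k:ℝ) := by positivity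
      linarith
    · rw [(hgd z hz).deriv, (hhd z hz).deriv, h1]
      have hP : P.eval z = (z - ξ) * t.eval z := by rw [hPe, hs, sub_zero]
      have hP' : P.derivative.eval z = t.eval z + (z - ξ) * t.derivative.eval z - s.derivative.eval z := by
        simp [P]
      rw [hP, hP', hk1]
      push_cast
      field_simp
      ring
    · rw [(hhd z hz).deriv]
      refine mul_ne_zero (hΦ' _ (hE'V ⟨z, subset_closure hz.1, rfl⟩)) (div_ne_zero (by norm_num) (pow_ne_zero _ h2))

end NW
end

section
open Complex Set Filter Topology Metric

namespace NW
variable {s t : Polynomial ℂ} {m : ℕ} {ξ : ℂ} {ε c : ℝ}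

lemma Good.ball_sub (h : Good s t m ξ ε c) (n : ℕ) : Metric.ball ξ ε ⊆ KK s t ξ ε n :=
  ball_subset_closedBall.trans (h.K0 ▸ h.K_mono (Nat.zero_le n))

lemma closure_ne_of_bdd {E : Set ℂ} (hEo : IsOpen E) (hEb : Bornology.IsBounded E) (hne : E.Nonempty) :
    ∃ z ∈ closure E, z ∉ E := by
  by_contra! hcon
  have h1 : IsClopen E := ⟨isClosed_of_closure_subset hcon, hEo⟩
  rcases isClopen_iff.mp h1 with h | h
  · exact hne.ne_empty h
  · rw [h] at hEb
    exact NormedSpace.unbounded_univ ℝ ℂ hEb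

lemma no_pole_step {E K : Set ℂ} (hEo : IsOpen E) (hEb : Bornology.IsBounded E)
    (hEp : IsPreconnected E) (hne : E.Nonempty)
    (hbd : ∀ z ∈ closure E, z ∉ E → NN s t z ∈ K) (hK : IsCompact K) (hKf : IsPreconnected Kᶜ)
    (hnt : ∀ z ∈ closure E, t.eval z ≠ 0) : ∀ z ∈ E, NN s t z ∈ K := by
  have hEc : IsCompact (closure E) := hEb.isCompact_closure
  have hcont : ContinuousOn (NN s t) (closure E) := fun z hz =>
    (NN_diff (hnt z hz)).continuousAt.continuousWithinAt
  have hd : DifferentiableOn ℂ (NN s t) E := fun z hz =>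
    (NN_diff (hnt z (subset_closure hz))).differentiableWithinAt
  rcases (hd.analyticOnNhd hEo).is_constant_or_isOpen hEp with ⟨w, hw⟩ | hop
  · obtain ⟨z1, hz1, hz1'⟩ := closure_ne_of_bdd hEo hEb hne
    have h1 : NN s t z1 = w := by
      have : Set.EqOn (NN s t) (fun _ => w) (closure E) := by
        apply Set.EqOn.of_subset_closure (s := E) (t := closure E) (fun z hz => hw z hz) hcont continuousOn_const subset_closure subset_rfl
      exact this hz1
    intro z hz
    rw [hw z hz, ← h1]; exact hbd z1 hz1 hz1'
  · intro z hz
    by_contra hcon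
    have hopen : IsOpen (NN s t '' E) := hop E subset_rfl hEo
    have hIc : IsCompact (NN s t '' closure E) := hEc.image_of_continuousOn hcont
    have hsub : Kᶜ ⊆ NN s t '' E := by
      apply hKf.subset_of_closure_inter_subset hopen ⟨_, hcon, z, hz, rfl⟩
      rintro y ⟨hy, hyK⟩
      have : y ∈ NN s t '' closure E := closure_minimal (image_mono subset_closure) hIc.isClosed hy
      obtain ⟨x, hx, rfl⟩ := this
      by_cases hxE : x ∈ E
      · exact ⟨x, hxE, rfl⟩
      · exact absurd (hbd x hx hxE) hyK
    have hb : Bornology.IsBounded (univ : Set ℂ) := by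
      refine (hK.isBounded.union hIc.isBounded).subset ?_
      intro x _
      by_cases hx : x ∈ K
      · exact Or.inl hx
      · exact Or.inr (image_mono subset_closure (hsub hx))
    exact NormedSpace.unbounded_univ ℝ ℂ hb

theorem Good.full (h : Good s t m ξ ε c) (n : ℕ) : IsPreconnected (KK s t ξ ε n)ᶜ := by
  induction n with
  | zero => rw [h.K0]; exact compl_ball_pre ξ h.ε0.le
  | succ n ih =>
    apply full_of_no_bdd (h.Kcompact _)
    intro a ha hEb
    set K' := KK s t ξ ε (n+1) with hK'
    have hK'o : IsOpen K'ᶜ := (h.Kcompact (n+1)).isClosed.isOpen_compl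
    set E := connectedComponentIn K'ᶜ a with hE
    have hEo : IsOpen E := hK'o.connectedComponentIn
    have hEp : IsPreconnected E := isPreconnected_connectedComponentIn
    have haE : a ∈ E := mem_connectedComponentIn ha
    have hEK' : ∀ z ∈ E, z ∉ K' := fun z hz => connectedComponentIn_subset _ _ hz
    have hbd : ∀ z ∈ closure E, z ∉ E → z ∈ K' := by
      intro z hz hzE
      by_contra hzK
      exact hzE (closure_comp hK'o a hz hzK)
    have hEK : ∀ z ∈ closure E, z ∉ KK s t ξ ε n := by
      intro z hz hzK
      obtain ⟨y, hy, hy'⟩ := mem_closure_iff.mp hz _ isOpen_interior (h.K_int n hzK)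
      exact hEK' y hy' (interior_subset hy)
    by_cases hpole : ∃ z ∈ E, t.eval z = 0
    · obtain ⟨z0, hz0, ht0⟩ := hpole
      exact pole_step h.ns h.hξ hEo hEb hEK (fun z hz hzE => ⟨h.Knt (hbd z hz hzE), h.map (hbd z hz hzE)⟩)
        (h.Kcompact n) (KK_pre n) h.ε0 (h.ball_sub n) ih hz0 ht0
    · push Not at hpole
      have h1 := no_pole_step hEo hEb hEp ⟨a, haE⟩ (fun z hz hzE => h.map (hbd z hz hzE)) (h.Kcompact n) ih
        (by
          intro z hz
          by_cases hzE : z ∈ E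
          · exact hpole z hzE
          · exact h.Knt (hbd z hz hzE))
      obtain ⟨z1, hz1, hz1'⟩ := closure_ne_of_bdd hEo hEb ⟨a, haE⟩
      have h2 : closure E ⊆ K' := by
        apply K_absorb hEp.closure
        · intro z hz
          by_cases hzE : z ∈ E
          · rw [GG_succ]; exact KK_sub n (h1 z hzE)
          · exact KK_sub _ (hbd z hz hzE)
        · exact ⟨z1, hz1, hbd z1 hz1 hz1'⟩
      exact ha (h2 (subset_closure haE))

end NW
end

section
open Complex Set Filter Topology Metric

namespace NW

lemma exp_one_small {z : ℂ} (h : Complex.exp z = 1) (hz : ‖z‖ < 1) : z = 0 := by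
  obtain ⟨n, hn⟩ := Complex.exp_eq_one_iff.mp h
  by_cases h0 : n = 0
  · rw [hn, h0]; simp
  · exfalso
    have h1 : (1:ℝ) ≤ |(n:ℝ)| := by exact_mod_cast Int.one_le_abs h0
    rw [hn, norm_mul, norm_mul, norm_mul] at hz
    simp only [norm_intCast, Complex.norm_ofNat, norm_real, norm_I, mul_one, Real.norm_eq_abs] at hz
    rw [abs_of_pos Real.pi_pos] at hz
    nlinarith [Real.pi_gt_three]

lemma log_unique {α : Type*} [TopologicalSpace α] {X : Set α} (hX : IsPreconnected X) {f g : α → ℂ}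
    (hf : ContinuousOn f X) (hg : ContinuousOn g X) (h : ∀ x ∈ X, Complex.exp (f x) = Complex.exp (g x))
    {x0 : α} (hx0 : x0 ∈ X) (h0 : f x0 = g x0) : ∀ x ∈ X, f x = g x := by
  intro x hx
  by_contra hne
  have hone : ∀ y ∈ X, Complex.exp (f y - g y) = 1 := by
    intro y hy
    rw [Complex.exp_sub, h y hy, div_self (Complex.exp_ne_zero _)]
  have h1 : (1:ℝ) ≤ ‖f x - g x‖ := by
    by_contra hlt
    exact hne (sub_eq_zero.mp (exp_one_small (hone x hx) (not_le.mp hlt)))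
  have h2 := hX.intermediate_value hx0 hx (hf.sub hg).norm
  obtain ⟨y, hy, hy'⟩ := h2 (show (1/2 : ℝ) ∈ _ from ⟨by simp [h0], by
    have : ((f - g) x) = f x - g x := rfl
    simp only [this]; linarith⟩)
  have hy2 : ‖f y - g y‖ = 1/2 := hy'
  have h3 := exp_one_small (hone y hy) (by rw [hy2]; norm_num)
  rw [h3, norm_zero] at hy2
  norm_num at hy2

lemma log_const {α : Type*} [TopologicalSpace α] {X : Set α} (hX : IsPreconnected X) {f g : α → ℂ}
    (hf : ContinuousOn f X) (hg : ContinuousOn g X) (h : ∀ x ∈ X, Complex.exp (f x) = Complex.exp (g x))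
    {x0 : α} (hx0 : x0 ∈ X) : ∀ x ∈ X, f x - g x = f x0 - g x0 := by
  have hg' : ContinuousOn (fun x => g x + (f x0 - g x0)) X := hg.add continuousOn_const
  have := log_unique hX hf hg' (by
    intro x hx
    simp only [Complex.exp_add, Complex.exp_sub, h x hx, h x0 hx0]
    rw [div_self (Complex.exp_ne_zero _), mul_one]) hx0 (by ring)
  intro x hx
  rw [this x hx]; ring

lemma slit_of {z : ℂ} (h : ‖z - 1‖ < 1) : z ∈ slitPlane := by
  have := Complex.mem_slitPlane_of_norm_lt_one h
  simpa using this

structure LogOn (K : Set ℂ) (ξ a : ℂ) (l : ℂ → ℂ) : Prop where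
  cont : ContinuousOn l K
  base : l ξ = 0
  eq : ∀ u ∈ K, Complex.exp (l u) = (u - a) / (ξ - a)

lemma LogOn.unique {K : Set ℂ} {ξ a : ℂ} {l l' : ℂ → ℂ} (hK : IsPreconnected K) (hξ : ξ ∈ K)
    (h : LogOn K ξ a l) (h' : LogOn K ξ a l') : ∀ u ∈ K, l u = l' u :=
  log_unique hK h.cont h'.cont (fun x hx => by rw [h.eq x hx, h'.eq x hx]) hξ (by rw [h.base, h'.base])

lemma sub_div_slit {u a a0 : ℂ} (h : ‖a - a0‖ < ‖u - a0‖) : (u - a) / (u - a0) ∈ slitPlane := by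
  have h0 : 0 < ‖u - a0‖ := (norm_nonneg _).trans_lt h
  have h1 : u - a0 ≠ 0 := norm_pos_iff.mp h0
  apply slit_of
  have : (u - a) / (u - a0) - 1 = (a0 - a) / (u - a0) := by field_simp; ring
  rw [this, norm_div, div_lt_one h0, norm_sub_rev]; exact h

lemma LogOn.step {K : Set ℂ} {ξ a a0 : ℂ} {l : ℂ → ℂ} (hξ : ξ ∈ K) (h : LogOn K ξ a0 l)
    (ha : ∀ u ∈ K, ‖a - a0‖ < ‖u - a0‖) :
    LogOn K ξ a (fun u => l u + Complex.log ((u - a) / (u - a0)) - Complex.log ((ξ - a) / (ξ - a0))) := by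
  have h0 : ∀ u ∈ K, u - a0 ≠ 0 := fun u hu => norm_pos_iff.mp ((norm_nonneg _).trans_lt (ha u hu))
  have hs : ∀ u ∈ K, (u - a) / (u - a0) ∈ slitPlane := fun u hu => sub_div_slit (ha u hu)
  have hn : ∀ u ∈ K, u - a ≠ 0 := by
    intro u hu h1
    have := hs u hu
    rw [h1, zero_div] at this
    simp at this
  refine ⟨?_, ?_, ?_⟩
  · refine (h.cont.add (ContinuousOn.clog ?_ hs)).sub continuousOn_const
    exact ContinuousOn.div (by fun_prop) (by fun_prop) h0
  · simp [h.base]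
  · intro u hu
    rw [Complex.exp_sub, Complex.exp_add, h.eq u hu, Complex.exp_log (slitPlane_ne_zero (hs u hu)),
      Complex.exp_log (slitPlane_ne_zero (hs ξ hξ))]
    have := h0 u hu; have := h0 ξ hξ; have := hn u hu; have := hn ξ hξ
    field_simp

lemma one_sub_slit {u a : ℂ} (h : ‖u‖ < ‖a‖) : 1 - u / a ∈ slitPlane := by
  apply slit_of
  have h0 : 0 < ‖a‖ := (norm_nonneg _).trans_lt h
  have : 1 - u / a - 1 = - (u / a) := by ring
  rw [this, norm_neg, norm_div, div_lt_one h0]; exact h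

lemma LogOn.big {K : Set ℂ} {ξ a : ℂ} (hξ : ξ ∈ K) (ha : ∀ u ∈ K, ‖u‖ < ‖a‖) :
    LogOn K ξ a (fun u => Complex.log (1 - u / a) - Complex.log (1 - ξ / a)) := by
  have ha0 : a ≠ 0 := norm_pos_iff.mp ((norm_nonneg _).trans_lt (ha ξ hξ))
  refine ⟨?_, by simp, ?_⟩
  · refine ContinuousOn.sub (ContinuousOn.clog (by fun_prop) fun u hu => one_sub_slit (ha u hu)) continuousOn_const
  · intro u hu
    rw [Complex.exp_sub, Complex.exp_log (slitPlane_ne_zero (one_sub_slit (ha u hu))),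
      Complex.exp_log (slitPlane_ne_zero (one_sub_slit (ha ξ hξ)))]
    have h1 : 1 - u/a = - (u - a)/a := by field_simp; ring
    have h2 : 1 - ξ/a = - (ξ - a)/a := by field_simp; ring
    rw [h1, h2, div_div_div_cancel_right₀ ha0, neg_div_neg_eq]

structure Fullc (K : Set ℂ) (ξ : ℂ) : Prop where
  cpt : IsCompact K
  pre : IsPreconnected K
  mem : ξ ∈ K
  full : IsPreconnected Kᶜ

lemma exists_gap {K : Set ℂ} (hK : IsCompact K) {a : ℂ} (ha : a ∉ K) : ∃ δ > 0, ∀ u ∈ K, δ ≤ ‖u - a‖ := by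
  obtain ⟨δ, hδ, h⟩ := Metric.isOpen_iff.mp hK.isClosed.isOpen_compl a ha
  refine ⟨δ, hδ, fun u hu => ?_⟩
  by_contra hlt
  exact h (show u ∈ ball a δ by rw [mem_ball, dist_eq_norm]; exact not_le.mp hlt) hu

lemma exists_big {K : Set ℂ} (hK : IsCompact K) : ∃ R : ℝ, 0 < R ∧ ∀ a : ℂ, R ≤ ‖a‖ → ∀ u ∈ K, ‖u‖ < ‖a‖ := by
  obtain ⟨R, hR0, hR⟩ := hK.isBounded.subset_closedBall_lt 0 0
  refine ⟨R + 1, by linarith, fun a ha u hu => ?_⟩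
  have := hR hu
  rw [mem_closedBall_zero_iff] at this
  linarith

lemma Fullc.exists_log {K : Set ℂ} {ξ : ℂ} (h : Fullc K ξ) {a : ℂ} (ha : a ∉ K) : ∃ l, LogOn K ξ a l := by
  suffices hs : Kᶜ ⊆ {a | a ∉ K ∧ ∃ l, LogOn K ξ a l} from (hs ha).2
  apply h.full.subset_of_closure_inter_subset
  · rw [Metric.isOpen_iff]
    rintro a0 ⟨ha0, l, hl⟩
    obtain ⟨δ, hδ, hg⟩ := exists_gap h.cpt ha0
    refine ⟨δ, hδ, fun a ha => ?_⟩
    rw [mem_ball, dist_eq_norm] at ha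
    refine ⟨fun haK => ?_, _, hl.step h.mem fun u hu => ha.trans_le (hg u hu)⟩
    linarith [hg a haK]
  · obtain ⟨R, hR0, hR⟩ := exists_big h.cpt
    have h1 : ∀ u ∈ K, ‖u‖ < ‖(R:ℂ)‖ := hR R (by rw [norm_real]; exact le_abs_self R)
    have h2 : (R:ℂ) ∉ K := fun hk => lt_irrefl _ (h1 _ hk)
    exact ⟨R, h2, h2, _, LogOn.big h.mem h1⟩
  · rintro a ⟨ha, haK⟩
    obtain ⟨δ, hδ, hg⟩ := exists_gap h.cpt haK
    obtain ⟨a0, ha0, hd⟩ := Metric.mem_closure_iff.mp ha (δ/2) (by linarith)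
    obtain ⟨_, l, hl⟩ := ha0
    rw [dist_eq_norm] at hd
    refine ⟨haK, _, hl.step h.mem fun u hu => ?_⟩
    have h1 := hg u hu
    have h2 : ‖u - a‖ ≤ ‖u - a0‖ + ‖a - a0‖ := by
      calc ‖u - a‖ = ‖(u - a0) - (a - a0)‖ := by congr 1; ring
        _ ≤ _ := norm_sub_le _ _
    linarith

open Classical in
noncomputable def Lam (K : Set ℂ) (ξ a : ℂ) : ℂ → ℂ :=
  if h : ∃ l, LogOn K ξ a l then h.choose else 0

variable {K K' : Set ℂ} {ξ : ℂ}

lemma Fullc.lam (h : Fullc K ξ) {a : ℂ} (ha : a ∉ K) : LogOn K ξ a (Lam K ξ a) := by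
  have := h.exists_log ha
  rw [Lam, dif_pos this]
  exact this.choose_spec

lemma Fullc.lam_eq (h : Fullc K ξ) {a : ℂ} (ha : a ∉ K) {l : ℂ → ℂ} (hl : LogOn K ξ a l) :
    ∀ u ∈ K, Lam K ξ a u = l u := LogOn.unique h.pre h.mem (h.lam ha) hl

lemma Fullc.lam_mono (h : Fullc K ξ) (h' : Fullc K' ξ) (hKK : K ⊆ K') {a : ℂ} (ha : a ∉ K') :
    ∀ u ∈ K, Lam K ξ a u = Lam K' ξ a u := by
  have h1 := h'.lam ha
  exact h.lam_eq (fun hk => ha (hKK hk)) ⟨h1.cont.mono hKK, h1.base, fun u hu => h1.eq u (hKK hu)⟩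

lemma Fullc.lam_big (h : Fullc K ξ) {a : ℂ} (ha : ∀ u ∈ K, ‖u‖ < ‖a‖) :
    ∀ u ∈ K, Lam K ξ a u = Complex.log (1 - u / a) - Complex.log (1 - ξ / a) :=
  h.lam_eq (fun hk => lt_irrefl _ (ha _ hk)) (LogOn.big h.mem ha)

lemma Fullc.lam_cont (h : Fullc K ξ) : ContinuousOn (fun p : ℂ × ℂ => Lam K ξ p.2 p.1) (K ×ˢ Kᶜ) := by
  rintro ⟨u0, a0⟩ ⟨hu0, ha0⟩
  simp only at hu0 ha0
  obtain ⟨δ, hδ, hg⟩ := exists_gap h.cpt ha0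
  have hev : ∀ᶠ p : ℂ × ℂ in 𝓝[K ×ˢ Kᶜ] (u0, a0), Lam K ξ p.2 p.1 =
      Lam K ξ a0 p.1 + Complex.log ((p.1 - p.2) / (p.1 - a0)) - Complex.log ((ξ - p.2) / (ξ - a0)) := by
    have h1 : ∀ᶠ p : ℂ × ℂ in 𝓝 (u0, a0), p.2 ∈ ball a0 δ :=
      continuousAt_snd.eventually (ball_mem_nhds a0 hδ)
    filter_upwards [mem_nhdsWithin_of_mem_nhds h1, self_mem_nhdsWithin] with p hp hpK
    rw [mem_ball, dist_eq_norm] at hp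
    exact h.lam_eq hpK.2 ((h.lam ha0).step h.mem fun u hu => hp.trans_le (hg u hu)) p.1 hpK.1
  have hne : ∀ u ∈ K, u - a0 ≠ 0 := fun u hu hk => by
    rw [sub_eq_zero] at hk; exact ha0 (hk ▸ hu)
  refine ContinuousWithinAt.congr_of_eventuallyEq ?_ hev (hev.self_of_nhdsWithin ⟨hu0, ha0⟩)
  refine ContinuousWithinAt.sub (ContinuousWithinAt.add ?_ ?_) ?_
  · have h1 := (h.lam ha0).cont u0 hu0
    exact ContinuousWithinAt.comp (f := Prod.fst) (t := K) (x := ((u0, a0) : ℂ × ℂ)) h1 continuousWithinAt_fst (fun p hp => hp.1)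
  · apply ContinuousAt.continuousWithinAt
    apply ContinuousAt.clog
    · exact ContinuousAt.div (by fun_prop) (by fun_prop) (hne u0 hu0)
    · simp only [div_self (hne u0 hu0)]; exact one_mem_slitPlane
  · apply ContinuousAt.continuousWithinAt
    apply ContinuousAt.clog
    · exact ContinuousAt.div (by fun_prop) (by fun_prop) (hne ξ h.mem)
    · simp only [div_self (hne ξ h.mem)]; exact one_mem_slitPlane

end NW
end

section
open Complex Set Filter Topology Metric

namespace NW
variable {s t : Polynomial ℂ} {m : ℕ} {ξ : ℂ} {ε c : ℝ}

lemma exists_bdd_nhd {F : Set ℂ} (hF : IsClosed F) {c : ℂ} (hc : c ∈ F)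
    (hb : Bornology.IsBounded (connectedComponentIn F c)) :
    ∃ O : Set ℂ, IsOpen O ∧ Bornology.IsBounded O ∧ c ∈ O ∧ ∀ z ∈ closure O, z ∉ O → z ∉ F := by
  obtain ⟨R, hR0, hR⟩ := hb.subset_ball_lt 0 0
  set X : Set ℂ := F ∩ closedBall 0 R with hX
  have hXc : IsCompact X := (isCompact_closedBall _ _).inter_left hF
  have : CompactSpace X := isCompact_iff_compactSpace.mp hXc
  have hcX : c ∈ X := ⟨hc, ball_subset_closedBall (hR (mem_connectedComponentIn hc))⟩
  let S : Set X := {x | R ≤ ‖(x:ℂ)‖}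
  have hS : IsCompact S := (isClosed_le continuous_const (by fun_prop)).isCompact
  have hcomp : connectedComponent (⟨c, hcX⟩ : X) ⊆ Sᶜ := by
    intro x hx hxS
    have h1 : (x:ℂ) ∈ connectedComponentIn F c := by
      have h2 : IsPreconnected ((↑) '' connectedComponent (⟨c, hcX⟩ : X) : Set ℂ) :=
        isPreconnected_connectedComponent.image _ continuous_subtype_val.continuousOn
      refine h2.subset_connectedComponentIn ⟨⟨c, hcX⟩, mem_connectedComponent, rfl⟩ ?_ ⟨x, hx, rfl⟩
      rintro _ ⟨y, _, rfl⟩; exact y.2.1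
    have h3 := hR h1
    rw [mem_ball_zero_iff] at h3
    exact absurd hxS (not_le.mpr h3)
  rw [connectedComponent_eq_iInter_isClopen] at hcomp
  obtain ⟨Q, hQ, hcQ, hQS⟩ : ∃ Q : Set X, IsClopen Q ∧ (⟨c, hcX⟩ : X) ∈ Q ∧ Disjoint Q S := by
    by_contra! hcon
    have : Nonempty { s : Set X // IsClopen s ∧ (⟨c, hcX⟩ : X) ∈ s } := ⟨⟨univ, isClopen_univ, mem_univ _⟩⟩
    have := hS.elim_directed_family_closed (fun s : { s : Set X // IsClopen s ∧ (⟨c, hcX⟩ : X) ∈ s } => s.1)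
      (fun s => s.2.1.isClosed) (by
        ext x
        simp only [mem_inter_iff, mem_empty_iff_false, iff_false, not_and]
        intro hx hx'; exact hcomp hx' hx) (by
        intro a b
        exact ⟨⟨a.1 ∩ b.1, a.2.1.inter b.2.1, a.2.2, b.2.2⟩, inter_subset_left, inter_subset_right⟩)
    obtain ⟨a, ha⟩ := this
    exact hcon a.1 a.2.1 a.2.2 (by rw [disjoint_iff_inter_eq_empty, inter_comm]; exact ha)
  set Q' : Set ℂ := (↑) '' Q with hQ'
  have hQ'c : IsCompact Q' := hQ.isClosed.isCompact.image continuous_subtype_val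
  have hFQ : F \ Q' = (((↑) '' Qᶜ : Set ℂ)) ∪ (F ∩ {z | R ≤ ‖z‖}) := by
    ext z
    constructor
    · rintro ⟨hz, hzQ⟩
      by_cases hzR : R ≤ ‖z‖
      · exact Or.inr ⟨hz, hzR⟩
      · refine Or.inl ⟨⟨z, hz, by rw [mem_closedBall_zero_iff]; exact (not_le.mp hzR).le⟩, fun h => hzQ ⟨_, h, rfl⟩, rfl⟩
    · rintro (⟨x, hx, rfl⟩ | ⟨hz, hzR⟩)
      · refine ⟨x.2.1, ?_⟩
        rintro ⟨y, hy, hyx⟩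
        rw [Subtype.coe_inj] at hyx
        exact hx (hyx ▸ hy)
      · refine ⟨hz, ?_⟩
        rintro ⟨y, hy, rfl⟩
        exact disjoint_left.mp hQS hy hzR
  have hcl : IsClosed (F \ Q') := by
    rw [hFQ]
    exact (hQ.compl.isClosed.isCompact.image continuous_subtype_val).isClosed.union
      (hF.inter (isClosed_le continuous_const continuous_norm))
  obtain ⟨δ, hδ, hd⟩ := (disjoint_sdiff_right : Disjoint Q' (F \ Q')).exists_cthickenings hQ'c hcl
  refine ⟨thickening δ Q', isOpen_thickening, hQ'c.isBounded.thickening, self_subset_thickening hδ _ ⟨_, hcQ, rfl⟩, ?_⟩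
  intro z hz hzO hzF
  exact disjoint_left.mp hd (closure_thickening_subset_cthickening δ Q' hz)
    (self_subset_cthickening _ ⟨hzF, fun h => hzO (self_subset_thickening hδ _ h)⟩)

/-- A chain of full continua exhausting `U`. -/
structure Chain (s t : Polynomial ℂ) (ξ : ℂ) (U : Set ℂ) (J : ℕ → Set ℂ) : Prop where
  full : ∀ i, Fullc (J i) ξ
  step : ∀ i, J i ⊆ interior (J (i+1))
  map : ∀ i, ∀ z ∈ J (i+2), NN s t z ∈ J i
  union : U = ⋃ i, J i
  ball : ∃ r > 0, J 1 = closedBall ξ r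
  con : ∀ z ∈ J 1, z ≠ ξ → ‖NN s t z - ξ‖ < ‖z - ξ‖
  nt : ∀ z ∈ U, t.eval z ≠ 0

variable {U : Set ℂ} {J : ℕ → Set ℂ}

lemma Chain.mono (h : Chain s t ξ U J) : Monotone J :=
  monotone_nat_of_le_succ fun i => (h.step i).trans interior_subset

lemma Chain.sub (h : Chain s t ξ U J) (i : ℕ) : J i ⊆ U := h.union ▸ subset_iUnion J i

lemma Chain.ξU (h : Chain s t ξ U J) : ξ ∈ U := h.sub 0 (h.full 0).mem

lemma Chain.open (h : Chain s t ξ U J) : IsOpen U := by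
  rw [isOpen_iff_mem_nhds]
  intro z hz
  rw [h.union] at hz
  obtain ⟨i, hi⟩ := mem_iUnion.mp hz
  exact mem_of_superset (mem_interior_iff_mem_nhds.mp (h.step i hi)) (h.sub _)

lemma Chain.pre (h : Chain s t ξ U J) : IsPreconnected U := by
  rw [h.union]
  exact isPreconnected_iUnion ⟨ξ, mem_iInter.mpr fun i => (h.full i).mem⟩ fun i => (h.full i).pre

lemma Chain.pre' (h : Chain s t ξ U J) : IsPreconnected (U \ {ξ}) := by
  obtain ⟨r, hr, hJ⟩ := h.ball
  exact punct_pre h.pre hr (ball_subset_closedBall.trans (hJ ▸ h.sub 1))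

lemma Chain.cpt (h : Chain s t ξ U J) {X : Set ℂ} (hX : IsCompact X) (hXU : X ⊆ U) : ∃ i, X ⊆ J i := by
  obtain ⟨i, hi⟩ := hX.elim_directed_cover (fun i => interior (J i)) (fun i => isOpen_interior) (by
    intro z hz
    have := hXU hz
    rw [h.union] at this
    obtain ⟨i, hi⟩ := mem_iUnion.mp this
    exact mem_iUnion.mpr ⟨i+1, h.step i hi⟩) (directed_of_isDirected_le fun i j hij => interior_mono (h.mono hij))
  exact ⟨i, hi.trans interior_subset⟩

lemma Chain.unbdd (h : Chain s t ξ U J) {a : ℂ} (ha : a ∈ Uᶜ) :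
    ¬ Bornology.IsBounded (connectedComponentIn Uᶜ a) := by
  intro hb
  obtain ⟨O, hO, hOb, haO, hfr⟩ := exists_bdd_nhd h.open.isClosed_compl ha hb
  have hfc : IsCompact (closure O \ O) := hOb.isCompact_closure.diff hO
  obtain ⟨i, hi⟩ := h.cpt hfc (fun z hz => not_not.mp (hfr z hz.1 hz.2))
  have hsub := (h.full i).full.subset_of_closure_inter_subset hO
    ⟨a, fun hJ => ha (h.sub i hJ), haO⟩ (by
      rintro z ⟨hz, hzJ⟩
      by_contra hzO
      exact hzJ (hi ⟨hz, hzO⟩))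
  have : (univ : Set ℂ) ⊆ J i ∪ O := fun z _ => by
    by_cases hz : z ∈ J i
    · exact Or.inl hz
    · exact Or.inr (hsub hz)
  exact NormedSpace.unbounded_univ ℝ ℂ (((h.full i).cpt.isBounded.union hOb).subset this)

lemma Good.smaller (h : Good s t m ξ ε c) {ε' : ℝ} (h0 : 0 < ε') (h1 : ε' ≤ ε) : Good s t m ξ ε' c :=
  ⟨h.ns, h.hξ, h0, h.c0, h.c1, fun z hz => h.nt z (closedBall_subset_closedBall h1 hz),
   fun z hz => h.con z (closedBall_subset_closedBall h1 hz)⟩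

lemma Good.fullc (h : Good s t m ξ ε c) (n : ℕ) : Fullc (KK s t ξ ε n) ξ :=
  ⟨h.Kcompact n, KK_pre n, h.ξK n, h.full n⟩

lemma mem_interior_comp {z : ℂ} {A : Set ℂ} (hA : A ∈ 𝓝 z) {V : Set ℂ} (h : ∀ B ⊆ A, IsPreconnected B → z ∈ B → B ⊆ V) :
    z ∈ interior V := by
  obtain ⟨δ, hδ, hb⟩ := Metric.mem_nhds_iff.mp hA
  rw [mem_interior_iff_mem_nhds]
  exact mem_of_superset (ball_mem_nhds z hδ) (h _ hb (convex_ball z δ).isPreconnected (mem_ball_self hδ))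

lemma Good.chain (h : Good s t m ξ ε c) : ∃ J, Chain s t ξ (basinU s t ξ) J := by
  have hc1 := h.c1; have hc0 := h.c0; have hε := h.ε0
  set e := (1 + c) / 2 * ε with he
  have he0 : 0 < e := by positivity
  have hel : e < ε := by nlinarith
  have hce : c * ε < e := by nlinarith
  have g := h.smaller he0 hel.le
  let J : ℕ → Set ℂ := fun i => if i % 2 = 0 then KK s t ξ e (i/2) else KK s t ξ ε (i/2)
  have J0 : ∀ n, J (2*n) = KK s t ξ e n := fun n => by simp [J]
  have J1 : ∀ n, J (2*n+1) = KK s t ξ ε n := fun n => by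
    have h1 : (2*n+1) % 2 = 1 := by omega
    have h2 : (2*n+1) / 2 = n := by omega
    simp [J, h1, h2]
  have step0 : ∀ n, KK s t ξ e n ⊆ interior (KK s t ξ ε n) := by
    intro n z hz
    have hzG := KK_sub n hz
    have hcont := g.iter_cont n z hzG
    have hA : {w | (NN s t)^[n] w ∈ closedBall ξ ε} ∈ 𝓝 z := by
      apply hcont
      apply mem_of_superset (isOpen_ball.mem_nhds _) ball_subset_closedBall
      exact closedBall_subset_ball hel hzG
    refine mem_interior_comp hA fun B hB hBp hzB => ?_
    have h1 : IsPreconnected (KK s t ξ e n ∪ B) := (KK_pre n).union z hz hzB hBp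
    refine subset_union_right.trans (h1.subset_connectedComponentIn (Or.inl (g.ξK n)) ?_)
    refine union_subset ?_ hB
    exact (KK_sub n).trans fun w hw => closedBall_subset_closedBall hel.le hw
  have step1 : ∀ n, KK s t ξ ε n ⊆ interior (KK s t ξ e (n+1)) := by
    intro n z hz
    have hlt : ∀ w ∈ GG s t ξ ε n, (NN s t)^[n+1] w ∈ Metric.ball ξ e := by
      intro w hw
      have h1 := h.con _ hw
      have h2 : (NN s t)^[n] w ∈ closedBall ξ ε := hw
      rw [mem_closedBall, dist_eq_norm] at h2
      rw [Function.iterate_succ_apply', mem_ball, dist_eq_norm]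
      have : c * ‖(NN s t)^[n] w - ξ‖ ≤ c * ε := by gcongr
      linarith
    have hzG := KK_sub n hz
    have hcont := h.iter_cont (n+1) z (h.G_mono (Nat.le_succ n) hzG)
    have hA : {w | (NN s t)^[n+1] w ∈ closedBall ξ e} ∈ 𝓝 z := by
      apply hcont
      exact mem_of_superset (isOpen_ball.mem_nhds (hlt z hzG)) ball_subset_closedBall
    refine mem_interior_comp hA fun B hB hBp hzB => ?_
    have h1 : IsPreconnected (KK s t ξ ε n ∪ B) := (KK_pre n).union z hz hzB hBp
    refine subset_union_right.trans (h1.subset_connectedComponentIn (Or.inl (h.ξK n)) ?_)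
    refine union_subset ?_ hB
    exact (KK_sub n).trans fun w hw => ball_subset_closedBall (hlt w hw)
  have cases : ∀ i, (∃ n, i = 2*n) ∨ ∃ n, i = 2*n+1 := fun i => by
    rcases Nat.even_or_odd i with ⟨n, hn⟩ | ⟨n, hn⟩
    · exact Or.inl ⟨n, by omega⟩
    · exact Or.inr ⟨n, hn⟩
  refine ⟨J, ?_, ?_, ?_, ?_, ⟨ε, hε, ?_⟩, ?_, ?_⟩
  · intro i
    rcases cases i with ⟨n, rfl⟩ | ⟨n, rfl⟩
    · rw [J0]; exact g.fullc n
    · rw [J1]; exact h.fullc n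
  · intro i
    rcases cases i with ⟨n, rfl⟩ | ⟨n, rfl⟩
    · rw [J0, J1]; exact step0 n
    · rw [J1, show 2*n+1+1 = 2*(n+1) by ring, J0]; exact step1 n
  · intro i z hz
    rcases cases i with ⟨n, rfl⟩ | ⟨n, rfl⟩
    · rw [show 2*n+2 = 2*(n+1) by ring, J0] at hz
      rw [J0]; exact g.map hz
    · rw [show 2*n+1+2 = 2*(n+1)+1 by ring, J1] at hz
      rw [J1]; exact h.map hz
  · rw [h.U_eq]
    apply subset_antisymm
    · exact iUnion_subset fun n => (J1 n) ▸ subset_iUnion J _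
    · refine iUnion_subset fun i => ?_
      rcases cases i with ⟨n, rfl⟩ | ⟨n, rfl⟩
      · rw [J0]; exact ((step0 n).trans interior_subset).trans (subset_iUnion _ n)
      · rw [J1]; exact subset_iUnion _ n
  · have := J1 0
    simp only [mul_zero, zero_add] at this
    rw [this, h.K0]
  · intro z hz hne
    have := J1 0
    simp only [mul_zero, zero_add] at this
    rw [this, h.K0] at hz
    have h1 := h.con z hz
    have h2 : 0 < ‖z - ξ‖ := norm_pos_iff.mpr (sub_ne_zero.mpr hne)
    nlinarith
  · intro z hz
    rw [h.U_eq] at hz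
    obtain ⟨n, hn⟩ := mem_iUnion.mp hz
    exact h.Knt hn

/-- the family of full continua -/
def Fam (J : ℕ → Set ℂ) (ξ : ℂ) : Set (Set ℂ) :=
  {X | (∃ i, X = J (i+1)) ∨ ∃ r > 0, X = closedBall ξ r ∧ X ⊆ J 1}

lemma Chain.famFull (h : Chain s t ξ U J) {X : Set ℂ} (hX : X ∈ Fam J ξ) : Fullc X ξ := by
  rcases hX with ⟨i, rfl⟩ | ⟨r, hr, rfl, _⟩
  · exact h.full _
  · exact ⟨isCompact_closedBall _ _, (convex_closedBall _ _).isPreconnected, mem_closedBall_self hr.le, compl_ball_pre ξ hr.le⟩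

lemma Chain.famTot (h : Chain s t ξ U J) {X Y : Set ℂ} (hX : X ∈ Fam J ξ) (hY : Y ∈ Fam J ξ) : X ⊆ Y ∨ Y ⊆ X := by
  rcases hX with ⟨i, rfl⟩ | ⟨r, hr, rfl, h1⟩ <;> rcases hY with ⟨j, rfl⟩ | ⟨r', hr', rfl, h2⟩
  · rcases le_total (i+1) (j+1) with hij | hij
    · exact Or.inl (h.mono hij)
    · exact Or.inr (h.mono hij)
  · exact Or.inr (h2.trans (h.mono (by omega)))
  · exact Or.inl (h1.trans (h.mono (by omega)))
  · rcases le_total r r' with hij | hij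
    · exact Or.inl (closedBall_subset_closedBall hij)
    · exact Or.inr (closedBall_subset_closedBall hij)

lemma Chain.famEx (h : Chain s t ξ U J) {z : ℂ} (hz : z ∈ U) (hne : z ≠ ξ) :
    ∃ X ∈ Fam J ξ, NN s t z ∈ interior X ∧ z ∉ X := by
  by_cases h1 : z ∈ J 1
  · obtain ⟨r0, hr0, hJ⟩ := h.ball
    have hc := h.con z h1 hne
    obtain ⟨r, hr1, hr2⟩ := exists_between hc
    refine ⟨closedBall ξ r, Or.inr ⟨r, (norm_nonneg _).trans_lt hr1, rfl, ?_⟩, ?_, ?_⟩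
    · rw [hJ] at h1 ⊢
      rw [mem_closedBall, dist_eq_norm] at h1
      exact closedBall_subset_closedBall (hr2.le.trans h1)
    · apply ball_subset_interior_closedBall
      rw [mem_ball, dist_eq_norm]; exact hr1
    · rw [mem_closedBall, dist_eq_norm]; exact not_le.mpr hr2
  · rw [h.union] at hz
    obtain ⟨i, hi⟩ := mem_iUnion.mp hz
    classical
    have hex : ∃ i, z ∈ J i := ⟨i, hi⟩
    set k := Nat.find hex with hk
    have hk1 : z ∈ J k := Nat.find_spec hex
    have hk2 : 2 ≤ k := by
      by_contra hlt
      exact h1 (h.mono (show k ≤ 1 by omega) hk1)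
    obtain ⟨j, hj⟩ : ∃ j, k = j + 2 := ⟨k - 2, by omega⟩
    refine ⟨J (j+1), Or.inl ⟨j, rfl⟩, h.step j (h.map j z (hj ▸ hk1)), ?_⟩
    exact Nat.find_min hex (by omega)

lemma Chain.ell (h : Chain s t ξ U J) : ∃ l : ℂ → ℂ, ContinuousOn l (U \ {ξ}) ∧
    (∀ z ∈ U \ {ξ}, Complex.exp (l z) = (NN s t z - z) / (ξ - z)) ∧
    ∀ i, ∀ z ∈ U, z ∉ J (i+1) → NN s t z ∈ J (i+1) → l z = Lam (J (i+1)) ξ z (NN s t z) := by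
  classical
  let l : ℂ → ℂ := fun z => if hz : ∃ X ∈ Fam J ξ, NN s t z ∈ X ∧ z ∉ X then Lam hz.choose ξ z (NN s t z) else 0
  have key : ∀ z, ∀ X ∈ Fam J ξ, NN s t z ∈ X → z ∉ X → l z = Lam X ξ z (NN s t z) := by
    intro z X hX h1 h2
    have hz : ∃ X ∈ Fam J ξ, NN s t z ∈ X ∧ z ∉ X := ⟨X, hX, h1, h2⟩
    have hl : l z = Lam hz.choose ξ z (NN s t z) := dif_pos hz
    rw [hl]
    obtain ⟨h3, h4, h5⟩ := hz.choose_spec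
    rcases h.famTot h3 hX with h6 | h6
    · exact (h.famFull h3).lam_mono (h.famFull hX) h6 h2 _ h4
    · exact ((h.famFull hX).lam_mono (h.famFull h3) h6 h5 _ h1).symm
  refine ⟨l, ?_, ?_, ?_⟩
  · intro z0 hz0
    obtain ⟨X, hX, h1, h2⟩ := h.famEx hz0.1 hz0.2
    have hf := h.famFull hX
    have hN : ContinuousAt (NN s t) z0 := (NN_diff (h.nt z0 hz0.1)).continuousAt
    have hev : ∀ᶠ z in 𝓝 z0, NN s t z ∈ X ∧ z ∉ X := by
      have e1 := hN.eventually (mem_interior_iff_mem_nhds.mp h1)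
      have e2 : ∀ᶠ z in 𝓝 z0, z ∉ X := hf.cpt.isClosed.isOpen_compl.mem_nhds h2
      exact e1.and e2
    have hc : ContinuousWithinAt (fun z => Lam X ξ z (NN s t z)) {z | NN s t z ∈ X ∧ z ∉ X} z0 := by
      have h3 := hf.lam_cont (NN s t z0, z0) ⟨interior_subset h1, h2⟩
      exact ContinuousWithinAt.comp (f := fun z => (NN s t z, z)) (t := X ×ˢ Xᶜ) h3
        (hN.prodMk continuousAt_id).continuousWithinAt (fun z hz => ⟨hz.1, hz.2⟩)
    have hc' := hc.continuousAt hev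
    refine (hc'.congr ?_).continuousWithinAt
    filter_upwards [hev] with z hz
    exact (key z X hX hz.1 hz.2).symm
  · intro z hz
    obtain ⟨X, hX, h1, h2⟩ := h.famEx hz.1 hz.2
    rw [key z X hX (interior_subset h1) h2]
    exact ((h.famFull hX).lam h2).eq _ (interior_subset h1)
  · intro i z _ h1 h2
    exact key z _ (Or.inl ⟨i, rfl⟩) h2 h1

end NW
end

section
open Complex Set Filter Topology Metric

namespace NW
variable {s t s1 : Polynomial ℂ} {m : ℕ} {ξ : ℂ} {ε c : ℝ} {U : Set ℂ} {J : ℕ → Set ℂ}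

lemma Chain.fix (h : Chain s t ξ U J) {z : ℂ} (hz : z ∈ U) (hs : s.eval z = 0) : z = ξ := by
  by_contra hne
  obtain ⟨X, _, h1, h2⟩ := h.famEx hz hne
  rw [NN_root hs] at h1
  exact h2 (interior_subset h1)

/-- closed union of components of the complement of `U` -/
structure Sat (U E : Set ℂ) : Prop where
  cl : IsClosed E
  sub : E ⊆ Uᶜ
  sat : ∀ z ∈ E, connectedComponentIn Uᶜ z ⊆ E

variable {E : Set ℂ}

lemma Sat.disj (hE : Sat U E) {z : ℂ} (hz : z ∈ Uᶜ) (hzE : z ∉ E) : connectedComponentIn Uᶜ z ⊆ Eᶜ := by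
  intro y hy hyE
  apply hzE
  apply hE.sat y hyE
  rw [← connectedComponentIn_eq hy]
  exact mem_connectedComponentIn hz

lemma Sat.UE (hE : Sat U E) : U ⊆ Eᶜ := fun _ hz hE' => hE.sub hE' hz

lemma Sat.closure_sub (hE : Sat U E) (hU : IsOpen U) {V : Set ℂ} (hV : IsPreconnected V) {v : ℂ} (hv : v ∈ V) (hvE : v ∉ E)
    (hVU : V ⊆ Uᶜ) : closure V ⊆ Eᶜ := by
  have h1 : closure V ⊆ Uᶜ := closure_minimal hVU hU.isClosed_compl
  exact (hV.closure.subset_connectedComponentIn (subset_closure hv) h1).trans (hE.disj (hVU hv) hvE)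

lemma Sat.pre (h : Chain s t ξ U J) (hE : Sat U E) : IsPreconnected Eᶜ := by
  have hUc : U ⊆ connectedComponentIn Eᶜ ξ := h.pre.subset_connectedComponentIn h.ξU hE.UE
  suffices hs : Eᶜ ⊆ connectedComponentIn Eᶜ ξ by
    have : Eᶜ = connectedComponentIn Eᶜ ξ := subset_antisymm hs (connectedComponentIn_subset _ _)
    rw [this]; exact isPreconnected_connectedComponentIn
  intro z hz
  by_contra hcon
  set V := connectedComponentIn Eᶜ z with hV
  have hVU : V ⊆ Uᶜ := by
    intro y hy hyU
    apply hcon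
    rw [connectedComponentIn_eq (hUc hyU), ← connectedComponentIn_eq hy]
    exact mem_connectedComponentIn hz
  have hVo : IsOpen V := hE.cl.isOpen_compl.connectedComponentIn
  have hzV : z ∈ V := mem_connectedComponentIn hz
  have hcl := hE.closure_sub h.open isPreconnected_connectedComponentIn hzV hz hVU
  have hclo : IsClopen V := ⟨isClosed_of_closure_subset fun y hy => closure_comp hE.cl.isOpen_compl z hy (hcl hy), hVo⟩
  rcases isClopen_iff.mp hclo with h1 | h1
  · rw [h1] at hzV; exact hzV
  · exact hVU (h1 ▸ mem_univ ξ) h.ξU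

lemma Sat.noHole (h : Chain s t ξ U J) (hE : Sat U E) : NoHole Eᶜ := by
  intro a ha
  rw [mem_compl_iff, not_not] at ha
  exact ⟨_, isPreconnected_connectedComponentIn, h.unbdd (hE.sub ha), by rw [compl_compl]; exact hE.sat a ha,
    mem_connectedComponentIn (hE.sub ha)⟩

/-- the function whose logarithm is studied -/
noncomputable def qq (s1 t : Polynomial ℂ) (m : ℕ) (z : ℂ) : ℂ := m * s1.eval z / t.eval z

lemma NS.s1_ne (h : NS s t m) (hξ : s.eval ξ = 0) (hs1 : s = (Polynomial.X - Polynomial.C ξ) * s1) : s1.eval ξ ≠ 0 := by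
  obtain ⟨k, _, _, h2⟩ := h.root ξ hξ
  rw [hs1] at h2
  simpa using h2

lemma qq_eq (hs1 : s = (Polynomial.X - Polynomial.C ξ) * s1) {z : ℂ} (hz : z ≠ ξ) (ht : t.eval z ≠ 0) :
    qq s1 t m z = m * ((NN s t z - z) / (ξ - z)) := by
  have h1 : ξ - z ≠ 0 := sub_ne_zero.mpr (Ne.symm hz)
  rw [qq, NN, hs1]
  simp only [Polynomial.eval_mul, Polynomial.eval_sub, Polynomial.eval_X, Polynomial.eval_C]
  field_simp
  ring

lemma exists_L (h : Chain s t ξ U J) (hn : NS s t m) (hξ : s.eval ξ = 0)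
    (hs1 : s = (Polynomial.X - Polynomial.C ξ) * s1) (hE : Sat U E) (hEs : ∀ z, s1.eval z = 0 → z ∈ E)
    (hEt : ∀ z, t.eval z = 0 → z ∈ E) {l : ℂ → ℂ} (hl : ContinuousOn l (U \ {ξ}))
    (hle : ∀ z ∈ U \ {ξ}, Complex.exp (l z) = (NN s t z - z) / (ξ - z)) :
    ∃ L : ℂ → ℂ, ContinuousOn L Eᶜ ∧ (∀ z ∈ Eᶜ, Complex.exp (L z) = qq s1 t m z) ∧
      ∀ z ∈ U \ {ξ}, L z = Real.log m + l z := by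
  have hΩ := hE.cl.isOpen_compl
  have hm : (m:ℂ) ≠ 0 := hn.m0
  have ht0 : ∀ z ∈ Eᶜ, t.eval z ≠ 0 := fun z hz h0 => hz (hEt z h0)
  have hs0 : ∀ z ∈ Eᶜ, s1.eval z ≠ 0 := fun z hz h0 => hz (hEs z h0)
  have hqP : PAon Eᶜ (qq s1 t m) :=
    (((PAon.const (m:ℂ)).mul (PAon.poly s1)).mul ((PAon.poly t).inv (Sat.noHole h hE) ht0)).congr
      fun z _ => by rw [qq, div_eq_mul_inv]
  have hq0 : ∀ z ∈ Eᶜ, qq s1 t m z ≠ 0 := fun z hz => div_ne_zero (mul_ne_zero hm (hs0 z hz)) (ht0 z hz)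
  obtain ⟨F, hF, hFe⟩ := hqP.log hΩ (Sat.pre h hE) (Sat.noHole h hE) hq0
  have hFc := (hF.differentiableOn hΩ).continuousOn
  obtain ⟨r, hr, hJ⟩ := h.ball
  have hz1 : ξ + r ∈ U \ {ξ} := by
    refine ⟨h.sub 1 (by rw [hJ]; simp [abs_of_pos hr]), ?_⟩
    simp [hr.ne']
  set z1 := ξ + (r:ℂ)
  have hexp : ∀ z ∈ U \ {ξ}, Complex.exp (Real.log m + l z) = qq s1 t m z := by
    intro z hz
    rw [qq_eq hs1 hz.2 (h.nt z hz.1), Complex.exp_add, hle z hz, ← Complex.ofReal_exp, Real.exp_log]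
    · simp
    · have : m ≠ 0 := by exact_mod_cast hm
      positivity
  have hshift : Complex.exp (Real.log m + l z1 - F z1) = 1 := by
    rw [Complex.exp_sub, hexp z1 hz1, hFe z1 (hE.UE hz1.1), div_self (hq0 _ (hE.UE hz1.1))]
  have hLc : ContinuousOn (fun z => F z + (Real.log m + l z1 - F z1)) Eᶜ := hFc.add continuousOn_const
  have hLe : ∀ z ∈ Eᶜ, Complex.exp (F z + (Real.log m + l z1 - F z1)) = qq s1 t m z := by
    intro z hz
    rw [Complex.exp_add, hshift, mul_one, hFe z hz]
  refine ⟨fun z => F z + (Real.log m + l z1 - F z1), hLc, hLe, ?_⟩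
  refine log_unique h.pre' (hLc.mono fun z hz => hE.UE hz.1)
    (ContinuousOn.add continuousOn_const hl) (fun z hz => ?_) hz1 (by simp)
  rw [hLe z (hE.UE hz.1), hexp z hz]

lemma arg_small {u : ℂ} (hu : ‖u‖ < 1) : |(1 - u).arg| < Real.pi / 2 := by
  rw [Complex.abs_arg_lt_pi_div_two_iff]
  left
  have := (Complex.abs_re_le_norm u).trans_lt hu
  rw [abs_lt] at this
  simp only [sub_re, one_re]; linarith

lemma key_claim (h : Chain s t ξ U J) (hn : NS s t m) (hξ : s.eval ξ = 0)
    (hs1 : s = (Polynomial.X - Polynomial.C ξ) * s1) (hE : Sat U E) {l L : ℂ → ℂ}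
    (hl : ∀ i, ∀ z ∈ U, z ∉ J (i+1) → NN s t z ∈ J (i+1) → l z = Lam (J (i+1)) ξ z (NN s t z))
    (hLc : ContinuousOn L Eᶜ) (hLe : ∀ z ∈ Eᶜ, Complex.exp (L z) = qq s1 t m z)
    (hLl : ∀ z ∈ U \ {ξ}, L z = Real.log m + l z) (hEne : E.Nonempty)
    {R : ℝ} (hR0 : 0 ≤ R) (hRt : ∀ z : ℂ, R ≤ ‖z‖ → t.eval z ≠ 0) (hRq : ∀ z : ℂ, R ≤ ‖z‖ → ‖qq s1 t m z - 1‖ < 1)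
    (hRN : ∀ z : ℂ, R ≤ ‖z‖ → ‖NN s t z‖ < ‖z‖) (hRJ : ∀ z ∈ J 1, ‖z‖ < R) {v : ℂ}
    (hv : v ∈ Eᶜ ∩ {z | R < ‖z‖})
    (hub : ¬ Bornology.IsBounded (connectedComponentIn (Eᶜ ∩ {z | R < ‖z‖}) v)) :
    ∀ z ∈ connectedComponentIn (Eᶜ ∩ {z | R < ‖z‖}) v, L z = Complex.log (qq s1 t m z) := by
  have hop : IsOpen (Eᶜ ∩ {z : ℂ | R < ‖z‖}) := hE.cl.isOpen_compl.inter (isOpen_lt continuous_const continuous_norm)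
  set V := connectedComponentIn (Eᶜ ∩ {z | R < ‖z‖}) v with hVdef
  have hVo : IsOpen V := hop.connectedComponentIn
  have hVp : IsPreconnected V := isPreconnected_connectedComponentIn
  have hvV : v ∈ V := mem_connectedComponentIn hv
  have hVsub : V ⊆ Eᶜ ∩ {z | R < ‖z‖} := connectedComponentIn_subset _ _
  have hclR : ∀ z ∈ closure V, R ≤ ‖z‖ := by
    have : closure V ⊆ {z : ℂ | R ≤ ‖z‖} :=
      closure_minimal (fun z hz => le_of_lt (show R < ‖z‖ from (hVsub hz).2)) (isClosed_le continuous_const continuous_norm)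
    exact this
  have hξR : ‖ξ‖ < R := hRJ ξ (h.full 1).mem
  -- step 1
  have hmeet : (V ∩ U).Nonempty := by
    by_contra hcon
    have hVU : V ⊆ Uᶜ := fun z hz hzU => hcon ⟨z, hz, hzU⟩
    have hcl := hE.closure_sub h.open hVp hvV hv.1 hVU
    have hsub : {z : ℂ | R < ‖z‖} ⊆ V :=
      (isPreconnected_outside hR0).subset_of_closure_inter_subset hVo ⟨v, hv.2, hvV⟩
        (fun z hz => closure_comp hop v hz.1 ⟨hcl hz.1, hz.2⟩)
    obtain ⟨w, hw⟩ := hEne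
    apply h.unbdd (hE.sub hw)
    refine (isBounded_closedBall (x := (0:ℂ)) (r := R)).subset ?_
    intro z hz
    rw [mem_closedBall_zero_iff]
    by_contra hlt
    exact (hVsub (hsub (not_le.mp hlt))).1 (hE.sat w hw hz)
  -- step 2
  classical
  have hex : ∃ i, (J i ∩ closure V).Nonempty := by
    obtain ⟨z, hz, hzU⟩ := hmeet
    rw [h.union] at hzU
    obtain ⟨i, hi⟩ := mem_iUnion.mp hzU
    exact ⟨i, z, hi, subset_closure hz⟩
  have hi := Nat.find_spec hex
  have hmin : ∀ k < Nat.find hex, ¬ (J k ∩ closure V).Nonempty := fun k hk => Nat.find_min hex hk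
  generalize Nat.find hex = i at hi hmin
  have hi2 : 2 ≤ i := by
    by_contra hlt
    obtain ⟨z, hz, hzV⟩ := hi
    exact absurd (hclR z hzV) (not_le.mpr (hRJ z (h.mono (show i ≤ 1 by omega) hz)))
  obtain ⟨j, rfl⟩ : ∃ j, i = j + 2 := ⟨i - 2, by omega⟩
  have hdis : ∀ z ∈ closure V, z ∉ J (j+1) := fun z hz hzJ => hmin (j+1) (by omega) ⟨z, hzJ, hz⟩
  have hξV : ξ ∉ V := fun hk => absurd (hVsub hk).2 (not_lt.mpr hξR.le)
  -- step 3
  obtain ⟨z0, hz0J, hz0cl, hz0V⟩ : ∃ z0 ∈ J (j+2), z0 ∈ closure V ∧ z0 ∉ V := by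
    by_contra! hcon
    obtain ⟨z, hz, hzV⟩ := hi
    exact hξV ((h.full (j+2)).pre.subset_of_closure_inter_subset hVo ⟨z, hz, hcon z hz hzV⟩
      (fun y hy => hcon y hy.2 hy.1) (h.full (j+2)).mem)
  have hz0U : z0 ∈ U := h.sub _ hz0J
  have hz0R : ‖z0‖ = R := by
    refine le_antisymm ?_ (hclR z0 hz0cl)
    by_contra hlt
    exact hz0V (closure_comp hop v hz0cl ⟨hE.UE hz0U, not_le.mp hlt⟩)
  have hz0ξ : z0 ≠ ξ := fun hk => by rw [hk] at hz0R; linarith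
  have hN0 : NN s t z0 ∈ J (j+1) := h.mono (Nat.le_succ j) (h.map j z0 hz0J)
  have hN0R : ‖NN s t z0‖ < R := hz0R ▸ hRN z0 hz0R.ge
  -- step 4
  set K := J (j+1) with hK
  have hKf : Fullc K ξ := h.full (j+1)
  have hane : ∀ a ∈ closure V, a ≠ 0 := fun a ha h0 => by
    have := hclR a ha
    rw [h0, norm_zero] at this
    linarith [norm_nonneg ξ]
  have e1 : ∀ a ∈ closure V, Lam K ξ a (NN s t z0) = Complex.log (1 - NN s t z0 / a) - Complex.log (1 - ξ / a) := by
    have hnb : ¬ Bornology.IsBounded V := hub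
    obtain ⟨R', hR'0, hR'⟩ := exists_big hKf.cpt
    obtain ⟨a, haV, haR⟩ : ∃ a ∈ V, R' ≤ ‖a‖ := by
      by_contra! hcon
      exact hnb ((isBounded_ball (x := (0:ℂ)) (r := R')).subset fun a ha => by
        rw [mem_ball_zero_iff]; exact hcon a ha)
    refine log_unique hVp.closure ?_ ?_ ?_ (subset_closure haV) (hKf.lam_big (hR' a haR) _ hN0)
    · exact ContinuousOn.comp (f := fun a => (NN s t z0, a)) hKf.lam_cont (by fun_prop) fun a ha => ⟨hN0, hdis a ha⟩
    · refine ContinuousOn.sub (ContinuousOn.clog ?_ ?_) (ContinuousOn.clog ?_ ?_)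
      · exact continuousOn_const.sub (continuousOn_const.div continuousOn_id hane)
      · exact fun a ha => one_sub_slit (hN0R.trans_le (hclR a ha))
      · exact continuousOn_const.sub (continuousOn_const.div continuousOn_id hane)
      · exact fun a ha => one_sub_slit (hξR.trans_le (hclR a ha))
    · intro a ha
      rw [(hKf.lam (hdis a ha)).eq _ hN0]
      have := (LogOn.big (K := {NN s t z0, ξ}) (ξ := ξ) (a := a) (by simp) (by
        intro u hu
        rcases hu with rfl | hu
        · exact hN0R.trans_le (hclR a ha)
        · rw [mem_singleton_iff.mp hu]; exact hξR.trans_le (hclR a ha))).eq (NN s t z0) (by simp)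
      exact this.symm
  have e2 : L z0 = Complex.log (qq s1 t m z0) := by
    have h1 := hLl z0 ⟨hz0U, hz0ξ⟩
    rw [hl j z0 hz0U (hdis z0 hz0cl) hN0, e1 z0 hz0cl] at h1
    have h0 : 0 < ‖z0‖ := norm_pos_iff.mpr (hane z0 hz0cl)
    have a1 := arg_small (u := NN s t z0 / z0) (by rw [norm_div, div_lt_one h0, hz0R]; exact hN0R)
    have a2 := arg_small (u := ξ / z0) (by rw [norm_div, div_lt_one h0, hz0R]; exact hξR)
    have him : (L z0).im = (1 - NN s t z0 / z0).arg - (1 - ξ / z0).arg := by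
      rw [h1]; simp [Complex.log_im]
    rw [abs_lt] at a1 a2
    rw [← hLe z0 (hE.UE hz0U), Complex.log_exp]
    · rw [him]; linarith
    · rw [him]; linarith
  -- step 5
  have hp : IsPreconnected (insert z0 V) := hVp.subset_closure (subset_insert _ _)
    (insert_subset hz0cl subset_closure)
  have hinE : ∀ z ∈ insert z0 V, z ∈ Eᶜ ∧ R ≤ ‖z‖ := by
    rintro z (rfl | hz)
    · exact ⟨hE.UE hz0U, hz0R.ge⟩
    · exact ⟨(hVsub hz).1, le_of_lt (show R < ‖z‖ from (hVsub hz).2)⟩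
  have hfin := log_unique hp (f := L) (g := fun z => Complex.log (qq s1 t m z))
    (hLc.mono fun z hz => (hinE z hz).1) (by
      refine ContinuousOn.clog ?_ fun z hz => slit_of (hRq z (hinE z hz).2)
      exact ContinuousOn.div (by fun_prop) (by fun_prop) fun z hz => hRt z (hinE z hz).2) (by
      intro z hz
      rw [hLe z (hinE z hz).1, Complex.exp_log (slitPlane_ne_zero (slit_of (hRq z (hinE z hz).2)))])
    (mem_insert _ _) e2
  exact fun z hz => hfin z (mem_insert_of_mem _ hz)

end NW
end

section
open Complex Set Filter Topology Metric

namespace NW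

lemma log_lift {X : Set ℂ} (hX : Convex ℝ X) (hne : X.Nonempty) (ho : IsOpen X) {g : ℂ → ℂ} (hg : ContinuousOn g X)
    (h0 : ∀ z ∈ X, g z ≠ 0) : ∃ f, ContinuousOn f X ∧ ∀ z ∈ X, Complex.exp (f z) = g z := by
  have hs : IsSimplyConnected X := by
    have := hX.contractibleSpace hne
    exact (inferInstance : SimplyConnectedSpace X)
  obtain ⟨f, hf, hfe⟩ := Complex.exists_continuousOn_eqOn_exp_comp hs ho hg (by
    rintro ⟨z, hz, h⟩; exact h0 z hz h)
  exact ⟨f, hf, fun z hz => hfe hz⟩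

/-- the cut-off profile -/
noncomputable def cut (x : ℝ) : ℝ := max 0 (min 1 (3 * x - 1))

lemma cut_cont : Continuous cut := by unfold cut; fun_prop
lemma cut_one {x : ℝ} (h : 2/3 ≤ x) : cut x = 1 := by
  unfold cut; rw [min_eq_left (by linarith), max_eq_right (by norm_num)]
lemma cut_zero {x : ℝ} (h : x ≤ 1/3) : cut x = 0 := by
  unfold cut; rw [min_eq_right (by linarith), max_eq_left (by linarith)]

structure Fin' (A B : Set ℂ) (a b c d : Polynomial ℂ) (k : ℂ) (q L : ℂ → ℂ) (R : ℝ) : Prop where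
  clA : IsClosed A
  clB : IsClosed B
  dis : Disjoint A B
  k0 : k ≠ 0
  a0 : ∀ z, a.eval z = 0 → z ∈ A
  c0 : ∀ z, c.eval z = 0 → z ∈ A
  b0 : ∀ z, b.eval z = 0 → z ∈ B
  d0 : ∀ z, d.eval z = 0 → z ∈ B
  hq : ∀ z, q z = k * (a.eval z * b.eval z) / (c.eval z * d.eval z)
  Lc : ContinuousOn L (A ∪ B)ᶜ
  Le : ∀ z ∈ (A ∪ B)ᶜ, Complex.exp (L z) = q z
  R0 : 0 < R
  qR : ∀ z : ℂ, R ≤ ‖z‖ → ‖q z - 1‖ < 1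
  cR : ∀ z : ℂ, R ≤ ‖z‖ → ‖c.eval z / z ^ c.natDegree - 1‖ < 1
  aR : ∀ z : ℂ, R ≤ ‖z‖ → ‖a.eval z / z ^ a.natDegree - 1‖ < 1
  key : ∀ v ∈ (A ∪ B)ᶜ ∩ {z : ℂ | R < ‖z‖}, ¬ Bornology.IsBounded (connectedComponentIn ((A ∪ B)ᶜ ∩ {z | R < ‖z‖}) v) →
    L v = Complex.log (q v)

variable {A B : Set ℂ} {a b c d : Polynomial ℂ} {k : ℂ} {q L : ℂ → ℂ} {R : ℝ}

lemma Fin'.qc (h : Fin' A B a b c d k q L R) : ∀ z : ℂ, R ≤ ‖z‖ → a.eval z ≠ 0 ∧ b.eval z ≠ 0 ∧ c.eval z ≠ 0 ∧ d.eval z ≠ 0 := by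
  intro z hz
  have h1 : q z ≠ 0 := slitPlane_ne_zero (slit_of (h.qR z hz))
  rw [h.hq] at h1
  simp only [ne_eq, div_eq_zero_iff, mul_eq_zero, not_or] at h1
  tauto

lemma Fin'.qcont (h : Fin' A B a b c d k q L R) {z : ℂ} (hz : R ≤ ‖z‖) : ContinuousAt q z := by
  have : q = fun z => k * (a.eval z * b.eval z) / (c.eval z * d.eval z) := funext h.hq
  rw [this]
  obtain ⟨_, _, h3, h4⟩ := h.qc z hz
  exact ContinuousAt.div (by fun_prop) (by fun_prop) (mul_ne_zero h3 h4)

lemma Fin'.logq (h : Fin' A B a b c d k q L R) {z : ℂ} (hz : R ≤ ‖z‖) : ContinuousAt (fun z => Complex.log (q z)) z :=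
  (h.qcont hz).clog (slit_of (h.qR z hz))

/-- existence of the separating function -/
lemma Fin'.chi (h : Fin' A B a b c d k q L R) : ∃ χ : ℂ → ℝ, Continuous χ ∧ (∀ z ∈ A, χ z = 1) ∧ ∀ z ∈ B, χ z = 0 := by
  obtain ⟨f, h0, h1, _⟩ := exists_continuous_zero_one_of_isClosed h.clB h.clA h.dis.symm
  exact ⟨f, f.continuous, fun z hz => h1 hz, fun z hz => h0 hz⟩

lemma Fin'.exH (h : Fin' A B a b c d k q L R) {χ : ℂ → ℝ} (hχ : Continuous χ) (hA : ∀ z ∈ A, χ z = 1) (hB : ∀ z ∈ B, χ z = 0) :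
    ∃ H : ℂ → ℂ, Continuous H ∧ (∀ z, 2/3 < χ z → Complex.exp (H z) = k * b.eval z / d.eval z) ∧
      (∀ z, χ z < 1/3 → Complex.exp (H z) = c.eval z / a.eval z) ∧
      ∀ z ∈ (A ∪ B)ᶜ, Complex.exp (H z) = Complex.exp (cut (χ z) * L z) * (c.eval z / a.eval z) := by
  classical
  let g : ℂ → ℂ := fun z => if 2/3 < χ z then k * b.eval z / d.eval z else if χ z < 1/3 then c.eval z / a.eval z
    else Complex.exp (cut (χ z) * L z) * (c.eval z / a.eval z)
  have g1 : ∀ z, 2/3 < χ z → g z = k * b.eval z / d.eval z := fun z hz => if_pos hz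
  have g2 : ∀ z, χ z < 1/3 → g z = c.eval z / a.eval z := fun z hz => by
    have : ¬ 2/3 < χ z := by linarith
    simp only [g, if_neg this, if_pos hz]
  have nz : ∀ z ∈ (A ∪ B)ᶜ, a.eval z ≠ 0 ∧ b.eval z ≠ 0 ∧ c.eval z ≠ 0 ∧ d.eval z ≠ 0 := fun z hz =>
    ⟨fun h' => hz (Or.inl (h.a0 z h')), fun h' => hz (Or.inr (h.b0 z h')), fun h' => hz (Or.inl (h.c0 z h')),
      fun h' => hz (Or.inr (h.d0 z h'))⟩
  have g3 : ∀ z ∈ (A ∪ B)ᶜ, g z = Complex.exp (cut (χ z) * L z) * (c.eval z / a.eval z) := by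
    intro z hz
    by_cases h1 : 2/3 < χ z
    · rw [g1 z h1, cut_one h1.le, ofReal_one, one_mul, h.Le z hz, h.hq]
      obtain ⟨h2, h3, h4, h5⟩ := nz z hz
      field_simp
    · by_cases h2 : χ z < 1/3
      · rw [g2 z h2, cut_zero h2.le]; simp
      · simp only [g, if_neg h1, if_neg h2]
  have hnA : ∀ z, χ z < 1 → z ∉ A := fun z hz hzA => by linarith [hA z hzA]
  have hnB : ∀ z, 0 < χ z → z ∉ B := fun z hz hzB => by linarith [hB z hzB]
  have g0 : ∀ z ∈ (univ : Set ℂ), g z ≠ 0 := by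
    intro z _
    by_cases h1 : 2/3 < χ z
    · rw [g1 z h1]
      have hzB := hnB z (by linarith)
      exact div_ne_zero (mul_ne_zero h.k0 fun h' => hzB (h.b0 z h')) fun h' => hzB (h.d0 z h')
    · have hzA := hnA z (by linarith)
      have h3 : c.eval z / a.eval z ≠ 0 := div_ne_zero (fun h' => hzA (h.c0 z h')) fun h' => hzA (h.a0 z h')
      by_cases h2 : χ z < 1/3
      · rw [g2 z h2]; exact h3
      · simp only [g, if_neg h1, if_neg h2]
        exact mul_ne_zero (Complex.exp_ne_zero _) h3
  have gc : Continuous g := by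
    rw [continuous_iff_continuousAt]
    intro z
    by_cases hzA : z ∈ A
    · have e : ∀ᶠ y in 𝓝 z, 2/3 < χ y := hχ.continuousAt.eventually (lt_mem_nhds (by rw [hA z hzA]; norm_num))
      have hc : ContinuousAt (fun z => k * b.eval z / d.eval z) z :=
        ContinuousAt.div (by fun_prop) (by fun_prop) fun h' => hnB z (by rw [hA z hzA]; norm_num) (h.d0 z h')
      exact hc.congr (e.mono fun y hy => (g1 y hy).symm)
    · by_cases hzB : z ∈ B
      · have e : ∀ᶠ y in 𝓝 z, χ y < 1/3 := hχ.continuousAt.eventually (gt_mem_nhds (by rw [hB z hzB]; norm_num))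
        have hc : ContinuousAt (fun z => c.eval z / a.eval z) z :=
          ContinuousAt.div (by fun_prop) (by fun_prop) fun h' => hzA (h.a0 z h')
        exact hc.congr (e.mono fun y hy => (g2 y hy).symm)
      · have hz : z ∈ (A ∪ B)ᶜ := by simp [hzA, hzB]
        have hm := (h.clA.union h.clB).isOpen_compl.mem_nhds hz
        have hL : ContinuousAt L z := h.Lc.continuousAt hm
        have hcut : Continuous fun z => ((cut (χ z) : ℝ) : ℂ) := continuous_ofReal.comp (cut_cont.comp hχ)
        have hc : ContinuousAt (fun z => Complex.exp (cut (χ z) * L z) * (c.eval z / a.eval z)) z :=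
          ((hcut.continuousAt.mul hL).cexp).mul
            (ContinuousAt.div (by fun_prop) (by fun_prop) fun h' => hzA (h.a0 z h'))
        exact hc.congr (by filter_upwards [hm] with y hy using (g3 y hy).symm)
  obtain ⟨H, hHc, hHe⟩ := log_lift convex_univ univ_nonempty isOpen_univ gc.continuousOn g0
  refine ⟨H, continuousOn_univ.mp hHc, ?_, ?_, ?_⟩
  · intro z hz; rw [hHe z trivial, g1 z hz]
  · intro z hz; rw [hHe z trivial, g2 z hz]
  · intro z hz; rw [hHe z trivial, g3 z hz]

lemma Fin'.exT (h : Fin' A B a b c d k q L R) {χ : ℂ → ℝ} (hχ : Continuous χ) (hA : ∀ z ∈ A, χ z = 1) (hB : ∀ z ∈ B, χ z = 0)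
    {R1 : ℝ} (hR1 : R < R1) :
    ∃ T : ℂ → ℂ, ContinuousOn T {z | R < ‖z‖} ∧ (∃ R2 : ℝ, ∀ z : ℂ, R2 < ‖z‖ → T z = 1) ∧ (∀ z, T z ≠ 0) ∧
      (∀ z, R < ‖z‖ → 2/3 < χ z → T z = 1) ∧ (∀ z, R < ‖z‖ → χ z < 1/3 → T z = 1) ∧
      ∀ z ∈ (A ∪ B)ᶜ, ‖z‖ = R1 → 1/3 ≤ χ z → χ z ≤ 2/3 →
        T z * Complex.exp (cut (χ z) * Complex.log (q z)) = Complex.exp (cut (χ z) * L z) := by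
  classical
  set Y : Set ℂ := (A ∪ B)ᶜ ∩ {z | R < ‖z‖} with hY
  have hYo : IsOpen Y := (h.clA.union h.clB).isOpen_compl.inter (isOpen_lt continuous_const continuous_norm)
  set C : Set ℂ := {z | ‖z‖ = R1 ∧ 1/3 ≤ χ z ∧ χ z ≤ 2/3} with hC
  have hCc : IsCompact C := by
    refine (isCompact_closedBall (0:ℂ) R1).of_isClosed_subset ?_ ?_
    · exact (isClosed_eq continuous_norm continuous_const).inter
        ((isClosed_le continuous_const hχ).inter (isClosed_le hχ continuous_const))
    · intro z hz; rw [mem_closedBall_zero_iff]; exact hz.1.le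
  have hCY : C ⊆ Y := by
    rintro z ⟨h1, h2, h3⟩
    refine ⟨?_, show R < ‖z‖ by rw [h1]; exact hR1⟩
    rintro (hz | hz)
    · linarith [hA z hz]
    · linarith [hB z hz]
  let O : Set ℂ := {z | z ∈ Y ∧ (∃ x ∈ C, x ∈ connectedComponentIn Y z) ∧ Bornology.IsBounded (connectedComponentIn Y z)}
  have hOcomp : ∀ z ∈ Y, ∀ y ∈ connectedComponentIn Y z, (y ∈ O ↔ z ∈ O) := by
    intro z hz y hy
    have hyY := connectedComponentIn_subset _ _ hy
    simp only [O, mem_ofPred_eq, ← connectedComponentIn_eq hy, hz, hyY]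
  have hOb : Bornology.IsBounded O := by
    obtain ⟨T, hTC, hT⟩ := hCc.elim_nhds_subcover (fun x => connectedComponentIn Y x)
      (fun x hx => hYo.connectedComponentIn.mem_nhds (mem_connectedComponentIn (hCY hx)))
    have hb : Bornology.IsBounded (⋃ x ∈ T.filter (fun x => Bornology.IsBounded (connectedComponentIn Y x)), connectedComponentIn Y x) := by
      rw [Bornology.isBounded_biUnion_finset]
      intro x hx
      exact (Finset.mem_filter.mp hx).2
    refine hb.subset ?_
    rintro z ⟨hzY, ⟨x, hxC, hxz⟩, hzb⟩
    obtain ⟨y, hyT, hxy⟩ := mem_iUnion₂.mp (hT hxC)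
    have e : connectedComponentIn Y y = connectedComponentIn Y z := by
      rw [connectedComponentIn_eq hxy, connectedComponentIn_eq hxz]
    refine mem_iUnion₂.mpr ⟨y, ?_, ?_⟩
    · rw [Finset.mem_filter]; exact ⟨hyT, by rw [e]; exact hzb⟩
    · rw [e]; exact mem_connectedComponentIn hzY
  let T : ℂ → ℂ := fun z => if z ∈ O then Complex.exp (cut (χ z) * (L z - Complex.log (q z))) else 1
  have T1 : ∀ z ∈ O, T z = Complex.exp (cut (χ z) * (L z - Complex.log (q z))) := fun z hz => if_pos hz
  have T0 : ∀ z ∉ O, T z = 1 := fun z hz => if_neg hz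
  have hexp1 : ∀ z ∈ Y, Complex.exp (L z - Complex.log (q z)) = 1 := by
    intro z hz
    have hq0 : q z ≠ 0 := slitPlane_ne_zero (slit_of (h.qR z (le_of_lt (show R < ‖z‖ from hz.2))))
    rw [Complex.exp_sub, h.Le z hz.1, Complex.exp_log hq0, div_self hq0]
  have Ta : ∀ z, 2/3 < χ z → T z = 1 := by
    intro z hz
    by_cases hO : z ∈ O
    · rw [T1 z hO, cut_one hz.le, ofReal_one, one_mul, hexp1 z hO.1]
    · exact T0 z hO
  have Tb : ∀ z, χ z < 1/3 → T z = 1 := by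
    intro z hz
    by_cases hO : z ∈ O
    · rw [T1 z hO, cut_zero hz.le]; simp
    · exact T0 z hO
  refine ⟨T, ?_, ?_, ?_, fun z _ => Ta z, fun z _ => Tb z, ?_⟩
  · intro z hz
    apply ContinuousAt.continuousWithinAt
    by_cases hzA : z ∈ A
    · have e : ∀ᶠ y in 𝓝 z, 2/3 < χ y := hχ.continuousAt.eventually (lt_mem_nhds (by rw [hA z hzA]; norm_num))
      exact continuousAt_const.congr (e.mono fun y hy => (Ta y hy).symm)
    · by_cases hzB : z ∈ B
      · have e : ∀ᶠ y in 𝓝 z, χ y < 1/3 := hχ.continuousAt.eventually (gt_mem_nhds (by rw [hB z hzB]; norm_num))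
        exact continuousAt_const.congr (e.mono fun y hy => (Tb y hy).symm)
      · have hz' : z ∈ (A ∪ B)ᶜ := by simp [hzA, hzB]
        have hzY : z ∈ Y := ⟨hz', hz⟩
        have hnb : connectedComponentIn Y z ∈ 𝓝 z := hYo.connectedComponentIn.mem_nhds (mem_connectedComponentIn hzY)
        by_cases hO : z ∈ O
        · have hL : ContinuousAt L z := h.Lc.continuousAt ((h.clA.union h.clB).isOpen_compl.mem_nhds hz')
          have hcut : Continuous fun z => ((cut (χ z) : ℝ) : ℂ) := continuous_ofReal.comp (cut_cont.comp hχ)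
          have hc : ContinuousAt (fun z => Complex.exp (cut (χ z) * (L z - Complex.log (q z)))) z :=
            (hcut.continuousAt.mul (hL.sub (h.logq (le_of_lt (show R < ‖z‖ from hz))))).cexp
          exact hc.congr (by filter_upwards [hnb] with y hy using (T1 y ((hOcomp z hzY y hy).mpr hO)).symm)
        · exact continuousAt_const.congr (by filter_upwards [hnb] with y hy using (T0 y (fun hk => hO ((hOcomp z hzY y hy).mp hk))).symm)
  · obtain ⟨R2, hR2⟩ := hOb.subset_closedBall 0
    refine ⟨R2, fun z hz => T0 z fun hO => ?_⟩
    have := hR2 hO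
    rw [mem_closedBall_zero_iff] at this
    linarith
  · intro z
    by_cases hO : z ∈ O
    · rw [T1 z hO]; exact Complex.exp_ne_zero _
    · rw [T0 z hO]; exact one_ne_zero
  · intro z hz h1 h2 h3
    have hzC : z ∈ C := ⟨h1, h2, h3⟩
    have hzY := hCY hzC
    by_cases hO : z ∈ O
    · rw [T1 z hO, ← Complex.exp_add]; congr 1; ring
    · have hub : ¬ Bornology.IsBounded (connectedComponentIn Y z) := fun hb =>
        hO ⟨hzY, ⟨z, hzC, mem_connectedComponentIn hzY⟩, hb⟩
      rw [T0 z hO, one_mul, h.key z hzY hub]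

lemma re_half_convex (r : ℝ) : Convex ℝ {w : ℂ | r < w.re} := convex_halfSpace_re_gt r

theorem Fin'.final (h : Fin' A B a b c d k q L R) : c.natDegree = a.natDegree := by
  obtain ⟨χ, hχ, hA, hB⟩ := h.chi
  obtain ⟨H, hHc, H1, H2, H3⟩ := h.exH hχ hA hB
  set R1 := R + 1 with hR1d
  have hR1 : R < R1 := by linarith
  have hR := h.R0
  obtain ⟨T, hTc, ⟨R2, hT2⟩, hT0, Ta, Tb, Tm⟩ := h.exT hχ hA hB hR1
  -- identity on the circle
  have hid : ∀ z : ℂ, ‖z‖ = R1 → Complex.exp (H z) =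
      T z * Complex.exp (cut (χ z) * Complex.log (q z)) * (c.eval z / a.eval z) := by
    intro z hz
    have hzR : R ≤ ‖z‖ := by linarith
    have hzR' : R < ‖z‖ := by linarith
    obtain ⟨n1, n2, n3, n4⟩ := h.qc z hzR
    have hq0 : q z ≠ 0 := slitPlane_ne_zero (slit_of (h.qR z hzR))
    by_cases h1 : 2/3 < χ z
    · rw [H1 z h1, Ta z hzR' h1, cut_one h1.le, ofReal_one, one_mul, one_mul, Complex.exp_log hq0, h.hq]
      field_simp
    · by_cases h2 : χ z < 1/3
      · rw [H2 z h2, Tb z hzR' h2, cut_zero h2.le]; simp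
      · have hzE : z ∈ (A ∪ B)ᶜ := by
          rintro (hz | hz)
          · linarith [hA z hz]
          · linarith [hB z hz]
        rw [H3 z hzE, Tm z hzE hz (by linarith) (by linarith)]
  -- the half plane
  set P : Set ℂ := {w : ℂ | Real.log R < w.re} with hP
  have hnorm : ∀ w : ℂ, ‖Complex.exp w‖ = Real.exp w.re := Complex.norm_exp
  have hPexp : ∀ w ∈ P, R < ‖Complex.exp w‖ := by
    intro w hw
    rw [hnorm, ← Real.log_lt_iff_lt_exp hR]; exact hw
  have hPo : IsOpen P := isOpen_lt continuous_const continuous_re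
  obtain ⟨f, hf, hfe⟩ := log_lift (re_half_convex (Real.log R)) ⟨((Real.log R + 1 : ℝ) : ℂ), by
      show Real.log R < (((Real.log R + 1 : ℝ) : ℂ)).re
      rw [ofReal_re]; linarith⟩ hPo
    (g := fun w => T (Complex.exp w)) (hTc.comp Complex.continuous_exp.continuousOn fun w hw => hPexp w hw)
    (fun w _ => hT0 _)
  have hper : ∀ w ∈ P, f (w + 2 * Real.pi * I) - f w = 0 := by
    have hPs : ∀ w ∈ P, w + 2 * Real.pi * I ∈ P := by
      intro w hw
      show Real.log R < (w + 2 * Real.pi * I).re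
      have : (w + 2 * Real.pi * I).re = w.re := by simp
      rw [this]; exact hw
    set R3 := max (Real.log R) (Real.log (max R2 1)) with hR3
    have hbig : ∀ w ∈ {w : ℂ | R3 < w.re}, T (Complex.exp w) = 1 := by
      intro w hw
      apply hT2
      have h1 : Real.log (max R2 1) < w.re := (le_max_right _ _).trans_lt hw
      rw [Real.log_lt_iff_lt_exp (by positivity)] at h1
      rw [hnorm]; exact (le_max_left _ _).trans_lt h1
    set w0 : ℂ := ((R3 + 1 : ℝ) : ℂ)
    have hw0 : w0 ∈ {w : ℂ | R3 < w.re} := by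
      show R3 < w0.re
      rw [ofReal_re]; linarith
    have hw1 : w0 + 2 * Real.pi * I ∈ {w : ℂ | R3 < w.re} := by
      show R3 < (w0 + 2 * Real.pi * I).re
      have : (w0 + 2 * Real.pi * I).re = w0.re := by simp
      rw [this]; exact hw0
    have hsub : {w : ℂ | R3 < w.re} ⊆ P := fun w hw => lt_of_le_of_lt (le_max_left _ _) (show R3 < w.re from hw)
    have hc1 := log_const (re_half_convex R3).isPreconnected (hf.mono hsub) (g := fun _ => 0) continuousOn_const
      (fun w hw => by rw [hfe w (hsub hw), hbig w hw]; simp) hw0 _ hw1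
    have hfs : ContinuousOn (fun w => f (w + 2 * Real.pi * I)) P := hf.comp (by fun_prop) hPs
    have hc2 := log_const (re_half_convex (Real.log R)).isPreconnected hfs hf
      (fun w hw => by
        rw [hfe _ (hPs w hw), hfe w hw, Complex.exp_add, Complex.exp_two_pi_mul_I, mul_one]) (hsub hw0)
    intro w hw
    rw [hc2 w hw]
    simpa [sub_eq_zero] using hc1
  -- the line
  have hR1p : 0 < R1 := by linarith
  let w : ℝ → ℂ := fun θ => Real.log R1 + θ * I
  have hwc : Continuous w := by fun_prop
  have hwP : ∀ θ, w θ ∈ P := by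
    intro θ
    show Real.log R < (w θ).re
    have : (w θ).re = Real.log R1 := by simp [w]
    rw [this]; exact Real.log_lt_log hR hR1
  have hwn : ∀ θ, ‖Complex.exp (w θ)‖ = R1 := by
    intro θ
    rw [hnorm]
    have : (w θ).re = Real.log R1 := by simp [w]
    rw [this, Real.exp_log hR1p]
  have hwR : ∀ θ, R ≤ ‖Complex.exp (w θ)‖ := fun θ => by rw [hwn]; linarith
  let Z : ℝ → ℂ := fun θ => Complex.exp (w θ)
  have hZc : Continuous Z := Complex.continuous_exp.comp hwc
  have hZ0 : ∀ θ, Z θ ≠ 0 := fun θ => Complex.exp_ne_zero _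
  let Φ : ℝ → ℂ := fun θ => H (Z θ) - cut (χ (Z θ)) * Complex.log (q (Z θ)) - f (w θ)
    - Complex.log (c.eval (Z θ) / Z θ ^ c.natDegree) + Complex.log (a.eval (Z θ) / Z θ ^ a.natDegree)
    - (c.natDegree * w θ - a.natDegree * w θ)
  have hΦc : Continuous Φ := by
    have i1 : Continuous fun θ => H (Z θ) := hHc.comp hZc
    have i2 : Continuous fun θ => (((cut (χ (Z θ)) : ℝ)) : ℂ) := continuous_ofReal.comp (cut_cont.comp (hχ.comp hZc))
    have i3 : Continuous fun θ => Complex.log (q (Z θ)) := continuous_iff_continuousAt.mpr fun θ =>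
      ContinuousAt.comp (f := Z) (g := fun z => Complex.log (q z)) (h.logq (hwR θ)) hZc.continuousAt
    have i4 : Continuous fun θ => f (w θ) := continuous_iff_continuousAt.mpr fun θ =>
      ContinuousAt.comp (f := w) (g := f) (hf.continuousAt (hPo.mem_nhds (hwP θ))) hwc.continuousAt
    have i5 : ∀ p : Polynomial ℂ, Continuous fun θ => p.eval (Z θ) / Z θ ^ p.natDegree := fun p =>
      (p.continuous.comp hZc).div (hZc.pow _) fun θ => pow_ne_zero _ (hZ0 θ)
    have i6 : Continuous fun θ => Complex.log (c.eval (Z θ) / Z θ ^ c.natDegree) :=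
      (i5 c).clog fun θ => slit_of (h.cR _ (hwR θ))
    have i7 : Continuous fun θ => Complex.log (a.eval (Z θ) / Z θ ^ a.natDegree) :=
      (i5 a).clog fun θ => slit_of (h.aR _ (hwR θ))
    exact ((((i1.sub (i2.mul i3)).sub i4).sub i6).add i7).sub ((continuous_const.mul hwc).sub (continuous_const.mul hwc))
  have hΦe : ∀ θ, Complex.exp (Φ θ) = 1 := by
    intro θ
    obtain ⟨n1, n2, n3, n4⟩ := h.qc (Z θ) (hwR θ)
    have hz := hZ0 θ
    have e1 : Complex.exp (f (w θ)) = T (Z θ) := hfe _ (hwP θ)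
    have e2 : ∀ n : ℕ, Complex.exp (n * w θ) = Z θ ^ n := fun n => Complex.exp_nat_mul _ _
    show Complex.exp (H (Z θ) - cut (χ (Z θ)) * Complex.log (q (Z θ)) - f (w θ)
      - Complex.log (c.eval (Z θ) / Z θ ^ c.natDegree) + Complex.log (a.eval (Z θ) / Z θ ^ a.natDegree)
      - (c.natDegree * w θ - a.natDegree * w θ)) = 1
    have l1 := Complex.exp_log (slitPlane_ne_zero (slit_of (h.cR (Z θ) (hwR θ))))
    have l2 := Complex.exp_log (slitPlane_ne_zero (slit_of (h.aR (Z θ) (hwR θ))))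
    rw [Complex.exp_sub, Complex.exp_add, Complex.exp_sub, Complex.exp_sub, Complex.exp_sub, hid (Z θ) (hwn θ), e1,
      Complex.exp_sub, e2, e2, l1, l2]
    have := hT0 (Z θ)
    have h5 := Complex.exp_ne_zero (cut (χ (Z θ)) * Complex.log (q (Z θ)))
    generalize Complex.exp (cut (χ (Z θ)) * Complex.log (q (Z θ))) = y at h5 ⊢
    clear_value Z
    field_simp
  have hfin := log_const (isPreconnected_univ (α := ℝ)) hΦc.continuousOn (g := fun _ => 0) continuousOn_const
    (fun θ _ => by rw [hΦe]; simp) (mem_univ 0) (2 * Real.pi) (mem_univ _)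
  have hw2 : w (2 * Real.pi) = w 0 + 2 * Real.pi * I := by simp [w]
  have hZ2 : Z (2 * Real.pi) = Z 0 := by
    simp only [Z]; rw [hw2, Complex.exp_add, Complex.exp_two_pi_mul_I, mul_one]
  have hf2 : f (w (2 * Real.pi)) = f (w 0) := by
    rw [hw2]; exact sub_eq_zero.mp (hper _ (hwP 0))
  simp only [Φ, sub_zero] at hfin
  rw [hZ2, hf2, hw2] at hfin
  have hpi : (2 * Real.pi * I : ℂ) ≠ 0 := Complex.two_pi_I_ne_zero
  have : ((c.natDegree : ℂ) - a.natDegree) * (2 * Real.pi * I) = 0 := by linear_combination -hfin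
  rcases mul_eq_zero.mp this with h1 | h1
  · have := sub_eq_zero.mp h1
    exact_mod_cast this
  · exact absurd h1 hpi

end NW
end

section
open Complex Set Filter Topology Metric

namespace NW
variable {s t s1 : Polynomial ℂ} {m : ℕ} {ξ : ℂ} {ε : ℝ} {U : Set ℂ} {J : ℕ → Set ℂ}

open Classical in
/-- product over the roots in `W` -/
noncomputable def pr (p : Polynomial ℂ) (W : Set ℂ) : Polynomial ℂ :=
  ((p.roots.filter (fun z => z ∈ W)).map fun r => Polynomial.X - Polynomial.C r).prod

lemma pr_monic (p : Polynomial ℂ) (W : Set ℂ) : (pr p W).Monic :=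
  Polynomial.monic_multiset_prod_of_monic _ _ fun r _ => Polynomial.monic_X_sub_C r

open Classical in
lemma pr_deg (p : Polynomial ℂ) (W : Set ℂ) : (pr p W).natDegree = (p.roots.filter (fun z => z ∈ W)).card := by
  rw [pr, Polynomial.natDegree_multiset_prod_X_sub_C_eq_card]

open Classical in
lemma pr_zero {p : Polynomial ℂ} {W : Set ℂ} {z : ℂ} (hz : (pr p W).eval z = 0) : z ∈ W ∧ z ∈ p.roots := by
  have h1 : z ∈ (pr p W).roots := (Polynomial.mem_roots (pr_monic p W).ne_zero).mpr hz
  rw [pr, Polynomial.roots_multiset_prod_X_sub_C, Multiset.mem_filter] at h1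
  exact ⟨h1.2, h1.1⟩

open Classical in
lemma pr_mul (p : Polynomial ℂ) (W : Set ℂ) : p = Polynomial.C p.leadingCoeff * (pr p W * pr p Wᶜ) := by
  have h1 := (IsAlgClosed.splits p).eq_prod_roots
  have h2 : pr p W * pr p Wᶜ = (p.roots.map fun r => Polynomial.X - Polynomial.C r).prod := by
    unfold pr
    rw [← Multiset.prod_add, ← Multiset.map_add]
    congr 2
    convert Multiset.filter_add_not (fun z => z ∈ W) p.roots
  rw [h2]; exact h1

lemma sat_of {x : ℂ} (hx : x ∈ Uᶜ) (hU : IsOpen U) {S : Set ℂ} (hS : S.Finite) (hSU : S ⊆ Uᶜ) :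
    Sat U (connectedComponentIn Uᶜ x ∪ ⋃ z ∈ S, connectedComponentIn Uᶜ z) := by
  refine ⟨?_, ?_, ?_⟩
  · exact (isClosed_connectedComponentIn' hU.isClosed_compl x).union
      (hS.isClosed_biUnion fun z _ => isClosed_connectedComponentIn' hU.isClosed_compl z)
  · exact union_subset (connectedComponentIn_subset _ _) (iUnion₂_subset fun z _ => connectedComponentIn_subset _ _)
  · rintro z (hz | hz)
    · rw [← connectedComponentIn_eq hz]; exact subset_union_left
    · obtain ⟨y, hy, hz⟩ := mem_iUnion₂.mp hz
      rw [← connectedComponentIn_eq hz]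
      exact (subset_biUnion_of_mem (u := fun z => connectedComponentIn Uᶜ z) hy).trans subset_union_right

lemma NS.evN (h : NS s t m) : ∀ᶠ z in Bornology.cobounded ℂ, ‖NN s t z‖ < ‖z‖ := by
  have h1 := (h.ratio 0).eventually (ball_mem_nhds 1 one_pos)
  filter_upwards [h1, poly_ne_cobounded (Polynomial.X_ne_zero (R := ℂ)), poly_ne_cobounded h.t0] with z hz hz0 ht
  rw [Polynomial.eval_X] at hz0
  rw [dist_eq_norm, sub_zero z] at hz
  have hm : (0:ℝ) < m := by have := h.two; positivity
  have hm1 : (1:ℝ) ≤ m := by have := h.two; exact_mod_cast (by omega)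
  have hm0 : (m:ℂ) ≠ 0 := h.m0
  have e : NN s t z = z * (((m:ℂ) - 1) / m - (m * (s.eval z / (z * t.eval z)) - 1) / m) := by
    rw [NN]; field_simp; ring
  rw [e, norm_mul]
  have hz' : 0 < ‖z‖ := norm_pos_iff.mpr hz0
  have h2 : ‖((m:ℂ) - 1) / m - (m * (s.eval z / (z * t.eval z)) - 1) / m‖ < 1 := by
    refine (norm_sub_le _ _).trans_lt ?_
    rw [norm_div, norm_div, Complex.norm_natCast]
    have : ‖(m:ℂ) - 1‖ = m - 1 := by
      have : (m:ℂ) - 1 = ((m - 1 : ℝ) : ℂ) := by push_cast; ring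
      rw [this, Complex.norm_real, Real.norm_of_nonneg (by linarith)]
    rw [this, ← add_div, div_lt_one hm]
    linarith
  nlinarith

lemma monic_ev {p : Polynomial ℂ} (hp : p.Monic) :
    ∀ᶠ z in Bornology.cobounded ℂ, ‖p.eval z / z ^ p.natDegree - 1‖ < 1 := by
  have h1 := (poly_div_pow_tendsto p)
  rw [hp.leadingCoeff] at h1
  filter_upwards [h1.eventually (ball_mem_nhds 1 one_pos)] with z hz
  rwa [dist_eq_norm] at hz

open Classical in
theorem main_count (hn : NS s t m) (hξ : s.eval ξ = 0)
    (hs1 : s = (Polynomial.X - Polynomial.C ξ) * s1) {x : ℂ} (hx : x ∈ (basinU s t ξ)ᶜ) :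
    (s1.roots.filter (fun z => z ∈ connectedComponentIn (basinU s t ξ)ᶜ x)).card =
    (t.roots.filter (fun z => z ∈ connectedComponentIn (basinU s t ξ)ᶜ x)).card := by
  obtain ⟨ε, c0, hg⟩ := hn.good hξ
  obtain ⟨J, h⟩ := hg.chain
  set U := basinU s t ξ with hU
  set W := connectedComponentIn Uᶜ x with hW
  have hsm := hn.monic
  have hs1m : s1.Monic := by
    rw [hs1] at hsm
    exact (Polynomial.monic_X_sub_C ξ).of_mul_monic_left hsm
  have ht0 := hn.t0
  have hm : (m:ℂ) ≠ 0 := hn.m0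
  set S : Set ℂ := {z | (z ∈ s1.roots ∨ z ∈ t.roots) ∧ z ∉ W} with hS
  have hSf : S.Finite := by
    refine ((s1.roots.toFinset ∪ t.roots.toFinset).finite_toSet).subset ?_
    rintro z ⟨hz, _⟩
    simpa using hz
  have hs1U : ∀ z, s1.eval z = 0 → z ∈ Uᶜ := by
    intro z hz hzU
    have h1 := h.fix hzU (by rw [hs1, Polynomial.eval_mul, hz, mul_zero])
    exact hn.s1_ne hξ hs1 (h1 ▸ hz)
  have htU : ∀ z, t.eval z = 0 → z ∈ Uᶜ := fun z hz hzU => h.nt z hzU hz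
  have hrU : ∀ z, (z ∈ s1.roots ∨ z ∈ t.roots) → z ∈ Uᶜ := by
    rintro z (hz | hz)
    · exact hs1U z (Polynomial.isRoot_of_mem_roots hz)
    · exact htU z (Polynomial.isRoot_of_mem_roots hz)
  have hSU : S ⊆ Uᶜ := fun z hz => hrU z hz.1
  set B : Set ℂ := ⋃ z ∈ S, connectedComponentIn Uᶜ z with hB
  have hE : Sat U (W ∪ B) := sat_of hx h.open hSf hSU
  have hSB : ∀ z, (z ∈ s1.roots ∨ z ∈ t.roots) → z ∉ W → z ∈ B := fun z hz hzW =>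
    mem_iUnion₂.mpr ⟨z, ⟨hz, hzW⟩, mem_connectedComponentIn (hrU z hz)⟩
  have hEr : ∀ z, (z ∈ s1.roots ∨ z ∈ t.roots) → z ∈ W ∪ B := fun z hz => by
    by_cases hzW : z ∈ W
    · exact Or.inl hzW
    · exact Or.inr (hSB z hz hzW)
  have hms : ∀ z, s1.eval z = 0 → z ∈ s1.roots := fun z hz => (Polynomial.mem_roots hs1m.ne_zero).mpr hz
  have hmt : ∀ z, t.eval z = 0 → z ∈ t.roots := fun z hz => (Polynomial.mem_roots ht0).mpr hz
  obtain ⟨l, hlc, hle, hll⟩ := h.ell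
  obtain ⟨L, hLc, hLe, hLl⟩ := exists_L h hn hξ hs1 hE (fun z hz => hEr z (Or.inl (hms z hz)))
    (fun z hz => hEr z (Or.inr (hmt z hz))) hlc hle
  -- the radius
  have hev : ∀ᶠ z in Bornology.cobounded ℂ, t.eval z ≠ 0 ∧ ‖qq s1 t m z - 1‖ < 1 ∧ ‖NN s t z‖ < ‖z‖ ∧
      ‖(pr t W).eval z / z ^ (pr t W).natDegree - 1‖ < 1 ∧ ‖(pr s1 W).eval z / z ^ (pr s1 W).natDegree - 1‖ < 1 ∧
      z ∉ J 1 := by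
    filter_upwards [poly_ne_cobounded ht0, (hn.ratio ξ).eventually (ball_mem_nhds 1 one_pos), hn.evN,
      monic_ev (pr_monic t W), monic_ev (pr_monic s1 W), poly_ne_cobounded (Polynomial.X_sub_C_ne_zero ξ),
      Bornology.isBounded_def.mp (h.full 1).cpt.isBounded] with z h1 h2 h3 h4 h5 h6 h7
    refine ⟨h1, ?_, h3, h4, h5, h7⟩
    rw [dist_eq_norm] at h2
    have e : qq s1 t m z = m * (s.eval z / ((z - ξ) * t.eval z)) := by
      rw [qq, hs1]
      simp only [Polynomial.eval_mul, Polynomial.eval_sub, Polynomial.eval_X, Polynomial.eval_C] at h6 ⊢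
      field_simp
    rw [e]; exact h2
  obtain ⟨R', hR'⟩ : ∃ R : ℝ, ∀ z : ℂ, R ≤ ‖z‖ → t.eval z ≠ 0 ∧ ‖qq s1 t m z - 1‖ < 1 ∧ ‖NN s t z‖ < ‖z‖ ∧
      ‖(pr t W).eval z / z ^ (pr t W).natDegree - 1‖ < 1 ∧ ‖(pr s1 W).eval z / z ^ (pr s1 W).natDegree - 1‖ < 1 ∧
      z ∉ J 1 := by
    obtain ⟨R, _, hR⟩ := (Filter.hasBasis_cobounded_norm (E := ℂ)).mem_iff.mp hev
    exact ⟨R, fun z hz => hR hz⟩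
  set R := max R' 1 with hRd
  have hR : ∀ z : ℂ, R ≤ ‖z‖ → _ := fun z hz => hR' z ((le_max_left _ _).trans hz)
  have hRp : 0 < R := lt_of_lt_of_le one_pos (le_max_right _ _)
  have hfin : Fin' W B (pr s1 W) (pr s1 Wᶜ) (pr t W) (pr t Wᶜ) 1 (qq s1 t m) L R := by
    refine ⟨isClosed_connectedComponentIn' h.open.isClosed_compl x,
      hSf.isClosed_biUnion fun z _ => isClosed_connectedComponentIn' h.open.isClosed_compl z, ?_, one_ne_zero,
      fun z hz => (pr_zero hz).1, fun z hz => (pr_zero hz).1, fun z hz => hSB z (Or.inl (pr_zero hz).2) (pr_zero hz).1,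
      fun z hz => hSB z (Or.inr (pr_zero hz).2) (pr_zero hz).1, ?_, hLc, hLe, hRp, fun z hz => (hR z hz).2.1,
      fun z hz => (hR z hz).2.2.2.1, fun z hz => (hR z hz).2.2.2.2.1, ?_⟩
    · rw [disjoint_left]
      intro y hyW hyB
      obtain ⟨z, hz, hy⟩ := mem_iUnion₂.mp hyB
      apply hz.2
      rw [hW, connectedComponentIn_eq hyW, ← connectedComponentIn_eq hy]
      exact mem_connectedComponentIn (hSU hz)
    · intro z
      have e1 := congrArg (Polynomial.eval z) (pr_mul s1 W)
      have e2 := congrArg (Polynomial.eval z) (pr_mul t W)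
      rw [hs1m.leadingCoeff] at e1
      rw [hn.lead] at e2
      simp only [Polynomial.eval_mul, Polynomial.eval_C] at e1 e2
      rw [qq, e1, e2, mul_div_mul_left _ _ hm]
    · intro v hv hub
      exact key_claim h hn hξ hs1 hE hll hLc hLe hLl ⟨x, Or.inl (mem_connectedComponentIn hx)⟩ hRp.le
        (fun z hz => (hR z hz).1) (fun z hz => (hR z hz).2.1) (fun z hz => (hR z hz).2.2.1)
        (fun z hz => by
          by_contra hlt
          exact (hR z (not_lt.mp hlt)).2.2.2.2.2 hz) hv hub v (mem_connectedComponentIn hv)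
  have := hfin.final
  rw [pr_deg, pr_deg] at this
  exact this.symm

end NW
end

section
open Complex Set Filter Topology Metric
namespace NW
open Polynomial

noncomputable def sp (A : Finset ℂ) : ℂ[X] := ∏ a ∈ A, (X - C a)
noncomputable def tp (A : Finset ℂ) (k : ℂ → ℕ) : ℂ[X] := ∑ a ∈ A, C (k a : ℂ) * sp (A.erase a)
noncomputable def dp (A : Finset ℂ) (k : ℂ → ℕ) (c : ℂ) : ℂ[X] := C c * ∏ a ∈ A, (X - C a) ^ (k a - 1)

lemma sp_monic (A : Finset ℂ) : (sp A).Monic := monic_prod_of_monic _ _ fun a _ => monic_X_sub_C a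

lemma sp_deg (A : Finset ℂ) : (sp A).natDegree = A.card := by
  rw [sp, natDegree_prod_of_monic _ _ fun a _ => monic_X_sub_C a]; simp

lemma sp_roots (A : Finset ℂ) : (sp A).roots = A.val := roots_prod_X_sub_C A

lemma sp_erase {A : Finset ℂ} {a : ℂ} (h : a ∈ A) : sp A = (X - C a) * sp (A.erase a) :=
  (Finset.mul_prod_erase A _ h).symm

lemma sp_eval {A : Finset ℂ} {z : ℂ} : (sp A).eval z = 0 ↔ z ∈ A := by
  rw [← IsRoot.def, ← mem_roots (sp_monic A).ne_zero, sp_roots]; rfl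

lemma dp_sp {A : Finset ℂ} {k : ℂ → ℕ} (hk : ∀ a ∈ A, 1 ≤ k a) (c : ℂ) :
    C c * ∏ a ∈ A, (X - C a) ^ k a = dp A k c * sp A := by
  rw [dp, sp, mul_assoc, ← Finset.prod_mul_distrib]
  congr 1
  refine Finset.prod_congr rfl fun a ha => ?_
  rw [← pow_succ, Nat.sub_add_cancel (hk a ha)]

lemma dp_tp {A : Finset ℂ} {k : ℂ → ℕ} (hk : ∀ a ∈ A, 1 ≤ k a) (c : ℂ) :
    derivative (C c * ∏ a ∈ A, (X - C a) ^ k a) = dp A k c * tp A k := by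
  rw [derivative_C_mul, derivative_prod_finset, dp, tp, mul_assoc]
  congr 1
  rw [Finset.mul_sum]
  refine Finset.sum_congr rfl fun a ha => ?_
  rw [derivative_X_sub_C_pow, ← Finset.mul_prod_erase A (fun a => (X - C a) ^ (k a - 1)) ha]
  have : ∏ b ∈ A.erase a, (X - C b) ^ k b = (∏ b ∈ A.erase a, (X - C b) ^ (k b - 1)) * sp (A.erase a) := by
    rw [sp, ← Finset.prod_mul_distrib]
    refine Finset.prod_congr rfl fun b hb => ?_
    rw [← pow_succ, Nat.sub_add_cancel (hk b (Finset.mem_of_mem_erase hb))]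
  rw [this]; simp only [map_natCast]; ring

lemma tp_coeff (A : Finset ℂ) (k : ℂ → ℕ) : (tp A k).coeff (A.card - 1) = ((∑ a ∈ A, k a : ℕ) : ℂ) := by
  rw [tp, finsetSum_coeff, Nat.cast_sum]
  refine Finset.sum_congr rfl fun a ha => ?_
  have h := (sp_monic (A.erase a)).coeff_natDegree
  rw [sp_deg, Finset.card_erase_of_mem ha] at h
  rw [coeff_C_mul, h, mul_one]

lemma tp_degle (A : Finset ℂ) (k : ℂ → ℕ) : (tp A k).natDegree ≤ A.card - 1 := by
  refine natDegree_sum_le_of_forall_le _ _ fun a ha => ?_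
  refine (natDegree_C_mul_le _ _).trans ?_
  rw [sp_deg, Finset.card_erase_of_mem ha]

lemma ns_of {A : Finset ℂ} {k : ℂ → ℕ} (hk : ∀ a ∈ A, 1 ≤ k a) (hA : 2 ≤ A.card) :
    NS (sp A) (tp A k) (∑ a ∈ A, k a) := by
  have h2 : A.card ≤ ∑ a ∈ A, k a := by
    rw [Finset.card_eq_sum_ones]; exact Finset.sum_le_sum hk
  have hd : (tp A k).natDegree = A.card - 1 := by
    refine le_antisymm (tp_degle A k) (le_natDegree_of_ne_zero ?_)
    rw [tp_coeff]
    exact_mod_cast (by omega)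
  refine ⟨sp_monic A, ?_, ?_, by omega, ?_⟩
  · rw [sp_deg, hd]; omega
  · rw [leadingCoeff, hd, tp_coeff]
  · intro z hz
    have hz' := sp_eval.mp hz
    have h3 : (derivative (sp A)).eval z = (sp (A.erase z)).eval z := by
      rw [sp_erase hz']; simp
    have h4 : (sp (A.erase z)).eval z ≠ 0 := fun h => by simpa using sp_eval.mp h
    refine ⟨k z, hk z hz', ?_, h3 ▸ h4⟩
    rw [h3, tp, eval_finsetSum, Finset.sum_eq_single z]
    · simp
    · intro b hb hbz
      rw [eval_mul, sp_eval.mpr (Finset.mem_erase.mpr ⟨hbz.symm, hz'⟩), mul_zero]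
    · exact fun h => absurd hz' h


lemma p_eq {p : ℂ[X]} : p = C p.leadingCoeff * ∏ a ∈ p.roots.toFinset, (X - C a) ^ p.roots.count a := by
  conv_lhs => rw [(IsAlgClosed.splits p).eq_prod_roots]
  rw [Finset.prod_multiset_map_count]

open Classical in
theorem newton_count (p : ℂ[X]) (hroots : 3 ≤ p.roots.toFinset.card)
    (ξ : ℂ) (hroot : p.eval ξ = 0)
    (W : Set ℂ) (hW : ∃ w ∈ (NewtonImmediateBasin p ξ)ᶜ,
      W = connectedComponentIn (NewtonImmediateBasin p ξ)ᶜ w) :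
    (p.roots.toFinset.filter (fun z => z ∈ W)).card =
      Multiset.card ((derivative p).roots.filter (fun z => z ∈ W ∧ p.eval z ≠ 0)) := by
  have hp0 : p ≠ 0 := by rintro rfl; simp at hroots
  set A := p.roots.toFinset with hA
  set k : ℂ → ℕ := fun a => p.roots.count a with hk'
  have hk : ∀ a ∈ A, 1 ≤ k a := fun a ha => Multiset.one_le_count_iff_mem.mpr (Multiset.mem_toFinset.mp ha)
  set D := dp A k p.leadingCoeff with hD
  have hpD : p = D * sp A := (p_eq).trans (dp_sp hk _)
  have hpD' : derivative p = D * tp A k := (congrArg derivative p_eq).trans (dp_tp hk _)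
  have hn := ns_of hk (by omega : 2 ≤ A.card)
  have hD0 : D ≠ 0 := by intro h; rw [h, zero_mul] at hpD; exact hp0 hpD
  have hDs : ∀ z, D.eval z = 0 → (sp A).eval z = 0 := by
    intro z hz
    rw [sp_eval, hA, Multiset.mem_toFinset, mem_roots hp0, IsRoot.def, hpD, eval_mul, hz, zero_mul]
  have hN : NewtonMap p = NN (sp A) (tp A k) := by
    funext z
    rw [NewtonMap, NN, hpD', eval_mul]
    have : p.eval z = D.eval z * (sp A).eval z := by conv_lhs => rw [hpD, eval_mul]
    rw [this]
    by_cases hz : D.eval z = 0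
    · rw [hDs z hz]; simp
    · rw [mul_div_mul_left _ _ hz]
  have hξA : ξ ∈ A := by rw [hA, Multiset.mem_toFinset, mem_roots hp0]; exact hroot
  have hsξ : (sp A).eval ξ = 0 := sp_eval.mpr hξA
  have hB : NewtonImmediateBasin p ξ = basinU (sp A) (tp A k) ξ := by
    rw [NewtonImmediateBasin, NewtonBasin, hN]; rfl
  obtain ⟨w, hw, rfl⟩ := hW
  rw [hB] at hw ⊢
  have key := main_count hn hsξ (sp_erase hξA) hw
  have hξU : ξ ∈ basinU (sp A) (tp A k) ξ := by
    refine mem_connectedComponentIn ?_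
    have : ∀ n, (NN (sp A) (tp A k))^[n] ξ = ξ := fun n =>
      Function.iterate_fixed (by rw [NN, hsξ]; simp) n
    show Tendsto _ _ _
    simp only [this]; exact tendsto_const_nhds
  set V := connectedComponentIn (basinU (sp A) (tp A k) ξ)ᶜ w with hV
  have hξV : ξ ∉ V := fun h => connectedComponentIn_subset _ _ h hξU
  have e1 : (A.filter (fun z => z ∈ V)) = (A.erase ξ).filter (fun z => z ∈ V) := by
    ext z
    simp only [Finset.mem_filter, Finset.mem_erase]
    constructor
    · rintro ⟨h1, h2⟩; exact ⟨⟨fun h => hξV (h ▸ h2), h1⟩, h2⟩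
    · rintro ⟨⟨_, h1⟩, h2⟩; exact ⟨h1, h2⟩
  rw [e1]
  rw [sp_roots] at key
  refine Eq.trans key ?_
  congr 1
  rw [hpD', roots_mul (mul_ne_zero hD0 hn.t0), Multiset.filter_add]
  have e2 : D.roots.filter (fun z => z ∈ V ∧ p.eval z ≠ 0) = 0 := by
    rw [Multiset.filter_eq_nil]
    rintro z hz ⟨_, h⟩
    have : D.eval z = 0 := isRoot_of_mem_roots hz
    rw [hpD, eval_mul, this, zero_mul] at h
    exact h rfl
  rw [e2, zero_add]
  refine Multiset.filter_congr fun z hz => ?_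
  have h1 : (tp A k).eval z = 0 := isRoot_of_mem_roots hz
  have h2 : (sp A).eval z ≠ 0 := fun h => hn.cop h h1
  have h3 : p.eval z ≠ 0 := by
    rw [hpD, eval_mul]; exact mul_ne_zero (fun h => h2 (hDs z h)) h2
  simp [h3]

end NW
end

open scoped Classical in
/-- Theorem 2.5 (Fixed Points and Poles): if `W` is a connected component of the
complement of an immediate basin `U_ξ`, then the number of fixed points of the Newton
map in `W` (the distinct roots of `p` in `W`) equals the number of poles of the Newton
map in `W`, counted with multiplicities (the roots of `p'` in `W`, with multiplicity,
that are not roots of `p`). -/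
theorem newton_fixed_points_eq_poles_in_complement_component
    (p : Polynomial ℂ) (hroots : 3 ≤ p.roots.toFinset.card)
    (ξ : ℂ) (hroot : Polynomial.eval ξ p = 0)
    (W : Set ℂ) (hW : ∃ w ∈ (NewtonImmediateBasin p ξ)ᶜ,
      W = connectedComponentIn (NewtonImmediateBasin p ξ)ᶜ w) :
    (p.roots.toFinset.filter (fun z => z ∈ W)).card =
      Multiset.card ((Polynomial.derivative p).roots.filter
        (fun z => z ∈ W ∧ Polynomial.eval z p ≠ 0)) := by
  exact NW.newton_count p hroots ξ hroot W hW
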